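/- Let n ≥ 2 and let u : ℝⁿ → ℝ be a smooth entire function. Let g(x) = Iₙ + (D²u(x))² and let θ(x) = ∑ᵢ arctan λᵢ(x), where λ₁(x),…,λₙ(x) are the eigenvalues of the (symmetric) Hessian D²u(x). Suppose u solves the fourth-order Hamiltonian stationary equation Δ_g θ = 0, i.e. ∑_{i,j} ∂_j( √(det g(x)) (g(x)⁻¹)_{ij} ∂_i θ(x) ) = 0 for all x, and suppose there exists δ > 0 such that θ(x) > (n−2)·π/2 + δ for all x ∈ ℝⁿ. Then u is a quadratic polynomial; equivalently, D²u is a constant matrix and the gradient graph Γ = {(x, Du(x))} is a plane. -/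

import Mathlib

open Matrix MeasureTheory Metric Real

noncomputable section

/-- `ℝⁿ` with the Euclidean structure. -/
abbrev En (n : ℕ) := EuclideanSpace ℝ (Fin n)

/-- The partial derivative `∂ᵢ f (x)`. -/
def pdrv (n : ℕ) (i : Fin n) (f : En n → ℝ) (x : En n) : ℝ :=
  fderiv ℝ f x (EuclideanSpace.single i 1)

/-- The Hessian matrix `D²u(x)`. -/
def hess (n : ℕ) (u : En n → ℝ) (x : En n) : Matrix (Fin n) (Fin n) ℝ :=
  Matrix.of fun i j => pdrv n j (fun y => pdrv n i u y) x

/-- The divergence-form expression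
`∑_{i,j} ∂_j( √(det g(x)) (g(x)⁻¹)_{ij} ∂_i f(x) )` for the Laplace–Beltrami
operator of the metric `g` in coordinates. -/
def lapBel (n : ℕ) (g : En n → Matrix (Fin n) (Fin n) ℝ) (f : En n → ℝ) (x : En n) : ℝ :=
  ∑ i, ∑ j, pdrv n j (fun y => Real.sqrt (g y).det * (g y)⁻¹ i j * pdrv n i f y) x

section
set_option linter.all false
/-! ### Part A: weak subsolutions of uniformly elliptic divergence form equations -/

/-- The dual space of `ℝⁿ`. -/
abbrev Dn (n : ℕ) := En n →L[ℝ] ℝ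

/-- The bilinear form on covectors given by a coefficient matrix. -/
def bil {n : ℕ} (A : Matrix (Fin n) (Fin n) ℝ) (p q : Dn n) : ℝ :=
  ∑ i, ∑ j, A i j * p (EuclideanSpace.single i 1) * q (EuclideanSpace.single j 1)

lemma bil_add_right {n : ℕ} (A : Matrix (Fin n) (Fin n) ℝ) (p q r : Dn n) :
    bil A p (q + r) = bil A p q + bil A p r := by
  simp only [bil, _root_.add_apply, ← Finset.sum_add_distrib]
  exact Finset.sum_congr rfl fun i _ => Finset.sum_congr rfl fun j _ => by ring

lemma bil_smul_right {n : ℕ} (A : Matrix (Fin n) (Fin n) ℝ) (c : ℝ) (p q : Dn n) :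
    bil A p (c • q) = c * bil A p q := by
  simp only [bil, _root_.smul_apply, smul_eq_mul, Finset.mul_sum]
  exact Finset.sum_congr rfl fun i _ => Finset.sum_congr rfl fun j _ => by ring

lemma bil_smul_left {n : ℕ} (A : Matrix (Fin n) (Fin n) ℝ) (c : ℝ) (p q : Dn n) :
    bil A (c • p) q = c * bil A p q := by
  simp only [bil, _root_.smul_apply, smul_eq_mul, Finset.mul_sum]
  exact Finset.sum_congr rfl fun i _ => Finset.sum_congr rfl fun j _ => by ring

lemma bil_zero_right {n : ℕ} (A : Matrix (Fin n) (Fin n) ℝ) (p : Dn n) : bil A p 0 = 0 := by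
  simp [bil]

lemma bil_zero_left {n : ℕ} (A : Matrix (Fin n) (Fin n) ℝ) (p : Dn n) : bil A 0 p = 0 := by
  simp [bil]

/-- Uniformly elliptic continuous coefficient field (bilinear forms on covectors). -/
structure Ell {n : ℕ} (lam Lam : ℝ) (B : En n → Matrix (Fin n) (Fin n) ℝ) : Prop where
  cont : ∀ i j, Continuous fun x => B x i j
  lower : ∀ x p, lam * ‖p‖ ^ 2 ≤ bil (B x) p p
  upper : ∀ x p q, |bil (B x) p q| ≤ Lam * ‖p‖ * ‖q‖

/-- Weak subsolutions. -/
def IsSub {n : ℕ} (B : En n → Matrix (Fin n) (Fin n) ℝ) (v : En n → ℝ) : Prop :=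
  ∀ φ : En n → ℝ, ContDiff ℝ 1 φ → HasCompactSupport φ → (∀ x, 0 ≤ φ x) →
    ∫ x, bil (B x) (fderiv ℝ v x) (fderiv ℝ φ x) ≤ 0

section
variable {n : ℕ} {lam Lam : ℝ} {B : En n → Matrix (Fin n) (Fin n) ℝ} {v : En n → ℝ}

lemma fderiv_cont {v : En n → ℝ} (hv : ContDiff ℝ 1 v) : Continuous (fderiv ℝ v) :=
  hv.continuous_fderiv one_ne_zero

lemma diff_of_C1 {v : En n → ℝ} (hv : ContDiff ℝ 1 v) : Differentiable ℝ v :=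
  hv.differentiable one_ne_zero

/-- composition with a convex increasing function -/
lemma sub_comp (hv : ContDiff ℝ 1 v) (hs : IsSub B v)
    (f f' f'' : ℝ → ℝ) (hf : ∀ x, HasDerivAt f (f' (v x)) (v x))
    (hf' : ∀ x, HasDerivAt f' (f'' (v x)) (v x)) (hc : Continuous fun x => f'' (v x))
    (h0 : ∀ x, 0 ≤ f' (v x)) :
    ContDiff ℝ 1 (fun x => f (v x)) ∧
    (∀ x, fderiv ℝ (fun x => f (v x)) x = f' (v x) • fderiv ℝ v x) ∧
    ∀ φ : En n → ℝ, ContDiff ℝ 1 φ → HasCompactSupport φ → (∀ x, 0 ≤ φ x) →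
    ∫ x, (bil (B x) (fderiv ℝ (fun x => f (v x)) x) (fderiv ℝ φ x)
      + φ x * f'' (v x) * bil (B x) (fderiv ℝ v x) (fderiv ℝ v x)) ≤ 0 := by
  have hd : ∀ x, HasFDerivAt (fun x => f (v x)) (f' (v x) • fderiv ℝ v x) x := fun x =>
    (hf x).comp_hasFDerivAt x (diff_of_C1 hv x).hasFDerivAt
  have hd' : ∀ x, HasFDerivAt (fun x => f' (v x)) (f'' (v x) • fderiv ℝ v x) x := fun x =>
    (hf' x).comp_hasFDerivAt x (diff_of_C1 hv x).hasFDerivAt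
  have c' : ContDiff ℝ 1 (fun x => f' (v x)) := by
    rw [contDiff_one_iff_fderiv]
    refine ⟨fun x => (hd' x).differentiableAt, ?_⟩
    have : fderiv ℝ (fun x => f' (v x)) = fun x => f'' (v x) • fderiv ℝ v x := by
      ext1 x; exact (hd' x).fderiv
    rw [this]
    exact hc.smul (fderiv_cont hv)
  refine ⟨?_, fun x => (hd x).fderiv, ?_⟩
  · rw [contDiff_one_iff_fderiv]
    refine ⟨fun x => (hd x).differentiableAt, ?_⟩
    have : fderiv ℝ (fun x => f (v x)) = fun x => f' (v x) • fderiv ℝ v x := by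
      ext1 x; exact (hd x).fderiv
    rw [this]
    exact c'.continuous.smul (fderiv_cont hv)
  · intro φ hφ hφc hφ0
    have := hs (fun x => φ x * f' (v x)) (hφ.mul c') hφc.mul_right
      (fun x => mul_nonneg (hφ0 x) (h0 x))
    refine le_trans (le_of_eq ?_) this
    congr 1
    ext x
    have e : fderiv ℝ (fun x => φ x * f' (v x)) x
        = φ x • (f'' (v x) • fderiv ℝ v x) + f' (v x) • fderiv ℝ φ x :=
      ((diff_of_C1 hφ x).hasFDerivAt.mul (hd' x)).fderiv
    rw [e, (hd x).fderiv]
    simp only [bil_add_right, bil_smul_right, bil_smul_left]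
    ring

lemma int_cs {f : En n → ℝ} (hf : Continuous f) (hc : HasCompactSupport f) : Integrable f :=
  hf.integrable_of_hasCompactSupport hc

lemma B_cont (hB : Ell lam Lam B) {p q : En n → Dn n} (hp : Continuous p) (hq : Continuous q) :
    Continuous fun x => bil (B x) (p x) (q x) := by
  unfold bil
  refine continuous_finsetSum _ fun i _ => continuous_finsetSum _ fun j _ => ?_
  exact ((hB.cont i j).mul (hp.clm_apply continuous_const)).mul (hq.clm_apply continuous_const)

lemma sub_of_comp (hlam : 0 < lam) (hB : Ell lam Lam B) (hv : ContDiff ℝ 1 v) (hs : IsSub B v)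
    (f f' f'' : ℝ → ℝ) (hf : ∀ x, HasDerivAt f (f' (v x)) (v x))
    (hf' : ∀ x, HasDerivAt f' (f'' (v x)) (v x)) (hc : Continuous fun x => f'' (v x))
    (h0 : ∀ x, 0 ≤ f' (v x)) (h1 : ∀ x, 0 ≤ f'' (v x)) :
    IsSub B (fun x => f (v x)) := by
  obtain ⟨c1, e, h⟩ := sub_comp hv hs f f' f'' hf hf' hc h0
  intro φ hφ hφc hφ0
  refine le_trans (integral_mono ?_ ?_ ?_) (h φ hφ hφc hφ0)
  · apply int_cs (B_cont hB (fderiv_cont c1) (fderiv_cont hφ))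
    exact (hφc.fderiv ℝ).mono (fun x hx => by
      simp only [Function.mem_support] at hx ⊢; contrapose! hx; simp [hx, bil_zero_right])
  · apply int_cs
    · exact (B_cont hB (fderiv_cont c1) (fderiv_cont hφ)).add
        ((hφ.continuous.mul hc).mul (B_cont hB (fderiv_cont hv) (fderiv_cont hv)))
    · apply HasCompactSupport.add
      · exact (hφc.fderiv ℝ).mono (fun x hx => by
          simp only [Function.mem_support] at hx ⊢; contrapose! hx; simp [hx, bil_zero_right])
      · exact hφc.mul_right.mul_right
  · intro x
    have := (hB.lower x (fderiv ℝ v x))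
    have h2 : 0 ≤ bil (B x) (fderiv ℝ v x) (fderiv ℝ v x) := le_trans (by positivity) this
    have := mul_nonneg (mul_nonneg (hφ0 x) (h1 x)) h2
    simp only
    linarith

/-- Abstract absorption: a pointwise to integral Caccioppoli estimate. -/
lemma absorb {F A D : En n → ℝ} {K : ℝ} (hA : Integrable A) (hD : Integrable D)
    (hF : Integrable F) (h : ∫ x, F x ≤ 0)
    (hp : ∀ x, lam * A x - K * D x ≤ 2 * F x) : lam * ∫ x, A x ≤ K * ∫ x, D x := by
  have : ∫ x, (lam * A x - K * D x) ≤ ∫ x, 2 * F x :=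
    integral_mono ((hA.const_mul _).sub (hD.const_mul _)) (hF.const_mul _) hp
  rw [integral_sub (hA.const_mul _) (hD.const_mul _), integral_const_mul, integral_const_mul,
    integral_const_mul] at this
  linarith

lemma hsq {η : En n → ℝ} (hηc : HasCompactSupport η) :
    HasCompactSupport fun x => (η x) ^ 2 :=
  hηc.mono (fun x hx => by simpa using hx)

/-- Caccioppoli inequality. -/
lemma cacc (hlam : 0 < lam) (hB : Ell lam Lam B) (hv : ContDiff ℝ 1 v) (hs : IsSub B v)
    (h0 : ∀ x, 0 ≤ v x) {η : En n → ℝ} (hη : ContDiff ℝ 1 η) (hηc : HasCompactSupport η) :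
    lam * ∫ x, (η x) ^ 2 * ‖fderiv ℝ v x‖ ^ 2 ≤
      (4 * Lam ^ 2 / lam) * ∫ x, (v x) ^ 2 * ‖fderiv ℝ η x‖ ^ 2 := by
  have key := hs (fun x => (η x) ^ 2 * v x) ((hη.pow 2).mul hv)
    (hsq hηc).mul_right (fun x => mul_nonneg (sq_nonneg _) (h0 x))
  have e : ∀ x, fderiv ℝ (fun x => (η x) ^ 2 * v x) x
      = (η x) ^ 2 • fderiv ℝ v x + (2 * η x * v x) • fderiv ℝ η x := by
    intro x
    have h1 : HasFDerivAt (fun x => (η x) ^ 2) ((2 * η x) • fderiv ℝ η x) x := by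
      simpa using (diff_of_C1 hη x).hasFDerivAt.pow 2
    refine (h1.mul (diff_of_C1 hv x).hasFDerivAt).fderiv.trans ?_
    rw [smul_smul]
    congr 2; ring
  have hcD : HasCompactSupport fun x => (v x) ^ 2 * ‖fderiv ℝ η x‖ ^ 2 :=
    (hηc.fderiv ℝ).mono (fun x hx => by
      simp only [Function.mem_support] at hx ⊢; contrapose! hx; simp [hx, bil_zero_right])
  refine absorb (F := fun x => bil (B x) (fderiv ℝ v x)
    (fderiv ℝ (fun x => (η x) ^ 2 * v x) x)) ?_ ?_ ?_ key ?_
  · apply int_cs ((hη.continuous.pow 2).mul ((fderiv_cont hv).norm.pow 2))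
    exact HasCompactSupport.mul_right (hsq hηc)
  · exact int_cs ((hv.continuous.pow 2).mul ((fderiv_cont hη).norm.pow 2)) hcD
  · apply int_cs
    · simp_rw [e]
      exact B_cont hB (fderiv_cont hv) (((hη.continuous.pow 2).smul (fderiv_cont hv)).add
        (((continuous_const.mul hη.continuous).mul hv.continuous).smul (fderiv_cont hη)))
    · have : HasCompactSupport (fun x => (η x) ^ 2 * v x) :=
        HasCompactSupport.mul_right (hsq hηc)
      exact (this.fderiv ℝ).mono (fun x hx => by
        simp only [Function.mem_support] at hx ⊢; contrapose! hx; simp [hx, bil_zero_right])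
  · intro x
    rw [e]
    simp only [bil_add_right, bil_smul_right, bil_smul_left]
    have h1 := hB.lower x (fderiv ℝ v x)
    have h2 := hB.upper x (fderiv ℝ v x) (fderiv ℝ η x)
    set a := ‖fderiv ℝ v x‖
    set b := ‖fderiv ℝ η x‖
    set t := bil (B x) (fderiv ℝ v x) (fderiv ℝ η x)
    have h3 : -(2 * η x * v x * t) ≤ |2 * η x * v x| * (Lam * a * b) := by
      calc _ ≤ |2 * η x * v x * t| := neg_le_abs _
        _ = |2 * η x * v x| * |t| := abs_mul _ _
        _ ≤ _ := by gcongr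
    have h4 : |2 * η x * v x| * (Lam * a * b) = 2 * (|η x| * a) * (Lam * (|v x| * b)) := by
      rw [abs_mul, abs_mul, abs_two]; ring
    have h5 : 4 * (|η x| * a) * (Lam * (|v x| * b)) ≤ lam * (|η x| * a) ^ 2 +
        4 / lam * (Lam * (|v x| * b)) ^ 2 := by
      have : lam * (|η x| * a) ^ 2 + 4 / lam * (Lam * (|v x| * b)) ^ 2
        - 4 * (|η x| * a) * (Lam * (|v x| * b)) = (1 / lam) *
          (lam * (|η x| * a) - 2 * (Lam * (|v x| * b))) ^ 2 := by field_simp; ring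
      have h6 : 0 ≤ (1 / lam) * (lam * (|η x| * a) - 2 * (Lam * (|v x| * b))) ^ 2 := by positivity
      linarith
    have h7 : (|η x| * a) ^ 2 = (η x) ^ 2 * a ^ 2 := by rw [mul_pow, sq_abs]
    have h8 : (Lam * (|v x| * b)) ^ 2 = Lam ^ 2 * ((v x) ^ 2 * b ^ 2) := by
      rw [mul_pow, mul_pow, sq_abs]
    have h9 := mul_le_mul_of_nonneg_left h1 (sq_nonneg (η x))
    rw [h7, h8] at h5
    have h10 : 4 * Lam ^ 2 / lam * ((v x) ^ 2 * b ^ 2) = 4 / lam * (Lam ^ 2 * ((v x) ^ 2 * b ^ 2)) := by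
      ring
    rw [h10]
    linarith

end
end

section
set_option linter.all false
lemma smoothTransition_deriv_bound : ∃ K : ℝ, 0 < K ∧ ∀ t, |deriv Real.smoothTransition t| ≤ K := by
  have hc : Continuous (deriv Real.smoothTransition) :=
    (Real.smoothTransition.contDiff (n := 1)).continuous_deriv le_rfl
  have hs : HasCompactSupport (deriv Real.smoothTransition) := by
    refine HasCompactSupport.intro (K := Set.Icc 0 1) isCompact_Icc (fun x hx => ?_)
    rw [Set.mem_Icc, not_and_or, not_le, not_le] at hx
    rcases hx with hx | hx
    · have : Real.smoothTransition =ᶠ[nhds x] fun _ => 0 := by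
        filter_upwards [Iio_mem_nhds hx] with y hy
        exact Real.smoothTransition.zero_of_nonpos (le_of_lt hy)
      rw [this.deriv_eq]; simp
    · have : Real.smoothTransition =ᶠ[nhds x] fun _ => 1 := by
        filter_upwards [Ioi_mem_nhds hx] with y hy
        exact Real.smoothTransition.one_of_one_le (le_of_lt hy)
      rw [this.deriv_eq]; simp
  obtain ⟨C, hC⟩ := hc.bounded_above_of_compact_support hs
  exact ⟨|C| + 1, by positivity, fun t => (hC t).trans ((le_abs_self C).trans (by linarith))⟩

/-- Cutoff functions with gradient bounds. -/
lemma exists_cutoff (n : ℕ) : ∃ K : ℝ, 0 < K ∧ ∀ r r' : ℝ, 0 < r → r < r' →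
    ∃ η : En n → ℝ, ContDiff ℝ 1 η ∧ HasCompactSupport η ∧ (∀ x, 0 ≤ η x ∧ η x ≤ 1) ∧
      (∀ x, ‖x‖ ≤ r → η x = 1) ∧ (∀ x, r' < ‖x‖ → η x = 0) ∧ (∀ x, r' < ‖x‖ → fderiv ℝ η x = 0) ∧
      ∀ x, ‖fderiv ℝ η x‖ ≤ K / (r' - r) := by
  obtain ⟨K, hK, hKb⟩ := smoothTransition_deriv_bound
  refine ⟨2 * K, by positivity, fun r r' hr hrr => ?_⟩
  have hd : 0 < r' ^ 2 - r ^ 2 := by nlinarith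
  have hd' : 0 < r' - r := by linarith
  let s : En n → ℝ := fun x => (r' ^ 2 - ‖x‖ ^ 2) / (r' ^ 2 - r ^ 2)
  have hs : ContDiff ℝ 1 s := by
    apply ContDiff.div_const
    exact contDiff_const.sub (contDiff_norm_sq ℝ)
  let η : En n → ℝ := fun x => Real.smoothTransition (s x)
  have hη : ContDiff ℝ 1 η := (Real.smoothTransition.contDiff (n := 1)).comp hs
  have hz : ∀ x, r' < ‖x‖ → η x = 0 := fun x hx => by
    apply Real.smoothTransition.zero_of_nonpos
    apply div_nonpos_of_nonpos_of_nonneg _ hd.le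
    nlinarith
  have hz' : ∀ x, r' < ‖x‖ → fderiv ℝ η x = 0 := fun x hx => by
    have : η =ᶠ[nhds x] fun _ => 0 := by
      filter_upwards [(isOpen_lt continuous_const continuous_norm).mem_nhds hx] with y hy
      exact hz y hy
    rw [this.fderiv_eq]; simp
  refine ⟨η, hη, ?_, fun x => ⟨Real.smoothTransition.nonneg _, Real.smoothTransition.le_one _⟩, ?_,
    hz, hz', ?_⟩
  · refine HasCompactSupport.intro (isCompact_closedBall (0 : En n) r') (fun x hx => hz x ?_)
    simpa using hx
  · intro x hx
    apply Real.smoothTransition.one_of_one_le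
    rw [one_le_div hd]
    nlinarith [norm_nonneg x]
  · intro x
    by_cases hx : r' < ‖x‖
    · rw [hz' x hx, norm_zero]; positivity
    · push Not at hx
      have h1 : HasFDerivAt s ((r' ^ 2 - r ^ 2)⁻¹ • (-(2 • innerSL ℝ x) : En n →L[ℝ] ℝ)) x := by
        have := ((hasStrictFDerivAt_norm_sq x).hasFDerivAt.const_sub (r' ^ 2)).const_smul
          ((r' ^ 2 - r ^ 2)⁻¹)
        refine this.congr_of_eventuallyEq (Filter.Eventually.of_forall fun y => ?_)
        simp [s, div_eq_inv_mul]
      have h2 : HasDerivAt Real.smoothTransition (deriv Real.smoothTransition (s x)) (s x) :=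
        ((Real.smoothTransition.contDiff (n := 1)).differentiable one_ne_zero _).hasDerivAt
      have h3 : fderiv ℝ η x = deriv Real.smoothTransition (s x) •
          ((r' ^ 2 - r ^ 2)⁻¹ • (-(2 • innerSL ℝ x) : En n →L[ℝ] ℝ)) := (h2.comp_hasFDerivAt x h1).fderiv
      have h4 : ‖(2 • innerSL ℝ x : En n →L[ℝ] ℝ)‖ ≤ 2 * r' := by
        rw [two_nsmul]
        refine (norm_add_le _ _).trans ?_
        rw [innerSL_apply_norm]; linarith
      rw [h3, norm_smul, norm_smul, norm_neg, Real.norm_eq_abs, Real.norm_eq_abs,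
        abs_of_pos (inv_pos.mpr hd)]
      calc _ ≤ K * ((r' ^ 2 - r ^ 2)⁻¹ * (2 * r')) := by
            gcongr
            exact hKb _
        _ ≤ 2 * K / (r' - r) := by
            have : r' ^ 2 - r ^ 2 = (r' - r) * (r' + r) := by ring
            have hrp : 0 < r' + r := by linarith
            rw [this, inv_mul_eq_div, mul_div_assoc', div_le_div_iff₀ (by positivity) hd']
            nlinarith [mul_pos hK hd', mul_pos (mul_pos hK hd') hr]

/-- Sobolev inequality (real integrals). -/
lemma sobolev_real (n : ℕ) (hn : 2 ≤ n) : ∃ C : ℝ, 0 < C ∧ ∀ f : En n → ℝ, ContDiff ℝ 1 f →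
    HasCompactSupport f → (∀ x, 0 ≤ f x) →
    ∫ x, (f x) ^ ((n : ℝ) / (n - 1)) ≤ C * (∫ x, ‖fderiv ℝ f x‖) ^ ((n : ℝ) / (n - 1)) := by
  set χ := (n : ℝ) / (n - 1) with hχ
  have hn' : (2 : ℝ) ≤ n := by exact_mod_cast hn
  have hχ0 : 0 < χ := by apply div_pos <;> linarith
  have hconj : Real.HolderConjugate (Module.finrank ℝ (En n)) χ := by
    rw [finrank_euclideanSpace_fin]
    rw [Real.holderConjugate_iff_eq_conjExponent (by linarith)]
  set C0 := lintegralPowLePowLIntegralFDerivConst (volume : Measure (En n)) χ with hC0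
  refine ⟨(C0 : ℝ) + 1, by positivity, fun f hf hfc hf0 => ?_⟩
  have h := lintegral_pow_le_pow_lintegral_fderiv (volume : Measure (En n)) hf hfc hconj
  have i1 : Integrable (fun x => (f x) ^ χ) := by
    apply int_cs
    · exact hf.continuous.rpow_const (fun x => Or.inr hχ0.le)
    · exact hfc.mono (fun x hx => by
        simp only [Function.mem_support] at hx ⊢; contrapose! hx; simp [hx, hχ0.ne'])
  have i2 : Integrable (fun x => ‖fderiv ℝ f x‖) :=
    int_cs (fderiv_cont hf).norm (hfc.fderiv ℝ).norm
  have e1 : ∫⁻ x, ‖f x‖ₑ ^ χ = ENNReal.ofReal (∫ x, (f x) ^ χ) := by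
    rw [ofReal_integral_eq_lintegral_ofReal i1
      (Filter.Eventually.of_forall fun x => Real.rpow_nonneg (hf0 x) _)]
    refine lintegral_congr fun x => ?_
    rw [← ofReal_norm_eq_enorm, Real.norm_of_nonneg (hf0 x),
      ENNReal.ofReal_rpow_of_nonneg (hf0 x) hχ0.le]
  have e2 : ∫⁻ x, ‖fderiv ℝ f x‖ₑ = ENNReal.ofReal (∫ x, ‖fderiv ℝ f x‖) := by
    rw [ofReal_integral_eq_lintegral_ofReal i2 (Filter.Eventually.of_forall fun x => norm_nonneg _)]
    refine lintegral_congr fun x => ?_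
    rw [← ofReal_norm_eq_enorm]
  have h0 : 0 ≤ ∫ x, ‖fderiv ℝ f x‖ := integral_nonneg fun x => norm_nonneg _
  rw [← hC0, e1, e2, ENNReal.ofReal_rpow_of_nonneg h0 hχ0.le,
    ← ENNReal.ofReal_coe_nnreal, ← ENNReal.ofReal_mul (NNReal.coe_nonneg C0),
    ENNReal.ofReal_le_ofReal_iff (mul_nonneg (NNReal.coe_nonneg C0) (Real.rpow_nonneg h0 _))] at h
  refine h.trans ?_
  gcongr
  simp [C0]
end

section
set_option linter.all false
lemma cont_int_ball {n : ℕ} {f : En n → ℝ} (hf : Continuous f) (r : ℝ) :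
    IntegrableOn f (closedBall 0 r) :=
  hf.continuousOn.integrableOn_compact (isCompact_closedBall _ _)

lemma moser_step (n : ℕ) (hn : 2 ≤ n) (lam Lam : ℝ) (hlam : 0 < lam) :
    ∃ C : ℝ, 0 < C ∧ ∀ (B : En n → Matrix (Fin n) (Fin n) ℝ) (z : En n → ℝ), Ell lam Lam B →
    ContDiff ℝ 1 z → IsSub B z → (∀ x, 0 ≤ z x) → ∀ r r' : ℝ, 0 < r → r < r' →
    ∫ x in closedBall 0 r, ((z x) ^ ((n : ℝ) / (n - 1))) ^ 2 ≤
      (C / (r' - r) * ∫ x in closedBall 0 r', (z x) ^ 2) ^ ((n : ℝ) / (n - 1)) := by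
  obtain ⟨K, hK, hcut⟩ := exists_cutoff n
  obtain ⟨S, hS, hsob⟩ := sobolev_real n hn
  set χ := (n : ℝ) / (n - 1) with hχ
  have hn' : (2 : ℝ) ≤ n := by exact_mod_cast hn
  have hχ0 : 0 < χ := by apply div_pos <;> linarith
  refine ⟨S ^ (1 / χ) * ((3 + 4 * Lam ^ 2 / lam ^ 2) * K), by positivity, ?_⟩
  intro B z hB hz hsub hz0 r r' hr hrr
  obtain ⟨η, hη, hηc, hη01, hη1, hηz, hηdz, hηd⟩ := hcut r r' hr hrr
  have hd : 0 < r' - r := by linarith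
  set D := K / (r' - r) with hD
  have hD0 : 0 < D := by positivity
  set I := ∫ x in closedBall 0 r', (z x) ^ 2 with hI
  have hI0 : 0 ≤ I := integral_nonneg fun x => sq_nonneg _
  have hzz : Continuous fun x => (z x) ^ 2 := hz.continuous.pow 2
  -- step 1
  have s1 : ∫ x, (z x) ^ 2 * ‖fderiv ℝ η x‖ ^ 2 ≤ D ^ 2 * I := by
    rw [← setIntegral_eq_integral_of_forall_compl_eq_zero (s := closedBall 0 r'), hI,
      ← integral_const_mul]
    · refine setIntegral_mono_on ?_ ?_ measurableSet_closedBall ?_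
      · exact cont_int_ball (hzz.mul ((fderiv_cont hη).norm.pow 2)) _
      · exact (cont_int_ball hzz _).const_mul _
      · intro x _
        rw [mul_comm]
        gcongr
        exact hηd x
    · intro x hx
      rw [hηdz x (by simpa using hx)]; simp
  -- step 2
  have s2 : ∫ x, (η x) ^ 2 * ‖fderiv ℝ z x‖ ^ 2 ≤ 4 * Lam ^ 2 / lam ^ 2 * D ^ 2 * I := by
    have h := cacc hlam hB hz hsub hz0 hη hηc
    have h' : lam * ∫ x, (η x) ^ 2 * ‖fderiv ℝ z x‖ ^ 2 ≤ 4 * Lam ^ 2 / lam * (D ^ 2 * I) :=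
      h.trans (by gcongr)
    rw [← le_div_iff₀' hlam] at h'
    refine h'.trans (le_of_eq ?_)
    field_simp
  -- step 3
  let f : En n → ℝ := fun x => (η x * z x) ^ 2
  have hf : ContDiff ℝ 1 f := (hη.mul hz).pow 2
  have hfc : HasCompactSupport f := hsq hηc.mul_right
  have ind : ∫ x, (closedBall (0 : En n) r').indicator (fun x => (z x) ^ 2) x = I :=
    integral_indicator measurableSet_closedBall
  have indi : Integrable ((closedBall (0 : En n) r').indicator (fun x => (z x) ^ 2)) :=
    (integrable_indicator_iff measurableSet_closedBall).mpr (cont_int_ball hzz _)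
  have i2 : Integrable fun x => (η x) ^ 2 * ‖fderiv ℝ z x‖ ^ 2 :=
    int_cs ((hη.continuous.pow 2).mul ((fderiv_cont hz).norm.pow 2)) (hsq hηc).mul_right
  have s3 : ∫ x, ‖fderiv ℝ f x‖ ≤ (3 + 4 * Lam ^ 2 / lam ^ 2) * D * I := by
    have hp : ∀ x, ‖fderiv ℝ f x‖ ≤ 3 * D * (closedBall (0 : En n) r').indicator (fun x => (z x) ^ 2) x
        + 1 / D * ((η x) ^ 2 * ‖fderiv ℝ z x‖ ^ 2) := by
      intro x
      have e : fderiv ℝ f x = (2 * (η x * z x)) • (η x • fderiv ℝ z x + z x • fderiv ℝ η x) := by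
        have h1 := ((diff_of_C1 hη x).hasFDerivAt.mul (diff_of_C1 hz x).hasFDerivAt).pow 2
        refine h1.fderiv.trans ?_
        simp
      by_cases hx : r' < ‖x‖
      · rw [e, hηz x hx]
        simp [Set.indicator, not_le.mpr hx]
      · push Not at hx
        rw [Set.indicator_of_mem (by simpa using hx)]
        have hb := hηd x
        obtain ⟨h0, h1⟩ := hη01 x
        have hzx := hz0 x
        have n1 : ‖fderiv ℝ f x‖ ≤ 2 * (η x * z x) * (η x * ‖fderiv ℝ z x‖ + z x * ‖fderiv ℝ η x‖) := by
          rw [e, norm_smul, Real.norm_of_nonneg (by positivity)]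
          gcongr
          refine (norm_add_le _ _).trans ?_
          rw [norm_smul, norm_smul, Real.norm_of_nonneg h0, Real.norm_of_nonneg hzx]
        refine n1.trans ?_
        set a := ‖fderiv ℝ z x‖
        set b := ‖fderiv ℝ η x‖
        have hb0 : 0 ≤ b := norm_nonneg _
        have t1 : 2 * (η x * z x) * (z x * b) ≤ 2 * D * (z x) ^ 2 := by
          calc 2 * (η x * z x) * (z x * b) ≤ 2 * (1 * z x) * (z x * D) := by gcongr
            _ = _ := by ring
        have t2 : 2 * (η x * z x) * (η x * a) ≤ D * (z x) ^ 2 + 1 / D * ((η x) ^ 2 * a ^ 2) := by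
          have t3 : 2 * (η x * z x) * (η x * a) ≤ 2 * (1 * z x) * (η x * a) := by gcongr
          have t4 : D * (z x) ^ 2 + 1 / D * ((η x) ^ 2 * a ^ 2) - 2 * (1 * z x) * (η x * a) =
            1 / D * (D * z x - η x * a) ^ 2 := by field_simp; ring
          have t5 : 0 ≤ 1 / D * (D * z x - η x * a) ^ 2 := by positivity
          linarith
        linarith
    have := integral_mono (int_cs (fderiv_cont hf).norm (hfc.fderiv ℝ).norm)
      ((indi.const_mul (3 * D)).add (i2.const_mul (1 / D))) hp
    rw [integral_add' (indi.const_mul (3 * D)) (i2.const_mul (1 / D)), integral_const_mul,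
      integral_const_mul, ind] at this
    refine this.trans ?_
    calc _ ≤ 3 * D * I + 1 / D * (4 * Lam ^ 2 / lam ^ 2 * D ^ 2 * I) := by gcongr
      _ = _ := by field_simp
  have s4 := hsob f hf hfc (fun x => sq_nonneg _)
  have s5 : ∫ x in closedBall 0 r, ((z x) ^ χ) ^ 2 ≤ ∫ x, (f x) ^ χ := by
    have hfχ : Continuous fun x => (f x) ^ χ := hf.continuous.rpow_const (fun x => Or.inr hχ0.le)
    have hinteg : Integrable fun x => (f x) ^ χ := by
      apply int_cs hfχ
      exact hfc.mono (fun x hx => by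
        simp only [Function.mem_support] at hx ⊢; contrapose! hx; simp [hx, hχ0.ne'])
    have e : ∫ x in closedBall 0 r, ((z x) ^ χ) ^ 2 = ∫ x in closedBall 0 r, (f x) ^ χ := by
      refine setIntegral_congr_fun measurableSet_closedBall fun x hx => ?_
      simp only [f]
      rw [hη1 x (by simpa using hx), one_mul, ← Real.rpow_natCast, ← Real.rpow_natCast,
        ← Real.rpow_mul (hz0 x), ← Real.rpow_mul (hz0 x), mul_comm]
    rw [e]
    exact setIntegral_le_integral hinteg (Filter.Eventually.of_forall fun x =>
      Real.rpow_nonneg (sq_nonneg _) _)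
  refine s5.trans (s4.trans ?_)
  calc S * (∫ x, ‖fderiv ℝ f x‖) ^ χ ≤ S * ((3 + 4 * Lam ^ 2 / lam ^ 2) * D * I) ^ χ := by
        have : 0 ≤ ∫ x, ‖fderiv ℝ f x‖ := integral_nonneg fun x => norm_nonneg _
        gcongr
    _ = (S ^ (1 / χ)) ^ χ * ((3 + 4 * Lam ^ 2 / lam ^ 2) * D * I) ^ χ := by
        rw [← Real.rpow_mul hS.le, one_div, inv_mul_cancel₀ hχ0.ne', Real.rpow_one]
    _ = _ := by
        rw [← Real.mul_rpow (by positivity) (by positivity)]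
        congr 1
        rw [hD]; ring
end

section
set_option linter.all false
lemma moser_rec (χ C : ℝ) (hχ : 1 < χ) (hC : 0 < C) : ∃ L : ℝ, 0 < L ∧ ∀ a : ℕ → ℝ,
    (∀ k, 0 ≤ a k) → (∀ k, a (k + 1) ≤ (C * 2 ^ k * a k) ^ χ) →
    ∀ k, L * a k ≤ (L * a 0) ^ (χ ^ k) := by
  have hβ : 0 < χ - 1 := by linarith
  obtain ⟨b, hb1, hbχ⟩ : ∃ b : ℝ, 1 ≤ b ∧ b ^ (χ - 1) = 2 ^ χ :=
    ⟨(2 : ℝ) ^ (χ / (χ - 1)), Real.one_le_rpow (by norm_num) (by positivity), by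
      rw [← Real.rpow_mul (by norm_num), div_mul_cancel₀ _ hβ.ne']⟩
  have hb0 : 0 < b := by linarith
  obtain ⟨L, hL0, hLχ⟩ : ∃ L : ℝ, 0 < L ∧ L ^ (χ - 1) = b * C ^ χ :=
    ⟨(b * C ^ χ) ^ (1 / (χ - 1)), by positivity, by
      rw [← Real.rpow_mul (by positivity), one_div, inv_mul_cancel₀ hβ.ne', Real.rpow_one]⟩
  have hx : ∀ t : ℝ, 0 < t → t * t ^ (χ - 1) = t ^ χ := fun t ht => by
    rw [Real.rpow_sub_one ht.ne']; field_simp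
  refine ⟨L, hL0, fun a ha h k => ?_⟩
  have key : ∀ k, L * b ^ k * a k ≤ (L * a 0) ^ (χ ^ k) := by
    intro k
    induction k with
    | zero => simp
    | succ k ih =>
      have hak := ha k
      calc L * b ^ (k + 1) * a (k + 1) ≤ L * b ^ (k + 1) * (C * 2 ^ k * a k) ^ χ := by
            gcongr; exact h k
        _ = (L * b ^ k * a k) ^ χ := by
            have e1 : (b ^ k) ^ (χ - 1) = (2 ^ k) ^ χ := by
              rw [← Real.rpow_natCast b k, ← Real.rpow_mul hb0.le, mul_comm (k : ℝ) (χ - 1),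
                Real.rpow_mul hb0.le, hbχ, ← Real.rpow_natCast 2 k, ← Real.rpow_mul (by norm_num),
                ← Real.rpow_mul (by norm_num), mul_comm (k : ℝ) χ]
            rw [Real.mul_rpow (by positivity) hak, Real.mul_rpow (by positivity) (by positivity),
              Real.mul_rpow (by positivity) hak, Real.mul_rpow (by positivity) (by positivity),
              ← hx L hL0, hLχ, ← hx (b ^ k) (by positivity), e1, pow_succ]
            ring
        _ ≤ ((L * a 0) ^ (χ ^ k)) ^ χ := by gcongr
        _ = (L * a 0) ^ (χ ^ (k + 1)) := by
            rw [← Real.rpow_mul (mul_nonneg hL0.le (ha 0)), pow_succ]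
  refine le_trans ?_ (key k)
  have hak := ha k
  gcongr
  exact le_mul_of_one_le_right hL0.le (one_le_pow₀ hb1)

lemma sub_rpow {n : ℕ} {lam Lam : ℝ} (hlam : 0 < lam) {B : En n → Matrix (Fin n) (Fin n) ℝ}
    (hB : Ell lam Lam B) {w : En n → ℝ} (hw : ContDiff ℝ 1 w) (hs : IsSub B w)
    (hpos : ∀ x, 0 < w x) {p : ℝ} (hp : 1 ≤ p) :
    ContDiff ℝ 1 (fun x => (w x) ^ p) ∧ IsSub B (fun x => (w x) ^ p) := by
  have h1 : ∀ x, HasDerivAt (fun s : ℝ => s ^ p) (p * (w x) ^ (p - 1)) (w x) :=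
    fun x => Real.hasDerivAt_rpow_const (Or.inl (hpos x).ne')
  have h2 : ∀ x, HasDerivAt (fun s : ℝ => p * s ^ (p - 1))
      (p * ((p - 1) * (w x) ^ (p - 1 - 1))) (w x) :=
    fun x => (Real.hasDerivAt_rpow_const (Or.inl (hpos x).ne')).const_mul p
  have h3 : Continuous fun x => p * ((p - 1) * (w x) ^ (p - 1 - 1)) :=
    continuous_const.mul (continuous_const.mul
      (hw.continuous.rpow_const fun x => Or.inl (hpos x).ne'))
  have h4 : ∀ x, 0 ≤ p * (w x) ^ (p - 1) := fun x => by
    have := hpos x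
    positivity
  have h5 : ∀ x, 0 ≤ p * ((p - 1) * (w x) ^ (p - 1 - 1)) := fun x => by
    have := hpos x
    have : 0 ≤ p - 1 := by linarith
    positivity
  exact ⟨(sub_comp hw hs (fun s => s ^ p) (fun s => p * s ^ (p - 1))
      (fun s => p * ((p - 1) * s ^ (p - 1 - 1))) h1 h2 h3 h4).1,
    sub_of_comp hlam hB hw hs (fun s => s ^ p) (fun s => p * s ^ (p - 1))
      (fun s => p * ((p - 1) * s ^ (p - 1 - 1))) h1 h2 h3 h4 h5⟩

/-- Local boundedness of positive subsolutions. -/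
lemma moser_sup (n : ℕ) (hn : 2 ≤ n) (lam Lam : ℝ) (hlam : 0 < lam) :
    ∃ C : ℝ, 0 < C ∧ ∀ (B : En n → Matrix (Fin n) (Fin n) ℝ) (w : En n → ℝ), Ell lam Lam B →
    ContDiff ℝ 1 w → IsSub B w → (∀ x, 0 < w x) →
    ∀ x, ‖x‖ < 1 → (w x) ^ 2 ≤ C * ∫ x in closedBall 0 2, (w x) ^ 2 := by
  obtain ⟨C, hC, hstep⟩ := moser_step n hn lam Lam hlam
  set χ := (n : ℝ) / (n - 1) with hχ
  have hn' : (2 : ℝ) ≤ n := by exact_mod_cast hn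
  have hχ1 : 1 < χ := by rw [hχ, one_lt_div] <;> linarith
  obtain ⟨L, hL, hrec⟩ := moser_rec χ (2 * C) hχ1 (by positivity)
  refine ⟨L, hL, fun B w hB hw hs hpos => ?_⟩
  let z : ℕ → En n → ℝ := fun k x => (w x) ^ (χ ^ k)
  have hz : ∀ k, ContDiff ℝ 1 (z k) ∧ IsSub B (z k) := fun k =>
    sub_rpow hlam hB hw hs hpos (one_le_pow₀ hχ1.le)
  have hz0 : ∀ k x, 0 ≤ z k x := fun k x => Real.rpow_nonneg (hpos x).le _
  let r : ℕ → ℝ := fun k => 1 + (1 / 2) ^ k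
  let a : ℕ → ℝ := fun k => ∫ x in closedBall 0 (r k), (z k x) ^ 2
  have ha : ∀ k, 0 ≤ a k := fun k => integral_nonneg fun x => sq_nonneg _
  have hr : ∀ k, 1 < r k := fun k => by simp [r]
  have ha' : ∀ k, a (k + 1) ≤ (2 * C * 2 ^ k * a k) ^ χ := by
    intro k
    have h := hstep B (z k) hB (hz k).1 (hz k).2 (hz0 k) (r (k + 1)) (r k)
      (by linarith [hr (k + 1)]) (by
        simp only [r, pow_succ]
        have : (0 : ℝ) < (1 / 2) ^ k := by positivity
        linarith)
    have e1 : C / (r k - r (k + 1)) = 2 * C * 2 ^ k := by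
      have : r k - r (k + 1) = 1 / (2 * 2 ^ k) := by
        simp only [r, pow_succ, one_div, inv_pow]
        field_simp
        ring
      rw [this]
      field_simp
    have e2 : ∀ x, (z k x) ^ χ = z (k + 1) x := fun x => by
      simp only [z]
      rw [← Real.rpow_mul (hpos x).le, pow_succ]
    rw [e1] at h
    simp_rw [e2] at h
    exact h
  have hfin := hrec a ha ha'
  have ha0 : a 0 = ∫ x in closedBall 0 2, (w x) ^ 2 := by
    simp only [a, r, z]
    norm_num
  rw [← ha0]
  intro x hx
  by_contra! hcon
  obtain ⟨S, hS1, hS2⟩ := exists_between hcon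
  set T := L * a 0
  have hT0 : 0 ≤ T := mul_nonneg hL.le (ha 0)
  have hS0 : 0 < S := lt_of_le_of_lt hT0 hS1
  have hopen : IsOpen {y : En n | S < (w y) ^ 2 ∧ ‖y‖ < 1} :=
    (isOpen_lt continuous_const (hw.continuous.pow 2)).inter
      (isOpen_lt continuous_norm continuous_const)
  obtain ⟨ε, hε, hball⟩ := Metric.isOpen_iff.mp hopen x ⟨hS2, hx⟩
  set m := volume.real (ball x ε) with hm
  have hm0 : 0 < m := by
    rw [hm, measureReal_def]
    exact ENNReal.toReal_pos (measure_ball_pos _ _ hε).ne' measure_ball_lt_top.ne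
  have hlow : ∀ k, m * S ^ (χ ^ k) ≤ a k := by
    intro k
    have hsub : ball x ε ⊆ closedBall 0 (r k) := fun y hy => by
      have := (hball hy).2
      simp only [mem_closedBall, dist_zero_right]
      linarith [hr k]
    have hcont : Continuous fun y => (z k y) ^ 2 := (hz k).1.continuous.pow 2
    calc m * S ^ (χ ^ k) = ∫ y in ball x ε, S ^ (χ ^ k) := by
          rw [setIntegral_const, smul_eq_mul]
      _ ≤ ∫ y in ball x ε, (z k y) ^ 2 := by
          refine setIntegral_mono_on ?_ ((cont_int_ball hcont (r k)).mono_set hsub)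
            measurableSet_ball ?_
          · exact integrableOn_const measure_ball_lt_top.ne
          · intro y hy
            have h1 := (hball hy).1.le
            have h2 : (z k y) ^ 2 = ((w y) ^ 2) ^ (χ ^ k) := by
              simp only [z]
              rw [← Real.rpow_natCast _ 2, ← Real.rpow_natCast _ 2, ← Real.rpow_mul (hpos y).le,
                ← Real.rpow_mul (hpos y).le, mul_comm]
            rw [h2]
            exact Real.rpow_le_rpow hS0.le h1 (by positivity)
      _ ≤ a k := setIntegral_mono_set (cont_int_ball hcont (r k))
            (Filter.Eventually.of_forall fun y => sq_nonneg _)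
            (Filter.Eventually.of_forall fun y hy => hsub hy)
  have hup : ∀ k, L * m * S ^ (χ ^ k) ≤ T ^ (χ ^ k) := fun k =>
    le_trans (by rw [mul_assoc]; exact mul_le_mul_of_nonneg_left (hlow k) hL.le) (hfin k)
  -- T / S < 1, so (T/S)^(χ^k) → 0
  have hq0 : 0 ≤ T / S := by positivity
  have hq1 : T / S < 1 := (div_lt_one hS0).mpr hS1
  have hlim : Filter.Tendsto (fun k : ℕ => (T / S) ^ (χ ^ k)) Filter.atTop (nhds 0) :=
    (tendsto_rpow_atTop_of_base_lt_one _ (by linarith) hq1).comp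
      (tendsto_pow_atTop_atTop_of_one_lt hχ1)
  have hge : ∀ k, L * m ≤ (T / S) ^ (χ ^ k) := fun k => by
    rw [Real.div_rpow hT0 hS0.le, le_div_iff₀ (by positivity)]
    exact hup k
  have := ge_of_tendsto' hlim hge
  have : 0 < L * m := by positivity
  linarith
end

section
set_option linter.all false
lemma lint_contract {n : ℕ} (g : En n → ENNReal) (hg : Measurable g) (R : ℝ) (y : En n)
    (hy : y ∈ closedBall (0 : En n) R) (t : ℝ) (ht0 : 0 ≤ t) (ht : t ≤ 1 / 2) :
    ∫⁻ x in closedBall (0 : En n) R, g ((1 - t) • x + t • y) ≤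
      2 ^ n * ∫⁻ x in closedBall (0 : En n) R, g x := by
  set S := closedBall (0 : En n) R with hS
  have hSm : MeasurableSet S := measurableSet_closedBall
  let G : En n → ENNReal := S.indicator g
  have hG : Measurable G := hg.indicator hSm
  have h1 : ∫⁻ x in S, g ((1 - t) • x + t • y) ≤ ∫⁻ x, G ((1 - t) • x + t • y) := by
    refine le_trans (setLIntegral_mono' hSm fun x hx => ?_) (setLIntegral_le_lintegral S _)
    have : (1 - t) • x + t • y ∈ S :=
      (convex_closedBall (0 : En n) R) hx hy (by linarith) ht0 (by ring)
    simp only [G]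
    rw [Set.indicator_of_mem this]
  refine h1.trans ?_
  have hne : (1 - t) ≠ 0 := by linarith
  have h2 : ∫⁻ x, G ((1 - t) • x + t • y) =
      ENNReal.ofReal |((1 - t) ^ Module.finrank ℝ (En n))⁻¹| * ∫⁻ x, G x := by
    have := lintegral_map (μ := (volume : Measure (En n))) (f := fun x => G (x + t • y))
      (g := fun x => (1 - t) • x) (hG.comp (measurable_id.add_const _)) (measurable_const_smul (1 - t))
    rw [Measure.map_addHaar_smul _ hne, lintegral_smul_measure,
      lintegral_add_right_eq_self] at this
    rw [← this, smul_eq_mul]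
  rw [h2, lintegral_indicator hSm]
  gcongr
  rw [finrank_euclideanSpace_fin]
  have : |((1 - t) ^ n)⁻¹| ≤ 2 ^ n := by
    rw [abs_of_nonneg (by apply inv_nonneg.mpr; apply pow_nonneg; linarith), ← inv_pow]
    apply pow_le_pow_left₀ (inv_nonneg.mpr (by linarith))
    rw [inv_le_comm₀ (by linarith) (by norm_num)]
    linarith
  calc _ ≤ ENNReal.ofReal (2 ^ n) := ENNReal.ofReal_le_ofReal this
    _ = 2 ^ n := by rw [ENNReal.ofReal_pow (by norm_num)]; norm_num

lemma poincare_half {n : ℕ} (f : En n → ℝ) (hf : ContDiff ℝ 1 f) (y : En n)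
    (hy : y ∈ closedBall (0 : En n) 2) :
    ∫⁻ x in closedBall (0 : En n) 2, ‖f ((1 / 2 : ℝ) • x + (1 / 2 : ℝ) • y) - f x‖ₑ ≤
      4 * 2 ^ n * ∫⁻ x in closedBall (0 : En n) 2, ‖fderiv ℝ f x‖ₑ := by
  set S := closedBall (0 : En n) 2 with hS
  have hSm : MeasurableSet S := measurableSet_closedBall
  have hDf := fderiv_cont hf
  have hp : ∀ x ∈ S, ‖f ((1 / 2 : ℝ) • x + (1 / 2 : ℝ) • y) - f x‖ₑ ≤
      ∫⁻ t in Set.Ioc (0 : ℝ) (1 / 2), 4 * ‖fderiv ℝ f ((1 - t) • x + t • y)‖ₑ := by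
    intro x hx
    have hd : ∀ t : ℝ, HasDerivAt (fun t : ℝ => f ((1 - t) • x + t • y))
        (fderiv ℝ f ((1 - t) • x + t • y) (y - x)) t := by
      intro t
      have h1 : HasDerivAt (fun t : ℝ => (1 - t) • x + t • y) (y - x) t := by
        have := (((hasDerivAt_id t).const_sub 1).smul_const x).add ((hasDerivAt_id t).smul_const y)
        refine this.congr_deriv ?_
        simp; abel
      exact (diff_of_C1 hf _).hasFDerivAt.comp_hasDerivAt t h1
    have hcont : Continuous fun t : ℝ => fderiv ℝ f ((1 - t) • x + t • y) (y - x) := by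
      apply Continuous.clm_apply _ continuous_const
      exact hDf.comp (by fun_prop)
    have hinteg := intervalIntegral.integral_eq_sub_of_hasDerivAt (a := 0) (b := 1 / 2)
      (fun t _ => hd t) (hcont.intervalIntegrable _ _)
    have e : f ((1 / 2 : ℝ) • x + (1 / 2 : ℝ) • y) - f x =
        ∫ t in Set.Ioc (0 : ℝ) (1 / 2), fderiv ℝ f ((1 - t) • x + t • y) (y - x) := by
      rw [← intervalIntegral.integral_of_le (by norm_num), hinteg]
      norm_num
    rw [e]
    refine (enorm_integral_le_lintegral_enorm _).trans (lintegral_mono fun t => ?_)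
    refine (ContinuousLinearMap.le_opENorm _ _).trans ?_
    rw [mul_comm]
    gcongr
    have : ‖y - x‖ ≤ 4 := by
      refine (norm_sub_le _ _).trans ?_
      have h1 : ‖x‖ ≤ 2 := by simpa [hS] using hx
      have h2 : ‖y‖ ≤ 2 := by simpa [hS] using hy
      linarith
    rw [← ofReal_norm_eq_enorm]
    calc _ ≤ ENNReal.ofReal 4 := ENNReal.ofReal_le_ofReal this
      _ = 4 := by norm_num
  have hjoint : Continuous (Function.uncurry fun (x : En n) (t : ℝ) =>
      4 * ‖fderiv ℝ f ((1 - t) • x + t • y)‖ₑ) := by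
    apply ENNReal.continuous_const_mul (by norm_num) |>.comp
    apply continuous_enorm.comp
    apply hDf.comp
    fun_prop
  calc _ ≤ ∫⁻ x in S, ∫⁻ t in Set.Ioc (0 : ℝ) (1 / 2), 4 * ‖fderiv ℝ f ((1 - t) • x + t • y)‖ₑ :=
        setLIntegral_mono' hSm hp
    _ = ∫⁻ t in Set.Ioc (0 : ℝ) (1 / 2), ∫⁻ x in S, 4 * ‖fderiv ℝ f ((1 - t) • x + t • y)‖ₑ :=
        lintegral_lintegral_swap hjoint.measurable.aemeasurable
    _ ≤ ∫⁻ t in Set.Ioc (0 : ℝ) (1 / 2), 4 * 2 ^ n * ∫⁻ x in S, ‖fderiv ℝ f x‖ₑ := by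
        refine setLIntegral_mono' measurableSet_Ioc fun t ht => ?_
        have hm : Measurable fun x => ‖fderiv ℝ f ((1 - t) • x + t • y)‖ₑ := by
          apply Continuous.measurable
          apply continuous_enorm.comp
          apply hDf.comp
          fun_prop
        rw [lintegral_const_mul _ hm, mul_assoc]
        gcongr
        exact lint_contract (fun x => ‖fderiv ℝ f x‖ₑ) (continuous_enorm.comp hDf).measurable 2 y hy t
          ht.1.le ht.2
    _ ≤ _ := by
        rw [setLIntegral_const, Real.volume_Ioc]
        calc _ ≤ (4 * 2 ^ n * ∫⁻ x in S, ‖fderiv ℝ f x‖ₑ) * 1 := by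
              gcongr
              rw [ENNReal.ofReal_le_one]; norm_num
          _ = _ := mul_one _

/-- `L¹` Poincaré inequality for functions vanishing on a set `Z`. -/
lemma poincare_one {n : ℕ} (f : En n → ℝ) (hf : ContDiff ℝ 1 f) (Z : Set (En n))
    (hZ : MeasurableSet Z) (hZs : Z ⊆ closedBall 0 2) (hfZ : ∀ x ∈ Z, f x = 0) :
    volume Z * ∫⁻ x in closedBall (0 : En n) 2, ‖f x‖ₑ ≤
      2 * (volume (closedBall (0 : En n) 2) * (4 * 2 ^ n *
        ∫⁻ x in closedBall (0 : En n) 2, ‖fderiv ℝ f x‖ₑ)) := by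
  set S := closedBall (0 : En n) 2 with hS
  have hSm : MeasurableSet S := measurableSet_closedBall
  set I := ∫⁻ x in S, ‖fderiv ℝ f x‖ₑ
  let A : En n → En n → ENNReal := fun x y => ‖f ((1 / 2 : ℝ) • x + (1 / 2 : ℝ) • y) - f x‖ₑ
  have hA : Continuous (Function.uncurry A) := by
    have := hf.continuous
    simp only [A, Function.uncurry_def]
    apply continuous_enorm.comp
    fun_prop
  have hbound : ∫⁻ y in S, ∫⁻ x in S, A x y ≤ volume S * (4 * 2 ^ n * I) := by
    calc _ ≤ ∫⁻ y in S, 4 * 2 ^ n * I := setLIntegral_mono' hSm fun y hy => poincare_half f hf y hy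
      _ = _ := by rw [setLIntegral_const, mul_comm]
  have hbound' : ∫⁻ y in S, ∫⁻ x in S, A y x ≤ volume S * (4 * 2 ^ n * I) := by
    rw [lintegral_lintegral_swap hA.measurable.aemeasurable]
    exact hbound
  calc volume Z * ∫⁻ x in S, ‖f x‖ₑ = ∫⁻ y in Z, ∫⁻ x in S, ‖f x‖ₑ := by
        rw [setLIntegral_const, mul_comm]
    _ ≤ ∫⁻ y in Z, ∫⁻ x in S, (A x y + A y x) := by
        refine setLIntegral_mono' hZ fun y hy => lintegral_mono fun x => ?_
        have : f x = (f ((1 / 2 : ℝ) • y + (1 / 2 : ℝ) • x) - f y) -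
            (f ((1 / 2 : ℝ) • x + (1 / 2 : ℝ) • y) - f x) := by
          rw [hfZ y hy, add_comm ((1 / 2 : ℝ) • y)]; ring
        calc ‖f x‖ₑ = ‖(f ((1 / 2 : ℝ) • y + (1 / 2 : ℝ) • x) - f y) -
            (f ((1 / 2 : ℝ) • x + (1 / 2 : ℝ) • y) - f x)‖ₑ := by rw [← this]
          _ ≤ A y x + A x y := enorm_sub_le
          _ = _ := add_comm _ _
    _ ≤ ∫⁻ y in S, ∫⁻ x in S, (A x y + A y x) := lintegral_mono_set hZs
    _ = (∫⁻ y in S, ∫⁻ x in S, A x y) + ∫⁻ y in S, ∫⁻ x in S, A y x := by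
        rw [← lintegral_add_left]
        · refine lintegral_congr fun y => ?_
          rw [lintegral_add_left]
          exact (hA.comp (by fun_prop : Continuous fun x : En n => (x, y))).measurable
        · exact (hA.measurable.comp measurable_swap).lintegral_prod_right'
    _ ≤ _ := by rw [two_mul]; exact add_le_add hbound hbound'
end

section
set_option linter.all false
lemma pos_pow_deriv (k : ℕ) (s : ℝ) :
    HasDerivAt (fun s : ℝ => (max s 0) ^ (k + 2)) ((k + 2) * (max s 0) ^ (k + 1)) s := by
  have hne : ∀ y : ℝ, y ≠ 0 →
      HasDerivAt (fun s : ℝ => (max s 0) ^ (k + 2)) ((k + 2) * (max y 0) ^ (k + 1)) y := by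
    intro y hy
    rcases lt_or_gt_of_ne hy with h | h
    · rw [max_eq_right h.le]
      have : (fun s : ℝ => (max s 0) ^ (k + 2)) =ᶠ[nhds y] fun _ => 0 := by
        filter_upwards [Iio_mem_nhds h] with a ha
        rw [max_eq_right (le_of_lt ha)]; simp
      simpa using (hasDerivAt_const y (0 : ℝ)).congr_of_eventuallyEq this
    · rw [max_eq_left h.le]
      have : (fun s : ℝ => (max s 0) ^ (k + 2)) =ᶠ[nhds y] fun s => s ^ (k + 2) := by
        filter_upwards [Ioi_mem_nhds h] with a ha
        rw [max_eq_left (le_of_lt ha)]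
      have h2 := (hasDerivAt_pow (k + 2) y).congr_of_eventuallyEq this
      simpa using h2
  by_cases hs : s = 0
  · subst hs
    exact hasDerivAt_of_hasDerivAt_of_ne hne (by fun_prop) (by fun_prop)
  · exact hne s hs

lemma poincare_two {n : ℕ} (z : En n → ℝ) (hz : ContDiff ℝ 1 z) (Z : Set (En n))
    (hZ : MeasurableSet Z) (hZs : Z ⊆ closedBall 0 2) (hfZ : ∀ x ∈ Z, z x = 0) (μ : ℝ) (hμ : 0 < μ)
    (hμZ : μ ≤ volume.real Z) :
    ∫ x in closedBall 0 2, (z x) ^ 2 ≤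
      4 * (8 * 2 ^ n * volume.real (closedBall (0 : En n) 2) / μ) ^ 2 *
        ∫ x in closedBall 0 2, ‖fderiv ℝ z x‖ ^ 2 := by
  have hz2 : ContDiff ℝ 1 (fun x => (z x) ^ 2) := hz.pow 2
  have hd : ∀ x, fderiv ℝ (fun x => (z x) ^ 2) x = (2 * z x) • fderiv ℝ z x := fun x => by
    have h1 : HasFDerivAt (fun x => (z x) ^ 2) ((2 * z x) • fderiv ℝ z x) x := by
      simpa using (diff_of_C1 hz x).hasFDerivAt.pow 2
    exact h1.fderiv
  have h := poincare_one (fun x => (z x) ^ 2) hz2 Z hZ hZs (fun x hx => by simp [hfZ x hx])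
  have c0 : Continuous z := hz.continuous
  have c1 : Continuous (fun x => ‖fderiv ℝ z x‖) := (fderiv_cont hz).norm
  have i1 : IntegrableOn (fun x => (z x) ^ 2) (closedBall (0 : En n) 2) :=
    cont_int_ball (c0.pow 2) 2
  have i2 : IntegrableOn (fderiv ℝ (fun x => (z x) ^ 2)) (closedBall (0 : En n) 2) :=
    (fderiv_cont hz2).continuousOn.integrableOn_compact (isCompact_closedBall _ _)
  rw [← ofReal_integral_norm_eq_lintegral_enorm i1, ← ofReal_integral_norm_eq_lintegral_enorm i2] at h
  have hZfin : volume Z ≠ ⊤ := ((measure_mono hZs).trans_lt measure_closedBall_lt_top).ne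
  have hBfin : volume (closedBall (0 : En n) 2) ≠ ⊤ := measure_closedBall_lt_top.ne
  have h' := ENNReal.toReal_mono (by
    refine ENNReal.mul_ne_top (by simp) (ENNReal.mul_ne_top hBfin
      (ENNReal.mul_ne_top (ENNReal.mul_ne_top (by simp) (by simp)) (by simp)))) h
  simp only [ENNReal.toReal_mul, ENNReal.toReal_pow, ENNReal.toReal_ofNat] at h'
  rw [ENNReal.toReal_ofReal (integral_nonneg fun x => norm_nonneg _),
    ENNReal.toReal_ofReal (integral_nonneg fun x => norm_nonneg _)] at h'
  simp only [norm_pow, Real.norm_eq_abs, sq_abs] at h'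
  set V := volume.real (closedBall (0 : En n) 2) with hV
  change volume.real Z * _ ≤ 2 * (V * _) at h'
  set I := ∫ x in closedBall 0 2, (z x) ^ 2 with hI
  set Q := 8 * 2 ^ n * V / μ with hQ
  have hI0 : 0 ≤ I := integral_nonneg fun x => sq_nonneg _
  have hV0 : 0 ≤ V := measureReal_nonneg
  have hQ0 : 0 ≤ Q := by positivity
  have h2 : I ≤ Q * ∫ x in closedBall 0 2, ‖fderiv ℝ (fun x => (z x) ^ 2) x‖ := by
    have := (mul_le_mul_of_nonneg_right hμZ hI0).trans h'
    rw [hQ, div_mul_eq_mul_div, le_div_iff₀ hμ]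
    linarith
  rw [← integral_const_mul] at h2
  have h3 : ∫ x in closedBall 0 2, Q * ‖fderiv ℝ (fun x => (z x) ^ 2) x‖ ≤
      ∫ x in closedBall 0 2, (1 / 2 * (z x) ^ 2 + 2 * Q ^ 2 * ‖fderiv ℝ z x‖ ^ 2) := by
    refine setIntegral_mono (i2.norm.const_mul Q) ?_ ?_
    · exact cont_int_ball (by fun_prop) 2
    · intro x
      simp only [hd, norm_smul, norm_mul, Real.norm_eq_abs, abs_two]
      nlinarith [sq_nonneg (|z x| - 2 * Q * ‖fderiv ℝ z x‖), sq_abs (z x)]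
  rw [integral_add (cont_int_ball (by fun_prop) 2) (cont_int_ball (by fun_prop) 2),
    integral_const_mul, integral_const_mul, integral_const_mul] at h3
  rw [integral_const_mul] at h2
  linarith

lemma log_est {n : ℕ} {lam Lam : ℝ} {B : En n → Matrix (Fin n) (Fin n) ℝ} {v : En n → ℝ}
    (hlam : 0 < lam) (hB : Ell lam Lam B) (hv : ContDiff ℝ 1 v) (hs : IsSub B v)
    (f f' f'' : ℝ → ℝ) (hf : ∀ x, HasDerivAt f (f' (v x)) (v x))
    (hf' : ∀ x, HasDerivAt f' (f'' (v x)) (v x)) (hc : Continuous fun x => f'' (v x))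
    (h0 : ∀ x, 0 ≤ f' (v x)) (h1 : ∀ x, f' (v x) ^ 2 ≤ f'' (v x))
    {η : En n → ℝ} (hη : ContDiff ℝ 1 η) (hηc : HasCompactSupport η) :
    lam * ∫ x, (η x) ^ 2 * ‖fderiv ℝ (fun x => f (v x)) x‖ ^ 2 ≤
      (4 * Lam ^ 2 / lam) * ∫ x, ‖fderiv ℝ η x‖ ^ 2 := by
  obtain ⟨c1, e, h⟩ := sub_comp hv hs f f' f'' hf hf' hc h0
  have key := h (fun x => (η x) ^ 2) (hη.pow 2) (hsq hηc) (fun x => sq_nonneg _)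
  have eη : ∀ x, fderiv ℝ (fun x => (η x) ^ 2) x = (2 * η x) • fderiv ℝ η x := fun x => by
    have h1 : HasFDerivAt (fun x => (η x) ^ 2) ((2 * η x) • fderiv ℝ η x) x := by
      simpa using (diff_of_C1 hη x).hasFDerivAt.pow 2
    exact h1.fderiv
  have hcD : HasCompactSupport fun x => ‖fderiv ℝ η x‖ ^ 2 :=
    (hηc.fderiv ℝ).mono (fun x hx => by
      simp only [Function.mem_support] at hx ⊢; contrapose! hx; simp [hx])
  refine absorb (F := fun x => bil (B x) (fderiv ℝ (fun x => f (v x)) x)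
      (fderiv ℝ (fun x => (η x) ^ 2) x)
      + (η x) ^ 2 * f'' (v x) * bil (B x) (fderiv ℝ v x) (fderiv ℝ v x)) ?_ ?_ ?_ key ?_
  · apply int_cs ((hη.continuous.pow 2).mul ((fderiv_cont c1).norm.pow 2))
    exact HasCompactSupport.mul_right (hsq hηc)
  · exact int_cs ((fderiv_cont hη).norm.pow 2) hcD
  · apply int_cs
    · exact (B_cont hB (fderiv_cont c1) (fderiv_cont (hη.pow 2))).add
        (((hη.continuous.pow 2).mul hc).mul (B_cont hB (fderiv_cont hv) (fderiv_cont hv)))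
    · apply HasCompactSupport.add
      · exact ((hsq hηc).fderiv ℝ).mono (fun x hx => by
          simp only [Function.mem_support] at hx ⊢; contrapose! hx; simp [hx, bil_zero_right])
      · exact (hsq hηc).mul_right.mul_right
  · intro x
    simp only [eη, bil_smul_right]
    set Dz := fderiv ℝ (fun x => f (v x)) x with hDz
    have hz : bil (B x) Dz Dz = f' (v x) ^ 2 * bil (B x) (fderiv ℝ v x) (fderiv ℝ v x) := by
      rw [hDz, e, bil_smul_left, bil_smul_right]; ring
    have hv0 : 0 ≤ bil (B x) (fderiv ℝ v x) (fderiv ℝ v x) :=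
      le_trans (by positivity) (hB.lower x (fderiv ℝ v x))
    have h2 := hB.lower x Dz
    have h3 := hB.upper x Dz (fderiv ℝ η x)
    have h4 : lam * ‖Dz‖ ^ 2 ≤ f'' (v x) * bil (B x) (fderiv ℝ v x) (fderiv ℝ v x) :=
      h2.trans (hz.le.trans (mul_le_mul_of_nonneg_right (h1 x) hv0))
    set a := ‖Dz‖
    set b := ‖fderiv ℝ η x‖
    set t := bil (B x) Dz (fderiv ℝ η x)
    have h5 := mul_le_mul_of_nonneg_left h4 (sq_nonneg (η x))
    have h6 : -(η x * t) ≤ |η x| * (Lam * a * b) := by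
      calc _ ≤ |η x * t| := neg_le_abs _
        _ = |η x| * |t| := abs_mul _ _
        _ ≤ _ := by gcongr
    have h7 : 4 * (|η x| * a) * (Lam * b) ≤ lam * (|η x| * a) ^ 2 + 4 / lam * (Lam * b) ^ 2 := by
      have : lam * (|η x| * a) ^ 2 + 4 / lam * (Lam * b) ^ 2
        - 4 * (|η x| * a) * (Lam * b) = (1 / lam) *
          (lam * (|η x| * a) - 2 * (Lam * b)) ^ 2 := by field_simp; ring
      have h6 : 0 ≤ (1 / lam) * (lam * (|η x| * a) - 2 * (Lam * b)) ^ 2 := by positivity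
      linarith
    have h8 : (|η x| * a) ^ 2 = (η x) ^ 2 * a ^ 2 := by rw [mul_pow, sq_abs]
    have h9 : 4 * Lam ^ 2 / lam * b ^ 2 = 4 / lam * (Lam * b) ^ 2 := by ring
    rw [h9]
    rw [h8] at h7
    linarith
end

section
set_option linter.all false
lemma osc_strict (n : ℕ) (hn : 2 ≤ n) (lam Lam : ℝ) (hlam : 0 < lam) (μ : ℝ) (hμ : 0 < μ) :
    ∃ c : ℝ, 0 < c ∧ c < 1 ∧ ∀ (B : En n → Matrix (Fin n) (Fin n) ℝ) (v : En n → ℝ),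
    Ell lam Lam B → ContDiff ℝ 1 v → IsSub B v → (∀ x, v x < 1) →
    μ ≤ volume.real ({x | v x ≤ 0} ∩ closedBall 0 2) →
    ∀ x, ‖x‖ < 1 → v x ≤ 1 - c := by
  obtain ⟨C, hC, hmos⟩ := moser_sup n hn lam Lam hlam
  obtain ⟨K0, hK0, hcut⟩ := exists_cutoff n
  obtain ⟨η, hη, hηc, hη0, hη1, -, -, -⟩ := hcut 2 3 (by norm_num) (by norm_num)
  set V := volume.real (closedBall (0 : En n) 2) with hV
  have hV0 : 0 ≤ V := measureReal_nonneg
  set K := 4 * (8 * 2 ^ n * V / μ) ^ 2 with hK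
  have hK0 : 0 ≤ K := by positivity
  set H := (4 * Lam ^ 2 / lam) * ∫ x, ‖fderiv ℝ η x‖ ^ 2 with hH
  have hH0 : 0 ≤ H := mul_nonneg (by positivity) (integral_nonneg fun x => by positivity)
  set E := C * (2 * V + 2 * (K * (H / lam))) with hE
  have hE0 : 0 ≤ E := by positivity
  have hexp : Real.exp (-E) ≤ 1 := Real.exp_le_one_iff.mpr (by linarith)
  have hexp0 := Real.exp_pos (-E)
  refine ⟨Real.exp (-E) / 3, by positivity, by linarith, ?_⟩
  intro B v hB hv hs hv1 hmeas
  let f : ℝ → ℝ := fun s => -Real.log (1 - (max s 0) ^ 3)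
  let f' : ℝ → ℝ := fun s => 3 * (max s 0) ^ 2 / (1 - (max s 0) ^ 3)
  let f'' : ℝ → ℝ := fun s =>
    (6 * max s 0 * (1 - (max s 0) ^ 3) + 9 * (max s 0) ^ 4) / (1 - (max s 0) ^ 3) ^ 2
  have hP0 : ∀ s : ℝ, 0 ≤ max s 0 := fun s => le_max_right _ _
  have hD : ∀ s : ℝ, s < 1 → 0 < 1 - (max s 0) ^ 3 := fun s hs => by
    have : (max s 0) ^ 3 < 1 := pow_lt_one₀ (hP0 s) (max_lt hs one_pos) (by norm_num)
    linarith
  have d3 : ∀ s : ℝ, HasDerivAt (fun s : ℝ => 1 - (max s 0) ^ 3) (-(3 * (max s 0) ^ 2)) s :=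
    fun s => by
      have := (pos_pow_deriv 1 s).const_sub 1
      norm_num at this
      exact this
  have d2 : ∀ s : ℝ, HasDerivAt (fun s : ℝ => 3 * (max s 0) ^ 2) (6 * max s 0) s :=
    fun s => by
      have := (pos_pow_deriv 0 s).const_mul 3
      norm_num at this
      refine this.congr_deriv ?_
      ring
  have hf : ∀ x, HasDerivAt f (f' (v x)) (v x) := fun x => by
    refine ((d3 (v x)).log (hD _ (hv1 x)).ne').neg.congr_deriv ?_
    simp only [f']; ring
  have hf' : ∀ x, HasDerivAt f' (f'' (v x)) (v x) := fun x => by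
    refine ((d2 (v x)).div (d3 (v x)) (hD _ (hv1 x)).ne').congr_deriv ?_
    simp only [f'']; ring
  have hvc := hv.continuous
  have hc : Continuous fun x => f'' (v x) := by
    refine Continuous.div (by fun_prop) (by fun_prop) fun x => ?_
    have := hD _ (hv1 x)
    positivity
  have h0 : ∀ x, 0 ≤ f' (v x) := fun x => by
    have := hD _ (hv1 x)
    have := hP0 (v x)
    simp only [f']; positivity
  have h1 : ∀ x, f' (v x) ^ 2 ≤ f'' (v x) := fun x => by
    have h2 := hD _ (hv1 x)
    have h3 := hP0 (v x)
    simp only [f', f'', div_pow]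
    gcongr
    have : 0 ≤ max (v x) 0 * (1 - max (v x) 0 ^ 3) := by positivity
    nlinarith
  have h2 : ∀ x, 0 ≤ f'' (v x) := fun x => (sq_nonneg _).trans (h1 x)
  obtain ⟨zc, -, -⟩ := sub_comp hv hs f f' f'' hf hf' hc h0
  have hlog := log_est hlam hB hv hs f f' f'' hf hf' hc h0 h1 hη hηc
  have hf1 : ∀ x, HasDerivAt (fun s => 1 + f s) (f' (v x)) (v x) := fun x => (hf x).const_add 1
  have hws := sub_of_comp hlam hB hv hs (fun s => 1 + f s) f' f'' hf1 hf' hc h0 h2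
  have hz0 : ∀ x, 0 ≤ f (v x) := fun x => by
    have h2 := hD _ (hv1 x)
    have h3 := hP0 (v x)
    have : Real.log (1 - (max (v x) 0) ^ 3) ≤ 0 :=
      Real.log_nonpos h2.le (by have : 0 ≤ (max (v x) 0) ^ 3 := by positivity
                                linarith)
    simp only [f]; linarith
  have hzz : ∀ x ∈ ({x | v x ≤ 0} ∩ closedBall 0 2 : Set (En n)), f (v x) = 0 := fun x hx => by
    simp only [f]
    rw [max_eq_right hx.1]; simp
  have hpo := poincare_two (fun x => f (v x)) zc _
    ((isClosed_le hvc continuous_const).measurableSet.inter measurableSet_closedBall)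
    Set.inter_subset_right hzz μ hμ hmeas
  have cz : Continuous fun x => f (v x) := zc.continuous
  have cz1 : Continuous fun x => (1 + f (v x)) ^ 2 := (continuous_const.add cz).pow 2
  have cz2 : Continuous fun x => 2 * (f (v x)) ^ 2 := continuous_const.mul (cz.pow 2)
  have cz3 : Continuous fun x => 2 + 2 * (f (v x)) ^ 2 := continuous_const.add cz2
  have cD : Continuous fun x => ‖fderiv ℝ (fun x => f (v x)) x‖ := (fderiv_cont zc).norm
  have hloc : ∫ x in closedBall 0 2, ‖fderiv ℝ (fun x => f (v x)) x‖ ^ 2 ≤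
      ∫ x, (η x) ^ 2 * ‖fderiv ℝ (fun x => f (v x)) x‖ ^ 2 := by
    have hi : Integrable fun x => (η x) ^ 2 * ‖fderiv ℝ (fun x => f (v x)) x‖ ^ 2 := by
      apply int_cs ((hη.continuous.pow 2).mul (cD.pow 2))
      exact HasCompactSupport.mul_right (hsq hηc)
    calc ∫ x in closedBall 0 2, ‖fderiv ℝ (fun x => f (v x)) x‖ ^ 2
        = ∫ x in closedBall 0 2, (η x) ^ 2 * ‖fderiv ℝ (fun x => f (v x)) x‖ ^ 2 := by
          refine setIntegral_congr_fun measurableSet_closedBall fun x hx => ?_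
          rw [hη1 x (by simpa using hx)]; simp
      _ ≤ _ := setIntegral_le_integral hi (Filter.Eventually.of_forall fun x => by positivity)
  have hinteg : ∫ x in closedBall 0 2, (1 + f (v x)) ^ 2 ≤ 2 * V + 2 * (K * (H / lam)) := by
    calc ∫ x in closedBall 0 2, (1 + f (v x)) ^ 2
        ≤ ∫ x in closedBall 0 2, (2 + 2 * (f (v x)) ^ 2) := by
          refine setIntegral_mono (cont_int_ball cz1 2) (cont_int_ball cz3 2) ?_
          intro x
          simp only
          nlinarith [sq_nonneg (1 - f (v x))]
      _ = 2 * V + 2 * ∫ x in closedBall 0 2, (f (v x)) ^ 2 := by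
          rw [integral_add (cont_int_ball continuous_const 2) (cont_int_ball cz2 2),
            integral_const_mul, setIntegral_const, smul_eq_mul]
          ring
      _ ≤ _ := by
          have : ∫ x in closedBall 0 2, ‖fderiv ℝ (fun x => f (v x)) x‖ ^ 2 ≤ H / lam := by
            rw [le_div_iff₀ hlam]
            have := mul_le_mul_of_nonneg_left hloc hlam.le
            linarith
          have := hpo.trans (mul_le_mul_of_nonneg_left this hK0)
          linarith
  intro x hx
  have hm := hmos B (fun x => 1 + f (v x)) hB (contDiff_const.add zc) hws
    (fun x => by linarith [hz0 x]) x hx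
  have hm2 : (1 + f (v x)) ^ 2 ≤ E := hm.trans (mul_le_mul_of_nonneg_left hinteg hC.le)
  have hzE : f (v x) ≤ E := by nlinarith [hz0 x]
  have hlog2 : -E ≤ Real.log (1 - (max (v x) 0) ^ 3) := by
    simp only [f] at hzE; linarith
  have h4 : Real.exp (-E) ≤ 1 - (max (v x) 0) ^ 3 :=
    (Real.le_log_iff_exp_le (hD _ (hv1 x))).mp hlog2
  by_contra! hcon
  set c := Real.exp (-E) / 3
  have hc3 : Real.exp (-E) = 3 * c := by simp only [c]; ring
  have hc1 : c ≤ 1 := by simp only [c]; linarith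
  have hc0 : 0 < c := by simp only [c]; linarith
  have h5 : 1 - c < max (v x) 0 := lt_of_lt_of_le hcon (le_max_left _ _)
  have h6 : (1 - c) ^ 3 ≤ (max (v x) 0) ^ 3 := by
    apply pow_le_pow_left₀ (by linarith) h5.le
  have h7 : (1 - c) ^ 3 < (max (v x) 0) ^ 3 := pow_lt_pow_left₀ h5 (by linarith) (by norm_num)
  nlinarith [mul_nonneg hc0.le hc0.le, mul_nonneg (mul_nonneg hc0.le hc0.le) (sub_nonneg.mpr hc1)]

lemma sub_scale {n : ℕ} {B : En n → Matrix (Fin n) (Fin n) ℝ} {v : En n → ℝ}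
    (hv : ContDiff ℝ 1 v) (hs : IsSub B v) (R a b : ℝ) (hR : 0 < R) (ha : 0 ≤ a) :
    IsSub (fun x => B (R • x)) (fun x => a * v (R • x) + b) := by
  intro φ hφ hφc hφ0
  let ψ : En n → ℝ := fun y => φ (R⁻¹ • y)
  have hψ : ContDiff ℝ 1 ψ := hφ.comp (contDiff_const_smul _)
  have hψc : HasCompactSupport ψ :=
    hφc.comp_homeomorph (Homeomorph.smulOfNeZero R⁻¹ (inv_ne_zero hR.ne'))
  have h := hs ψ hψ hψc (fun x => hφ0 _)
  have e1 : ∀ x, fderiv ℝ (fun x => a * v (R • x) + b) x = (a * R) • fderiv ℝ v (R • x) := by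
    intro x
    have h1 : HasFDerivAt (fun x : En n => R • x) (R • ContinuousLinearMap.id ℝ (En n)) x :=
      (hasFDerivAt_id x).const_smul R
    have h2 := ((diff_of_C1 hv (R • x)).hasFDerivAt.comp x h1).const_mul a |>.add_const b
    refine h2.fderiv.trans ?_
    ext y
    simp [mul_assoc]
  have e2 : ∀ x, fderiv ℝ φ x = R • fderiv ℝ ψ (R • x) := by
    intro x
    have h1 : HasFDerivAt (fun x : En n => R • x) (R • ContinuousLinearMap.id ℝ (En n)) x :=
      (hasFDerivAt_id x).const_smul R
    have h2 := ((diff_of_C1 hψ (R • x)).hasFDerivAt.comp x h1)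
    have h3 : ψ ∘ (fun x => R • x) = φ := by
      ext y; simp [ψ, smul_smul, hR.ne']
    rw [h3] at h2
    refine h2.fderiv.trans ?_
    ext y
    simp
  have e3 : ∀ x, bil (B (R • x)) (fderiv ℝ (fun x => a * v (R • x) + b) x) (fderiv ℝ φ x) =
      (a * R * R) * (fun y => bil (B y) (fderiv ℝ v y) (fderiv ℝ ψ y)) (R • x) := by
    intro x
    rw [e1, e2, bil_smul_left, bil_smul_right]; ring
  simp_rw [e3]
  rw [integral_const_mul, Measure.integral_comp_smul volume
    (fun y => bil (B y) (fderiv ℝ v y) (fderiv ℝ ψ y)) R]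
  apply mul_nonpos_of_nonneg_of_nonpos (by positivity)
  rw [smul_eq_mul]
  exact mul_nonpos_of_nonneg_of_nonpos (abs_nonneg _) h

lemma ell_scale {n : ℕ} {lam Lam : ℝ} {B : En n → Matrix (Fin n) (Fin n) ℝ}
    (hB : Ell lam Lam B) (R : ℝ) : Ell lam Lam (fun x => B (R • x)) :=
  ⟨fun i j => (hB.cont i j).comp (continuous_const_smul R), fun x p => hB.lower _ p,
    fun x p q => hB.upper _ p q⟩

lemma wmv (n : ℕ) (hn : 2 ≤ n) {lam Lam : ℝ} (hlam : 0 < lam)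
    {B : En n → Matrix (Fin n) (Fin n) ℝ} {v : En n → ℝ} (hB : Ell lam Lam B)
    (hv : ContDiff ℝ 1 v) (hs : IsSub B v) (M : ℝ) (hM : ∀ x, v x ≤ M)
    (hM' : ∀ ε > 0, ∃ x, M - ε < v x) (ε μ : ℝ) (hε : 0 < ε) (hμ : 0 < μ) :
    ∃ R0 : ℝ, ∀ R, R0 ≤ R → volume.real ({x : En n | v (R • x) ≤ M - ε} ∩ closedBall 0 2) < μ := by
  obtain ⟨c, hc0, hc1, hosc⟩ := osc_strict n hn lam Lam hlam μ hμ
  obtain ⟨x0, hx0⟩ := hM' (c * ε) (by positivity)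
  refine ⟨‖x0‖ + 1, fun R hR => ?_⟩
  by_contra! hcon
  have hR0 : 0 < R := by linarith [norm_nonneg x0]
  have key : ∀ τ > 0, v x0 ≤ M - ε + (1 - c) * (ε + τ) := by
    intro τ hτ
    have hετ : 0 < ε + τ := by linarith
    have h := hosc (fun x => B (R • x)) (fun x => (1 / (ε + τ)) * v (R • x) + (-(M - ε) / (ε + τ)))
      (ell_scale hB R) ((contDiff_const.mul (hv.comp (contDiff_const_smul R))).add contDiff_const)
      (sub_scale hv hs R _ _ hR0 (by positivity)) (fun x => by
        have : 1 / (ε + τ) * v (R • x) + (-(M - ε) / (ε + τ)) = (v (R • x) - (M - ε)) / (ε + τ) := by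
          ring
        rw [this, div_lt_one hετ]
        linarith [hM (R • x)]) (by
        have : {x : En n | 1 / (ε + τ) * v (R • x) + (-(M - ε) / (ε + τ)) ≤ 0} =
            {x : En n | v (R • x) ≤ M - ε} := by
          ext x
          have : 1 / (ε + τ) * v (R • x) + (-(M - ε) / (ε + τ)) = (v (R • x) - (M - ε)) / (ε + τ) := by
            ring
          simp only [Set.mem_setOf_eq]
          rw [this, div_le_iff₀ hετ]
          constructor <;> intro h <;> linarith
        rw [this]; exact hcon) (R⁻¹ • x0) (by
        rw [norm_smul, norm_inv, Real.norm_eq_abs, abs_of_pos hR0, inv_mul_lt_iff₀ hR0]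
        linarith)
    simp only [smul_smul, mul_inv_cancel₀ hR0.ne', one_smul] at h
    have e : 1 / (ε + τ) * v x0 + (-(M - ε) / (ε + τ)) = (v x0 - (M - ε)) / (ε + τ) := by ring
    rw [e, div_le_iff₀ hετ] at h
    linarith
  have h2 : v x0 ≤ M - ε + (1 - c) * ε := by
    refine le_of_forall_pos_le_add fun τ hτ => ?_
    have := key τ hτ
    nlinarith
  nlinarith

/-- Finitely many bounded subsolutions are simultaneously almost maximal. -/
lemma simul (n : ℕ) (hn : 2 ≤ n) {lam Lam : ℝ} (hlam : 0 < lam)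
    {B : En n → Matrix (Fin n) (Fin n) ℝ} (hB : Ell lam Lam B) {ι : Type*} (T : Finset ι)
    (v : ι → En n → ℝ) (hv : ∀ i ∈ T, ContDiff ℝ 1 (v i)) (hs : ∀ i ∈ T, IsSub B (v i)) (M : ι → ℝ)
    (hM : ∀ i ∈ T, ∀ x, v i x ≤ M i)
    (hM' : ∀ i ∈ T, ∀ ε > 0, ∃ x, M i - ε < v i x) (ε : ℝ) (hε : 0 < ε) :
    ∃ x, ∀ i ∈ T, M i - ε < v i x := by
  set V := volume.real (closedBall (0 : En n) 2) with hV
  have hV0 : 0 < V := by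
    rw [hV, measureReal_def]
    exact ENNReal.toReal_pos (measure_closedBall_pos _ _ (by norm_num)).ne' measure_closedBall_lt_top.ne
  set μ := V / (T.card + 1) with hμ
  have hμ0 : 0 < μ := by positivity
  have h1 : ∀ i : ι, ∃ R0 : ℝ, i ∈ T → ∀ R, R0 ≤ R →
      volume.real ({x : En n | v i (R • x) ≤ M i - ε} ∩ closedBall 0 2) < μ := by
    intro i
    by_cases hi : i ∈ T
    · obtain ⟨R0, h⟩ := wmv n hn hlam hB (hv i hi) (hs i hi) (M i) (hM i hi) (hM' i hi) ε μ hε hμ0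
      exact ⟨R0, fun _ => h⟩
    · exact ⟨0, fun h => absurd h hi⟩
  choose R0 hR0 using h1
  set R := ∑ i ∈ T, |R0 i|
  have hR : ∀ i ∈ T, R0 i ≤ R := fun i hi =>
    (le_abs_self _).trans (Finset.single_le_sum (f := fun i => |R0 i|) (fun i _ => abs_nonneg _) hi)
  by_contra! hcon
  have hsub : closedBall (0 : En n) 2 ⊆
      ⋃ i ∈ T, ({x : En n | v i (R • x) ≤ M i - ε} ∩ closedBall 0 2) := by
    intro x hx
    obtain ⟨i, hi, h⟩ := hcon (R • x)
    simp only [Set.mem_iUnion]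
    exact ⟨i, hi, h, hx⟩
  have h2 : V ≤ ∑ i ∈ T, volume.real ({x : En n | v i (R • x) ≤ M i - ε} ∩ closedBall 0 2) := by
    refine (measureReal_mono hsub ?_).trans (measureReal_biUnion_finset_le _ _)
    refine ((measure_mono ?_).trans_lt (measure_closedBall_lt_top (x := (0 : En n)) (r := 2))).ne
    exact Set.iUnion₂_subset fun i hi => Set.inter_subset_right
  have h3 : ∑ i ∈ T, volume.real ({x : En n | v i (R • x) ≤ M i - ε} ∩ closedBall 0 2) ≤
      T.card * μ := by
    rw [← nsmul_eq_mul]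
    exact Finset.sum_le_card_nsmul _ _ _ fun i hi => (hR0 i hi R (hR i hi)).le
  have h4 : (T.card : ℝ) * μ < V := by
    rw [hμ, mul_div_assoc', div_lt_iff₀ (by positivity)]
    nlinarith
  linarith

/-- Liouville theorem for bounded two-sided weak solutions. -/
lemma liouville (n : ℕ) (hn : 2 ≤ n) {lam Lam : ℝ} (hlam : 0 < lam)
    {B : En n → Matrix (Fin n) (Fin n) ℝ} (hB : Ell lam Lam B)
    (v : En n → ℝ) (hv : ContDiff ℝ 1 v) (hs : IsSub B v) (hs' : IsSub B (fun x => - v x))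
    (C : ℝ) (hC : ∀ x, |v x| ≤ C) (x y : En n) : v x = v y := by
  have hbd : BddAbove (Set.range v) := ⟨C, by rintro _ ⟨x, rfl⟩; exact (abs_le.mp (hC x)).2⟩
  have hbd' : BddAbove (Set.range fun x => - v x) :=
    ⟨C, by rintro _ ⟨x, rfl⟩; linarith [(abs_le.mp (hC x)).1]⟩
  have key : (⨆ x, v x) + (⨆ x, - v x) ≤ 0 := by
    refine le_of_forall_pos_le_add fun ε hε => ?_
    obtain ⟨x, hx⟩ := simul n hn hlam hB (Finset.univ : Finset Bool)
      (fun b x => if b then v x else - v x) (fun i _ => by cases i <;> simp <;> fun_prop)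
      (fun i _ => by cases i <;> simpa) (fun b => if b then ⨆ x, v x else ⨆ x, - v x)
      (fun i _ x => by
        cases i
        · simpa using le_ciSup hbd' x
        · simpa using le_ciSup hbd x)
      (fun i _ ε hε => by
        cases i
        · simpa using exists_lt_of_lt_ciSup (show (⨆ x, - v x) - ε < ⨆ x, - v x by linarith)
        · simpa using exists_lt_of_lt_ciSup (show (⨆ x, v x) - ε < ⨆ x, v x by linarith))
      (ε / 2) (by positivity)
    have h1 := hx true (Finset.mem_univ _)
    have h2 := hx false (Finset.mem_univ _)
    simp at h1 h2
    linarith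
  have a1 := le_ciSup hbd x
  have a2 := le_ciSup hbd y
  have b1 := le_ciSup hbd' x
  have b2 := le_ciSup hbd' y
  linarith
end

section
set_option linter.all false
/-! ### Part B: matrix calculus -/

abbrev Mn (n : ℕ) := Matrix (Fin n) (Fin n) ℝ

section
variable {n : ℕ} {E : Type*} [NormedAddCommGroup E] [NormedSpace ℝ E] {k : WithTop ℕ∞}

/-- Entrywise smoothness of a matrix field. -/
def MC (k : WithTop ℕ∞) (A : E → Mn n) : Prop := ∀ i j, ContDiff ℝ k (fun y => A y i j)

/-- Entrywise directional derivative of a matrix field. -/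
def dmat (A : E → Mn n) (x v : E) : Mn n := Matrix.of fun i j => fderiv ℝ (fun y => A y i j) x v

lemma MC.of_le {A : E → Mn n} {l : WithTop ℕ∞} (hA : MC k A) (h : l ≤ k) : MC l A :=
  fun i j => (hA i j).of_le h

lemma MC.const (A : Mn n) : MC k (fun _ : E => A) := fun i j => contDiff_const

lemma MC.add {A B : E → Mn n} (hA : MC k A) (hB : MC k B) : MC k (fun x => A x + B x) :=
  fun i j => (hA i j).add (hB i j)

lemma MC.sub {A B : E → Mn n} (hA : MC k A) (hB : MC k B) : MC k (fun x => A x - B x) :=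
  fun i j => (hA i j).sub (hB i j)

lemma MC.smul {A : E → Mn n} {c : E → ℝ} (hc : ContDiff ℝ k c) (hA : MC k A) :
    MC k (fun x => c x • A x) :=
  fun i j => hc.mul (hA i j)

lemma MC.mul {A B : E → Mn n} (hA : MC k A) (hB : MC k B) : MC k (fun x => A x * B x) := by
  intro i j
  simp only [Matrix.mul_apply]
  exact ContDiff.sum fun l _ => (hA i l).mul (hB l j)

lemma MC.trace {A : E → Mn n} (hA : MC k A) : ContDiff ℝ k (fun x => (A x).trace) := by
  simp only [Matrix.trace, Matrix.diag]
  exact ContDiff.sum fun i _ => hA i i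

lemma MC.det {A : E → Mn n} (hA : MC k A) : ContDiff ℝ k (fun x => (A x).det) := by
  simp only [Matrix.det_apply]
  refine ContDiff.sum fun σ _ => ContDiff.const_smul _ ?_
  exact contDiff_prod fun i _ => hA _ _

lemma MC.inv {A : E → Mn n} (hA : MC k A) (hd : ∀ x, (A x).det ≠ 0) :
    MC k (fun x => (A x)⁻¹) := by
  intro i j
  simp only [Matrix.inv_def, Ring.inverse_eq_inv', Matrix.smul_apply, smul_eq_mul,
    Matrix.adjugate_apply]
  refine (hA.det.inv hd).mul ?_
  apply MC.det (A := fun x => (A x).updateRow j (Pi.single i 1))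
  intro a b
  by_cases h : a = j
  · subst h; simp only [Matrix.updateRow_self]; exact contDiff_const
  · simp only [Matrix.updateRow_ne h]; exact hA a b

lemma MC.cont {A : E → Mn n} (hA : MC k A) : Continuous A :=
  continuous_matrix fun i j => (hA i j).continuous

lemma MC.diff {A : E → Mn n} (hA : MC 1 A) (i j : Fin n) (x : E) :
    DifferentiableAt ℝ (fun y => A y i j) x := (hA i j).differentiable one_ne_zero x

lemma dmat_mul {A B : E → Mn n} (hA : MC 1 A) (hB : MC 1 B) (x v : E) :
    dmat (fun x => A x * B x) x v = dmat A x v * B x + A x * dmat B x v := by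
  ext i j
  simp only [dmat, Matrix.of_apply, Matrix.add_apply, Matrix.mul_apply]
  have h : HasFDerivAt (fun y => ∑ l, A y i l * B y l j)
      (∑ l, (A x i l • fderiv ℝ (fun y => B y l j) x + B x l j • fderiv ℝ (fun y => A y i l) x)) x :=
    HasFDerivAt.fun_sum fun l _ => (hA.diff i l x).hasFDerivAt.mul (hB.diff l j x).hasFDerivAt
  rw [h.fderiv]
  simp only [ContinuousLinearMap.sum_apply, _root_.add_apply, _root_.smul_apply, smul_eq_mul,
    Finset.sum_add_distrib]
  rw [add_comm]
  congr 1
  exact Finset.sum_congr rfl fun l _ => mul_comm _ _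

lemma dmat_add {A B : E → Mn n} (hA : MC 1 A) (hB : MC 1 B) (x v : E) :
    dmat (fun x => A x + B x) x v = dmat A x v + dmat B x v := by
  ext i j
  simp only [dmat, Matrix.of_apply, Matrix.add_apply]
  have := ((hA.diff i j x).hasFDerivAt.add (hB.diff i j x).hasFDerivAt).fderiv
  refine (congrArg (fun L => L v) this).trans ?_
  simp

lemma dmat_const (A : Mn n) (x v : E) : dmat (fun _ : E => A) x v = 0 := by
  ext i j
  simp [dmat]

lemma dmat_trace {A : E → Mn n} (hA : MC 1 A) (x v : E) :
    fderiv ℝ (fun x => (A x).trace) x v = (dmat A x v).trace := by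
  simp only [Matrix.trace, Matrix.diag, dmat, Matrix.of_apply]
  have h : HasFDerivAt (fun y => ∑ l, A y l l) (∑ l, fderiv ℝ (fun y => A y l l) x) x :=
    HasFDerivAt.fun_sum fun l _ => (hA.diff l l x).hasFDerivAt
  rw [h.fderiv]
  simp

lemma dmat_inv {A : E → Mn n} (hA : MC 1 A) (hd : ∀ x, (A x).det ≠ 0) (x v : E) :
    dmat (fun x => (A x)⁻¹) x v = - ((A x)⁻¹ * dmat A x v * (A x)⁻¹) := by
  have hu : ∀ x, IsUnit (A x).det := fun x => isUnit_iff_ne_zero.mpr (hd x)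
  have h := dmat_mul hA (hA.inv hd) x v
  have e : (fun x => A x * (A x)⁻¹) = fun _ => 1 := by
    ext1 x; exact Matrix.mul_nonsing_inv _ (hu x)
  rw [e, dmat_const] at h
  have h2 := congrArg (fun Z => (A x)⁻¹ * Z) h
  simp only [mul_zero, mul_add] at h2
  rw [← mul_assoc ((A x)⁻¹) (A x), Matrix.nonsing_inv_mul _ (hu x), one_mul, ← mul_assoc] at h2
  exact (neg_eq_of_add_eq_zero_right h2.symm).symm

/-- Jacobi's formula. -/
lemma dmat_det {A : E → Mn n} (hA : MC 1 A) (hd : ∀ x, (A x).det ≠ 0) (x v : E) :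
    fderiv ℝ (fun x => (A x).det) x v = (A x).det * ((A x)⁻¹ * dmat A x v).trace := by
  let ev : (Fin n → Fin n → ℝ) → Mn n := fun M => Matrix.of M
  have hev : MC 1 ev := fun i j => by
    simp only [ev, Matrix.of_apply]; fun_prop
  have hD : Differentiable ℝ (fun M : Fin n → Fin n → ℝ => (ev M).det) :=
    hev.det.differentiable one_ne_zero
  let A' : E → (Fin n → Fin n → ℝ) := fun y i j => A y i j
  let H : Fin n → Fin n → ℝ := fun i j => fderiv ℝ (fun y => A y i j) x v
  have hA' : DifferentiableAt ℝ A' x :=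
    differentiableAt_pi.mpr fun i => differentiableAt_pi.mpr fun j => hA.diff i j x
  have h1 : fderiv ℝ A' x v = H := by
    have : HasFDerivAt A' (ContinuousLinearMap.pi fun i => ContinuousLinearMap.pi fun j =>
        fderiv ℝ (fun y => A y i j) x) x :=
      hasFDerivAt_pi.mpr fun i => hasFDerivAt_pi.mpr fun j => (hA.diff i j x).hasFDerivAt
    rw [this.fderiv]
    rfl
  have h2 : fderiv ℝ (fun x => (A x).det) x v =
      fderiv ℝ (fun M : Fin n → Fin n → ℝ => (ev M).det) (A' x) H := by
    have := ((hD (A' x)).hasFDerivAt.comp x hA'.hasFDerivAt).fderiv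
    rw [← h1]
    exact congrArg (fun L => L v) this
  rw [h2]
  -- derivative along a line
  have h3 : HasDerivAt (fun r : ℝ => (ev (A' x + r • H)).det)
      (fderiv ℝ (fun M : Fin n → Fin n → ℝ => (ev M).det) (A' x) H) 0 := by
    have l : HasDerivAt (fun r : ℝ => A' x + r • H) H 0 := by
      simpa using ((hasDerivAt_id (0 : ℝ)).smul_const H).const_add (A' x)
    have hh : HasFDerivAt (fun M : Fin n → Fin n → ℝ => (ev M).det)
      (fderiv ℝ (fun M : Fin n → Fin n → ℝ => (ev M).det) (A' x)) (A' x + (0 : ℝ) • H) := by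
      simpa using (hD (A' x)).hasFDerivAt
    exact hh.comp_hasDerivAt 0 l
  let K : Mn n := (A x)⁻¹ * dmat A x v
  have h4 : ∀ r : ℝ, (ev (A' x + r • H)).det = (A x).det * (1 + r • K).det := by
    intro r
    rw [← Matrix.det_mul]
    congr 1
    rw [mul_add, mul_one, Matrix.mul_smul]
    simp only [K]
    rw [← mul_assoc, Matrix.mul_nonsing_inv _ (isUnit_iff_ne_zero.mpr (hd x)), one_mul]
    ext i j
    simp [ev, A', H, dmat]
  have h5 : HasDerivAt (fun r : ℝ => (1 + r • K).det) K.trace 0 := by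
    rw [show (fun r : ℝ => (1 + r • K).det) = _ from funext fun r => Matrix.det_one_add_smul r K]
    generalize (Matrix.det (1 + (Polynomial.X : Polynomial ℝ) • K.map Polynomial.C)).divX.divX = q
    have a1 := (((hasDerivAt_id (0 : ℝ)).const_mul K.trace).const_add 1).add
      ((q.hasDerivAt 0).mul (hasDerivAt_pow 2 (0 : ℝ)))
    refine a1.congr_deriv ?_
    simp
  simp_rw [h4] at h3
  exact h3.unique (h5.const_mul _)
end
end

section
set_option linter.all false
lemma arctan_subadd {a b : ℝ} (ha : 0 ≤ a) (hb : 0 ≤ b) :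
    Real.arctan (a + b) ≤ Real.arctan a + Real.arctan b := by
  by_cases h : a * b < 1
  · rw [Real.arctan_add h]
    apply Real.arctan_strictMono.monotone
    rw [le_div_iff₀ (by linarith)]
    nlinarith [mul_nonneg ha hb]
  · push Not at h
    have ha' : 0 < a := by
      rcases ha.lt_or_eq with h1 | h1
      · exact h1
      · rw [← h1] at h; linarith
    have h2 : a⁻¹ ≤ b := by rw [inv_le_iff_one_le_mul₀ ha']; linarith
    have h3 := Real.arctan_strictMono.monotone h2
    rw [Real.arctan_inv_of_pos ha'] at h3
    linarith [Real.arctan_lt_pi_div_two (a + b)]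

lemma arctan_sum_le {ι : Type*} (T : Finset ι) (a : ι → ℝ) (ha : ∀ i ∈ T, 0 ≤ a i) :
    Real.arctan (∑ i ∈ T, a i) ≤ ∑ i ∈ T, Real.arctan (a i) := by
  classical
  induction T using Finset.induction_on with
  | empty => simp
  | insert i s hi ih =>
    rw [Finset.sum_insert hi, Finset.sum_insert hi]
    have h1 := ih fun j hj => ha j (Finset.mem_insert_of_mem hj)
    have h2 := arctan_subadd (ha i (Finset.mem_insert_self _ _))
      (Finset.sum_nonneg fun j hj => ha j (Finset.mem_insert_of_mem hj) : 0 ≤ ∑ j ∈ s, a j)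
    linarith

lemma sum_pair_split {n : ℕ} (d : Fin n → ℝ) (k : Fin n) :
    ∑ i, d i = d k + ∑ i ∈ Finset.univ.erase k, d i :=
  (Finset.add_sum_erase _ _ (Finset.mem_univ k)).symm

lemma pair_nonneg {n : ℕ} (d : Fin n → ℝ)
    (h : ((n : ℝ) - 2) * (π / 2) ≤ ∑ i, Real.arctan (d i)) (i j : Fin n) (hij : i ≠ j) :
    0 ≤ d i + d j := by
  have h1 := sum_pair_split (fun i => Real.arctan (d i)) i
  have hj : j ∈ Finset.univ.erase i := by simp [hij.symm]
  have h2 := (Finset.add_sum_erase (Finset.univ.erase i) (fun i => Real.arctan (d i)) hj).symm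
  have h3 : ∑ l ∈ (Finset.univ.erase i).erase j, Real.arctan (d l) ≤
      ((Finset.univ.erase i).erase j).card • (π / 2) :=
    Finset.sum_le_card_nsmul _ _ _ fun l _ => (Real.arctan_lt_pi_div_two _).le
  have hc : (((Finset.univ.erase i).erase j).card : ℝ) = (n : ℝ) - 2 := by
    rw [Finset.card_erase_of_mem hj, Finset.card_erase_of_mem (Finset.mem_univ _), Finset.card_univ,
      Fintype.card_fin]
    have : 2 ≤ n := by
      have := i.2; have := j.2; have : (i : ℕ) ≠ j := fun h => hij (Fin.ext h); omega
    rw [Nat.sub_sub, Nat.cast_sub this]; norm_num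
  rw [nsmul_eq_mul, hc] at h3
  have h4 : 0 ≤ Real.arctan (d i) + Real.arctan (d j) := by linarith
  have h5 : Real.arctan (-d j) ≤ Real.arctan (d i) := by rw [Real.arctan_neg]; linarith
  have := Real.arctan_strictMono.le_iff_le.mp h5
  linarith

lemma diag_nonneg {n : ℕ} (hn : 2 ≤ n) (d y : Fin n → ℝ)
    (h : ((n : ℝ) - 2) * (π / 2) ≤ ∑ i, Real.arctan (d i)) (hy : ∑ i, y i = 0) :
    0 ≤ ∑ i, d i * (y i) ^ 2 := by
  by_cases hd : ∀ i, 0 ≤ d i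
  · exact Finset.sum_nonneg fun i _ => mul_nonneg (hd i) (sq_nonneg _)
  push Not at hd
  obtain ⟨k, hk⟩ := hd
  set S := Finset.univ.erase k with hS
  have hpos : ∀ i ∈ S, 0 < d i := fun i hi => by
    have hne : i ≠ k := (Finset.mem_erase.mp hi).1
    have := pair_nonneg d h i k hne
    linarith
  have hnk : 0 < -d k := by linarith
  have hcard : (S.card : ℝ) = n - 1 := by
    rw [hS, Finset.card_erase_of_mem (Finset.mem_univ _), Finset.card_univ, Fintype.card_fin,
      Nat.cast_sub (by omega)]
    simp
  have h1 : ∑ i ∈ S, (d i)⁻¹ ≤ (-d k)⁻¹ := by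
    apply Real.arctan_strictMono.le_iff_le.mp
    refine (arctan_sum_le S _ fun i hi => (inv_pos.mpr (hpos i hi)).le).trans ?_
    have e : ∑ i ∈ S, Real.arctan ((d i)⁻¹) = ∑ i ∈ S, (π / 2 - Real.arctan (d i)) :=
      Finset.sum_congr rfl fun i hi => Real.arctan_inv_of_pos (hpos i hi)
    rw [e, Real.arctan_inv_of_pos hnk, Real.arctan_neg, Finset.sum_sub_distrib, Finset.sum_const,
      nsmul_eq_mul, hcard]
    have := sum_pair_split (fun i => Real.arctan (d i)) k
    linarith
  have h2 : (∑ i ∈ S, y i) ^ 2 ≤ (∑ i ∈ S, d i * (y i) ^ 2) * ∑ i ∈ S, (d i)⁻¹ := by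
    have := Finset.sum_sq_le_sum_mul_sum_of_sq_eq_mul S (r := fun i => y i)
      (f := fun i => d i * (y i) ^ 2) (g := fun i => (d i)⁻¹)
      (fun i hi => mul_nonneg (hpos i hi).le (sq_nonneg _)) (fun i hi => (inv_pos.mpr (hpos i hi)).le)
      (fun i hi => by have := (hpos i hi).ne'; field_simp)
    exact this
  have h3 : ∑ i ∈ S, y i = - y k := by
    have := sum_pair_split y k
    linarith
  have h4 := sum_pair_split (fun i => d i * (y i) ^ 2) k
  rw [h4]
  have hQ : 0 ≤ ∑ i ∈ S, d i * (y i) ^ 2 :=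
    Finset.sum_nonneg fun i hi => mul_nonneg (hpos i hi).le (sq_nonneg _)
  set Q := ∑ i ∈ S, d i * (y i) ^ 2
  rw [h3] at h2
  have h5 : (- y k) ^ 2 ≤ Q * (-d k)⁻¹ := h2.trans (mul_le_mul_of_nonneg_left h1 hQ)
  rw [← div_eq_mul_inv, le_div_iff₀ hnk] at h5
  nlinarith

/-- The algebraic inequality behind the subsolution property of the second derivatives. -/
lemma alg_diag {n : ℕ} (hn : 2 ≤ n) (d : Fin n → ℝ) (Y : Matrix (Fin n) (Fin n) ℝ)
    (h : ((n : ℝ) - 2) * (π / 2) ≤ ∑ i, Real.arctan (d i))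
    (hY : ∑ i, Y i i / (1 + d i ^ 2) = 0) :
    0 ≤ ∑ i, ∑ j, (d i + d j) * (Y i j) ^ 2 / ((1 + d i ^ 2) * (1 + d j ^ 2)) := by
  have h1 := diag_nonneg hn d (fun i => Y i i / (1 + d i ^ 2)) h hY
  have h2 : ∑ i, d i * (Y i i / (1 + d i ^ 2)) ^ 2 * 2 ≤
      ∑ i, ∑ j, (d i + d j) * (Y i j) ^ 2 / ((1 + d i ^ 2) * (1 + d j ^ 2)) := by
    refine Finset.sum_le_sum fun i _ => ?_
    have e : d i * (Y i i / (1 + d i ^ 2)) ^ 2 * 2 =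
        (d i + d i) * (Y i i) ^ 2 / ((1 + d i ^ 2) * (1 + d i ^ 2)) := by
      have : 1 + d i ^ 2 ≠ 0 := by positivity
      field_simp; ring
    rw [e]
    rw [sum_pair_split (fun j => (d i + d j) * (Y i j) ^ 2 / ((1 + d i ^ 2) * (1 + d j ^ 2))) i]
    have : 0 ≤ ∑ j ∈ Finset.univ.erase i, (d i + d j) * (Y i j) ^ 2 / ((1 + d i ^ 2) * (1 + d j ^ 2)) := by
      refine Finset.sum_nonneg fun j hj => ?_
      have := pair_nonneg d h i j (Finset.mem_erase.mp hj).1.symm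
      positivity
    linarith
  rw [← Finset.sum_mul] at h2
  linarith

/-- orthogonal diagonalisation data -/
structure Dg {n : ℕ} (N O : Matrix (Fin n) (Fin n) ℝ) (d : Fin n → ℝ) : Prop where
  left : Oᵀ * O = 1
  right : O * Oᵀ = 1
  eq : N = O * diagonal d * Oᵀ

section
variable {n : ℕ} {N O N' : Matrix (Fin n) (Fin n) ℝ} {d d' : Fin n → ℝ}

lemma Dg.symm (h : Dg N O d) : Nᵀ = N := by
  rw [h.eq]; simp [Matrix.transpose_mul, mul_assoc]

lemma Dg.mul (h : Dg N O d) (h' : Dg N' O d') : Dg (N * N') O (fun i => d i * d' i) := by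
  refine ⟨h.left, h.right, ?_⟩
  rw [h.eq, h'.eq, ← Matrix.diagonal_mul_diagonal]
  calc _ = O * diagonal d * (Oᵀ * O) * diagonal d' * Oᵀ := by simp only [mul_assoc]
    _ = _ := by rw [h.left]; simp only [mul_assoc, mul_one]

lemma Dg.add (h : Dg N O d) (h' : Dg N' O d') : Dg (N + N') O (fun i => d i + d' i) := by
  refine ⟨h.left, h.right, ?_⟩
  rw [h.eq, h'.eq, ← Matrix.diagonal_add]
  simp only [mul_add, add_mul]

lemma Dg.smul (h : Dg N O d) (c : ℝ) : Dg (c • N) O (fun i => c * d i) := by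
  refine ⟨h.left, h.right, ?_⟩
  rw [h.eq]
  have : diagonal (fun i => c * d i) = c • diagonal d := by
    rw [← Matrix.diagonal_smul]; rfl
  rw [this]
  simp

lemma Dg.one (h : Dg N O d) : Dg (1 : Matrix (Fin n) (Fin n) ℝ) O (fun _ => 1) := by
  refine ⟨h.left, h.right, ?_⟩
  rw [Matrix.diagonal_one, mul_one, h.right]

lemma Dg.congr (h : Dg N O d) (hd : ∀ i, d i = d' i) : Dg N O d' := by
  have : d = d' := funext hd
  exact this ▸ h

lemma Dg.det (h : Dg N O d) : N.det = ∏ i, d i := by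
  rw [h.eq, Matrix.det_mul, Matrix.det_mul, mul_right_comm, ← Matrix.det_mul, h.right]
  simp

lemma Dg.trace (h : Dg N O d) : N.trace = ∑ i, d i := by
  rw [h.eq, Matrix.trace_mul_comm, ← mul_assoc, h.left, one_mul, Matrix.trace_diagonal]

lemma Dg.inv (h : Dg N O d) (hd : ∀ i, d i ≠ 0) : Dg N⁻¹ O (fun i => (d i)⁻¹) := by
  refine ⟨h.left, h.right, ?_⟩
  apply Matrix.inv_eq_left_inv
  have h1 : Dg (O * diagonal (fun i => (d i)⁻¹) * Oᵀ) O (fun i => (d i)⁻¹) := ⟨h.left, h.right, rfl⟩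
  have h2 := ((h1.mul h).congr (d' := fun _ => 1) fun i => inv_mul_cancel₀ (hd i))
  rw [h2.eq, Matrix.diagonal_one, mul_one, h.right]

lemma Dg.gg (h : Dg N O d) : Dg (1 + N * N) O (fun i => 1 + d i ^ 2) :=
  (h.one.add (h.mul h)).congr fun i => by ring

lemma gpos (d : ℝ) : (0 : ℝ) < 1 + d ^ 2 := by positivity

lemma Dg.ginv (h : Dg N O d) : Dg (1 + N * N)⁻¹ O (fun i => (1 + d i ^ 2)⁻¹) :=
  h.gg.inv fun i => (gpos _).ne'

lemma Dg.gdet (h : Dg N O d) : (1 + N * N).det = ∏ i, (1 + d i ^ 2) := h.gg.det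

lemma alg_ineq (hn : 2 ≤ n) (h : Dg N O d) (X : Matrix (Fin n) (Fin n) ℝ) (hX : Xᵀ = X)
    (hth : ((n : ℝ) - 2) * (π / 2) ≤ ∑ i, Real.arctan (d i))
    (htr : ((1 + N * N)⁻¹ * X).trace = 0) :
    0 ≤ ((1 + N * N)⁻¹ * (X * N + N * X) * (1 + N * N)⁻¹ * X).trace := by
  set Y := Oᵀ * X * O with hY
  have hYs : Yᵀ = Y := by simp [hY, Matrix.transpose_mul, hX, mul_assoc]
  have hXY : X = O * Y * Oᵀ := by
    calc X = (O * Oᵀ) * X * (O * Oᵀ) := by rw [h.right]; simp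
      _ = _ := by rw [hY]; simp only [mul_assoc]
  have hg := h.ginv
  set g := (1 + N * N)⁻¹
  set e : Fin n → ℝ := fun i => (1 + d i ^ 2)⁻¹ with he
  have L : ∀ Z : Matrix (Fin n) (Fin n) ℝ, Oᵀ * (O * Z) = Z := fun Z => by
    rw [← mul_assoc, h.left, one_mul]
  have htr' : ∑ i, Y i i / (1 + d i ^ 2) = 0 := by
    rw [← htr, hg.eq, hXY]
    have : O * diagonal e * Oᵀ * (O * Y * Oᵀ) = O * (diagonal e * Y * Oᵀ) := by
      simp only [mul_assoc, L]
    rw [this, Matrix.trace_mul_comm, mul_assoc, h.left, mul_one, Matrix.trace]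
    refine Finset.sum_congr rfl fun i _ => ?_
    simp [Matrix.diagonal_mul, he]; ring
  have hfin := alg_diag hn d Y hth htr'
  refine hfin.trans (le_of_eq ?_)
  have : g * (X * N + N * X) * g * X =
      O * (diagonal e * (Y * diagonal d + diagonal d * Y) * diagonal e * Y * Oᵀ) := by
    rw [hg.eq, hXY, h.eq]
    simp only [mul_assoc, L, mul_add, add_mul]
  rw [this, Matrix.trace_mul_comm, mul_assoc, h.left, mul_one, Matrix.trace]
  refine Finset.sum_congr rfl fun i _ => ?_
  rw [Matrix.diag_apply, Matrix.mul_apply]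
  refine Finset.sum_congr rfl fun j _ => ?_
  have hs : Y j i = Y i j := by
    have := congrFun (congrFun hYs i) j
    simpa using this
  rw [Matrix.mul_diagonal, Matrix.diagonal_mul, Matrix.add_apply, Matrix.mul_diagonal,
    Matrix.diagonal_mul, hs]
  simp only [he]
  have := (gpos (d i)).ne'
  have := (gpos (d j)).ne'
  field_simp
  ring

end
end

section
set_option linter.all false
/-- The phase function of a symmetric matrix. -/
def Th {n : ℕ} (A : Mn n) : ℝ := ∫ t in (0 : ℝ)..1, (A * (1 + t ^ 2 • (A * A))⁻¹).trace

section
variable {n : ℕ}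

lemma exists_dg {A : Mn n} (h : A.IsHermitian) : ∃ O, Dg A O h.eigenvalues := by
  have hs : (star (h.eigenvectorUnitary : Mn n)) = (h.eigenvectorUnitary : Mn n)ᵀ := by
    rw [star_eq_conjTranspose, conjTranspose_eq_transpose_of_trivial]
  refine ⟨(h.eigenvectorUnitary : Mn n), ?_, ?_, ?_⟩
  · rw [← hs]; exact Unitary.coe_star_mul_self _
  · rw [← hs]; exact Unitary.coe_mul_star_self _
  · have := h.spectral_theorem
    rw [Unitary.conjStarAlgAut_apply] at this
    rw [← hs]
    exact this

lemma exists_dg' {A : Mn n} (h : Aᵀ = A) : ∃ O d, Dg A O d := by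
  have : A.IsHermitian := by rw [Matrix.IsHermitian, conjTranspose_eq_transpose_of_trivial, h]
  obtain ⟨O, hO⟩ := exists_dg this
  exact ⟨O, _, hO⟩

lemma Dg.rt {N O : Mn n} {d : Fin n → ℝ} (h : Dg N O d) (t : ℝ) :
    Dg (1 + t ^ 2 • (N * N)) O (fun i => 1 + (t * d i) ^ 2) :=
  (h.one.add ((h.mul h).smul _)).congr fun i => by ring

lemma rt_det {A : Mn n} (h : Aᵀ = A) (t : ℝ) : (1 + t ^ 2 • (A * A)).det ≠ 0 := by
  obtain ⟨O, d, hd⟩ := exists_dg' h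
  rw [(hd.rt t).det]
  exact Finset.prod_ne_zero_iff.mpr fun i _ => (gpos _).ne'

lemma g_det {A : Mn n} (h : Aᵀ = A) : 0 < (1 + A * A).det := by
  obtain ⟨O, d, hd⟩ := exists_dg' h
  rw [hd.gdet]
  exact Finset.prod_pos fun i _ => gpos _

lemma Th_dg {N O : Mn n} {d : Fin n → ℝ} (h : Dg N O d) : Th N = ∑ i, Real.arctan (d i) := by
  have e : ∀ t : ℝ, (N * (1 + t ^ 2 • (N * N))⁻¹).trace = ∑ i, d i * (1 + (t * d i) ^ 2)⁻¹ := fun t =>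
    (h.mul ((h.rt t).inv fun i => (gpos _).ne')).trace
  have hc : ∀ i, Continuous fun t : ℝ => d i * (1 + (t * d i) ^ 2)⁻¹ := fun i =>
    continuous_const.mul (Continuous.inv₀ (by fun_prop) fun t => (gpos _).ne')
  unfold Th
  simp_rw [e]
  rw [intervalIntegral.integral_finset_sum fun i _ => (hc i).intervalIntegrable _ _]
  refine Finset.sum_congr rfl fun i _ => ?_
  have := intervalIntegral.integral_eq_sub_of_hasDerivAt (a := 0) (b := 1)
    (f := fun t => Real.arctan (t * d i)) (f' := fun t => d i * (1 + (t * d i) ^ 2)⁻¹)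
    (fun t _ => by
      have := ((hasDerivAt_id t).mul_const (d i)).arctan
      refine this.congr_deriv ?_
      simp; ring) ((hc i).intervalIntegrable _ _)
  rw [this]; simp

variable {E : Type*} [NormedAddCommGroup E] [NormedSpace ℝ E] [ProperSpace E]

lemma dmat_smul_const {E : Type*} [NormedAddCommGroup E] [NormedSpace ℝ E]
    {A : E → Mn n} (hA : MC 1 A) (c : ℝ) (x v : E) :
    dmat (fun x => c • A x) x v = c • dmat A x v := by
  ext i j
  simp only [dmat, Matrix.of_apply, Matrix.smul_apply, smul_eq_mul]
  have := ((hA.diff i j x).hasFDerivAt.const_mul c).fderiv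
  refine (congrArg (fun L => L v) this).trans ?_
  simp

lemma Th_F_deriv {E : Type*} [NormedAddCommGroup E] [NormedSpace ℝ E]
    {A : E → Mn n} (hA : MC 1 A) (hs : ∀ x, (A x)ᵀ = A x) (x v : E) (t : ℝ) :
    fderiv ℝ (fun x => (A x * (1 + t ^ 2 • (A x * A x))⁻¹).trace) x v =
      ((1 + t ^ 2 • (A x * A x))⁻¹ * dmat A x v).trace - 2 * t ^ 2 *
        ((1 + t ^ 2 • (A x * A x))⁻¹ * (A x * A x) * (1 + t ^ 2 • (A x * A x))⁻¹ * dmat A x v).trace := by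
  have hq : MC 1 (fun x => 1 + t ^ 2 • (A x * A x)) :=
    (MC.const 1).add (MC.smul contDiff_const (hA.mul hA))
  have hqd : ∀ x, (1 + t ^ 2 • (A x * A x)).det ≠ 0 := fun x => rt_det (hs x) t
  have hR := hq.inv hqd
  rw [dmat_trace (hA.mul hR), dmat_mul hA hR, dmat_inv hq hqd,
    dmat_add (MC.const 1) (MC.smul contDiff_const (hA.mul hA)), dmat_const,
    dmat_smul_const (hA.mul hA), dmat_mul hA hA]
  have hcomm : A x * (1 + t ^ 2 • (A x * A x))⁻¹ = (1 + t ^ 2 • (A x * A x))⁻¹ * A x := by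
    have hu : IsUnit (1 + t ^ 2 • (A x * A x)).det := isUnit_iff_ne_zero.mpr (hqd x)
    have h1 : A x * (1 + t ^ 2 • (A x * A x)) = (1 + t ^ 2 • (A x * A x)) * A x := by
      simp [mul_add, add_mul, mul_assoc]
    calc _ = ((1 + t ^ 2 • (A x * A x))⁻¹ * (1 + t ^ 2 • (A x * A x))) * A x *
          (1 + t ^ 2 • (A x * A x))⁻¹ := by rw [Matrix.nonsing_inv_mul _ hu, one_mul]
      _ = (1 + t ^ 2 • (A x * A x))⁻¹ * (A x * (1 + t ^ 2 • (A x * A x))) *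
          (1 + t ^ 2 • (A x * A x))⁻¹ := by rw [h1]; simp only [mul_assoc]
      _ = _ := by rw [mul_assoc, mul_assoc, Matrix.mul_nonsing_inv _ hu, mul_one]
  generalize (1 + t ^ 2 • (A x * A x))⁻¹ = R at *
  generalize dmat A x v = X
  generalize A x = N at *
  rw [zero_add, Matrix.trace_add, mul_neg, Matrix.trace_neg, Matrix.trace_mul_comm X R, mul_smul_comm,
    smul_mul_assoc, mul_smul_comm, Matrix.trace_smul, mul_add, add_mul, mul_add, Matrix.trace_add]
  have e1 : (N * (R * (X * N) * R)).trace = (R * (N * N) * R * X).trace := by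
    calc (N * (R * (X * N) * R)).trace = ((N * R) * (X * (N * R))).trace := by simp only [mul_assoc]
      _ = ((X * (N * R)) * (N * R)).trace := Matrix.trace_mul_comm _ _
      _ = (X * (R * (N * N) * R)).trace := by
        congr 1
        rw [mul_assoc X]
        congr 1
        calc N * R * (N * R) = R * N * (N * R) := by rw [hcomm]
          _ = _ := by simp only [mul_assoc]
      _ = _ := Matrix.trace_mul_comm _ _
  have e2 : (N * (R * (N * X) * R)).trace = (R * (N * N) * R * X).trace := by
    calc (N * (R * (N * X) * R)).trace = ((N * R * N) * (X * R)).trace := by simp only [mul_assoc]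
      _ = ((X * R) * (N * R * N)).trace := Matrix.trace_mul_comm _ _
      _ = (X * (R * (N * N) * R)).trace := by
        congr 1; simp only [mul_assoc]; rw [hcomm]
      _ = _ := Matrix.trace_mul_comm _ _
  rw [e1, e2, smul_eq_mul]
  ring

lemma Th_t_deriv {N : Mn n} (hs : Nᵀ = N) (X : Mn n) (t : ℝ) :
    HasDerivAt (fun t : ℝ => t * ((1 + t ^ 2 • (N * N))⁻¹ * X).trace)
      (((1 + t ^ 2 • (N * N))⁻¹ * X).trace - 2 * t ^ 2 *
        ((1 + t ^ 2 • (N * N))⁻¹ * (N * N) * (1 + t ^ 2 • (N * N))⁻¹ * X).trace) t := by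
  have hsm : MC 1 (fun t : ℝ => t ^ 2 • (N * N)) :=
    MC.smul (contDiff_id.pow 2) (MC.const (N * N))
  have hq : MC 1 (fun t : ℝ => 1 + t ^ 2 • (N * N)) := (MC.const 1).add hsm
  have hqd : ∀ t : ℝ, (1 + t ^ 2 • (N * N)).det ≠ 0 := fun t => rt_det hs t
  have hR := hq.inv hqd
  have hRX := hR.mul (MC.const X)
  have hd : dmat (fun t : ℝ => t ^ 2 • (N * N)) t 1 = (2 * t) • (N * N) := by
    ext i j
    simp only [dmat, Matrix.of_apply, Matrix.smul_apply, smul_eq_mul]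
    rw [fderiv_apply_one_eq_deriv]
    have := ((hasDerivAt_pow 2 t).mul_const ((N * N) i j)).deriv
    rw [this]; simp
  have h1 : deriv (fun t : ℝ => ((1 + t ^ 2 • (N * N))⁻¹ * X).trace) t =
      - (2 * t) * ((1 + t ^ 2 • (N * N))⁻¹ * (N * N) * (1 + t ^ 2 • (N * N))⁻¹ * X).trace := by
    rw [← fderiv_apply_one_eq_deriv, dmat_trace hRX, dmat_mul hR (MC.const X), dmat_const,
      dmat_inv hq hqd, dmat_add (MC.const 1) hsm, dmat_const, hd, mul_zero, add_zero, zero_add,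
      mul_smul_comm, smul_mul_assoc, neg_mul, smul_mul_assoc, Matrix.trace_neg, Matrix.trace_smul,
      smul_eq_mul]
    ring
  have h2 : DifferentiableAt ℝ (fun t : ℝ => ((1 + t ^ 2 • (N * N))⁻¹ * X).trace) t :=
    hRX.trace.differentiable one_ne_zero t
  refine ((hasDerivAt_id t).mul h2.hasDerivAt).congr_deriv ?_
  rw [h1]
  simp only [id]
  ring

/-- The derivative of the phase. -/
lemma Th_deriv {A : E → Mn n} (hA : MC 1 A) (hs : ∀ x, (A x)ᵀ = A x) (x : E) :
    DifferentiableAt ℝ (fun y => Th (A y)) x ∧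
    ∀ v, fderiv ℝ (fun y => Th (A y)) x v = ((1 + A x * A x)⁻¹ * dmat A x v).trace := by
  let FF : E × ℝ → ℝ := fun p => (A p.1 * (1 + p.2 ^ 2 • (A p.1 * A p.1))⁻¹).trace
  have hA1 : MC 1 (fun p : E × ℝ => A p.1) := fun i j => (hA i j).comp contDiff_fst
  have hq : MC 1 (fun p : E × ℝ => 1 + p.2 ^ 2 • (A p.1 * A p.1)) :=
    (MC.const 1).add (MC.smul (contDiff_snd.pow 2) (hA1.mul hA1))
  have hFF : ContDiff ℝ 1 FF := (hA1.mul (hq.inv fun p => rt_det (hs p.1) p.2)).trace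
  let F' : E → ℝ → (E →L[ℝ] ℝ) := fun y t => fderiv ℝ FF (y, t) ∘L ContinuousLinearMap.inl ℝ E ℝ
  have hF' : ∀ y t, HasFDerivAt (fun y => FF (y, t)) (F' y t) y := fun y t =>
    HasFDerivAt.comp (g := FF) y (hFF.differentiable one_ne_zero (y, t)).hasFDerivAt
      (hasFDerivAt_prodMk_left y t)
  have cF' : Continuous fun p : E × ℝ => F' p.1 p.2 :=
    (hFF.continuous_fderiv one_ne_zero).clm_comp continuous_const
  obtain ⟨C, hC⟩ := ((isCompact_closedBall x 1).prod (isCompact_Icc (a := (0 : ℝ)) (b := 1))).exists_bound_of_continuousOn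
    cF'.continuousOn
  have key := intervalIntegral.hasFDerivAt_integral_of_dominated_of_fderiv_le (μ := volume)
    (F := fun y t => FF (y, t)) (F' := F') (x₀ := x) (a := 0) (b := 1) (bound := fun _ => C)
    (s := closedBall x 1) (closedBall_mem_nhds x one_pos)
    (Filter.Eventually.of_forall fun y =>
      (hFF.continuous.comp (Continuous.prodMk_right y)).aestronglyMeasurable)
    ((hFF.continuous.comp (Continuous.prodMk_right x)).intervalIntegrable _ _)
    ((cF'.comp (Continuous.prodMk_right x)).aestronglyMeasurable)
    (Filter.Eventually.of_forall fun t ht y hy => hC (y, t) ⟨hy, by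
      rw [Set.uIoc_of_le zero_le_one] at ht; exact ⟨ht.1.le, ht.2⟩⟩)
    (by simp)
    (Filter.Eventually.of_forall fun t ht y hy => hF' y t)
  refine ⟨key.differentiableAt, fun v => ?_⟩
  have e : fderiv ℝ (fun y => Th (A y)) x = ∫ t in (0 : ℝ)..1, F' x t := key.fderiv
  have ci : Continuous fun t => F' x t := cF'.comp (Continuous.prodMk_right x)
  rw [e, ContinuousLinearMap.intervalIntegral_apply (ci.intervalIntegrable _ _)]
  have e2 : ∀ t, F' x t v = ((1 + t ^ 2 • (A x * A x))⁻¹ * dmat A x v).trace - 2 * t ^ 2 *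
        ((1 + t ^ 2 • (A x * A x))⁻¹ * (A x * A x) * (1 + t ^ 2 • (A x * A x))⁻¹ * dmat A x v).trace := by
    intro t
    rw [← Th_F_deriv hA hs x v t, ← (hF' x t).fderiv]
  have e3 := intervalIntegral.integral_eq_sub_of_hasDerivAt (a := 0) (b := 1)
    (f := fun t : ℝ => t * ((1 + t ^ 2 • (A x * A x))⁻¹ * dmat A x v).trace)
    (f' := fun t => F' x t v)
    (fun t _ => by rw [e2]; exact Th_t_deriv (hs x) _ t)
    ((ci.clm_apply continuous_const).intervalIntegrable _ _)
  rw [e3]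
  simp

lemma MC.dmat {E : Type*} [NormedAddCommGroup E] [NormedSpace ℝ E] {A : E → Mn n}
    (hA : MC (⊤ : ℕ∞) A) (v : E) : MC (⊤ : ℕ∞) (fun x => dmat A x v) := by
  intro i j
  simp only [_root_.dmat, Matrix.of_apply]
  exact ((hA i j).fderiv_right (m := (⊤ : ℕ∞)) (by simp)).clm_apply contDiff_const

lemma MC.one {E : Type*} [NormedAddCommGroup E] [NormedSpace ℝ E] {A : E → Mn n}
    (hA : MC (⊤ : ℕ∞) A) : MC 1 A := hA.of_le (by exact_mod_cast le_top)

lemma MC.ginv {E : Type*} [NormedAddCommGroup E] [NormedSpace ℝ E] {k : WithTop ℕ∞} {A : E → Mn n}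
    (hA : MC k A) (hs : ∀ x, (A x)ᵀ = A x) : MC k (fun x => (1 + A x * A x)⁻¹) :=
  ((MC.const 1).add (hA.mul hA)).inv fun x => (g_det (hs x)).ne'

lemma Th_smooth {A : En n → Mn n} (hA : MC (⊤ : ℕ∞) A) (hs : ∀ x, (A x)ᵀ = A x) :
    ContDiff ℝ 2 (fun y => Th (A y)) := by
  have h := fun x => Th_deriv hA.one hs x
  have : (2 : WithTop ℕ∞) = 1 + 1 := by norm_num
  rw [this, contDiff_succ_iff_fderiv_apply]
  refine ⟨fun x => (h x).1, by simp, fun v => ?_⟩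
  have e : (fun x => fderiv ℝ (fun y => Th (A y)) x v) =
      fun x => ((1 + A x * A x)⁻¹ * dmat A x v).trace := by
    ext x; exact (h x).2 v
  rw [e]
  exact ((hA.one.ginv hs).mul (hA.dmat v).one).trace
end
end

section
set_option linter.all false
section
variable {n : ℕ}

/-- Strict monotonicity of the phase. -/
lemma Th_strict {M A : Mn n} (hM : Mᵀ = M) (hA : Aᵀ = A) (hP : (A - M).PosSemidef)
    (hT : Th A = Th M) : A = M := by
  set P := A - M with hPdef
  let p : ℝ → Mn n := fun s => M + s • P
  have hPt : Pᵀ = P := by simp [hPdef, hM, hA]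
  have hps : ∀ s, (p s)ᵀ = p s := fun s => by simp [p, hM, hPt]
  have hsm : MC 1 (fun s : ℝ => s • P) := MC.smul contDiff_id (MC.const P)
  have hp : MC 1 p := (MC.const M).add hsm
  have hd : ∀ s, dmat p s 1 = P := fun s => by
    simp only [p]
    rw [dmat_add (MC.const M) hsm, dmat_const, zero_add]
    ext i j
    simp only [dmat, Matrix.of_apply, Matrix.smul_apply, smul_eq_mul]
    rw [fderiv_apply_one_eq_deriv]
    simp
  have hder : ∀ s, HasDerivAt (fun s => Th (p s)) (((1 + p s * p s)⁻¹ * P).trace) s := fun s => by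
    obtain ⟨h1, h2⟩ := Th_deriv hp hps s
    have := h1.hasDerivAt
    rwa [← fderiv_apply_one_eq_deriv, h2, hd] at this
  obtain ⟨s, -, hs⟩ := exists_hasDerivAt_eq_zero (a := (0 : ℝ)) (b := 1) zero_lt_one
    (fun s _ => (hder s).continuousAt.continuousWithinAt) (by simp [p, hPdef, hT])
    (fun s _ => hder s)
  obtain ⟨O, d, hO⟩ := exists_dg' (hps s)
  have hg := hO.ginv
  rw [hg.eq, mul_assoc, mul_assoc, Matrix.trace_mul_comm, mul_assoc, mul_assoc] at hs
  have hQ : (Oᵀ * P * O).PosSemidef := by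
    have := hP.conjTranspose_mul_mul_same O
    rwa [conjTranspose_eq_transpose_of_trivial] at this
  have hs2 : ∑ i, (1 + d i ^ 2)⁻¹ * (Oᵀ * P * O) i i = 0 := by
    rw [← hs, Matrix.trace]
    refine Finset.sum_congr rfl fun i _ => ?_
    rw [Matrix.diag_apply, Matrix.diagonal_mul, mul_assoc]
  have hz : ∀ i, (Oᵀ * P * O) i i = 0 := fun i => by
    have := (Finset.sum_eq_zero_iff_of_nonneg (fun i _ => mul_nonneg (inv_pos.mpr (gpos (d i))).le
      hQ.diag_nonneg)).mp hs2 i (Finset.mem_univ i)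
    exact (mul_eq_zero.mp this).resolve_left (inv_pos.mpr (gpos (d i))).ne'
  have htr : P.trace = 0 := by
    have h1 : (Oᵀ * P * O).trace = 0 := by
      rw [Matrix.trace]; exact Finset.sum_eq_zero fun i _ => hz i
    rw [mul_assoc, Matrix.trace_mul_comm, mul_assoc, hO.right, mul_one] at h1
    exact h1
  have := hP.trace_eq_zero_iff.mp htr
  exact sub_eq_zero.mp this

lemma Th_cont {A : Fin n → Fin n → ℝ} (C : ℝ) (S : Set (Fin n → Fin n → ℝ))
    (hS : ∀ B ∈ S, (Matrix.of B)ᵀ = Matrix.of B ∧ Th (Matrix.of B) = C) (hA : A ∈ closure S) :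
    (Matrix.of A)ᵀ = Matrix.of A ∧ Th (Matrix.of A) = C := by
  let σ : (Fin n → Fin n → ℝ) → Mn n := fun B => Matrix.of fun i j => (B i j + B j i) / 2
  have hσ : MC 1 σ := fun i j => by simp only [σ, Matrix.of_apply]; fun_prop
  have hσs : ∀ B, (σ B)ᵀ = σ B := fun B => by
    ext i j; simp [σ, add_comm]
  have hc : Continuous fun B => Th (σ B) :=
    continuous_iff_continuousAt.mpr fun B => (Th_deriv hσ hσs B).1.continuousAt
  have hfix : ∀ B : Fin n → Fin n → ℝ, (Matrix.of B)ᵀ = Matrix.of B → σ B = Matrix.of B := by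
    intro B hB
    ext i j
    have := congrFun (congrFun hB i) j
    simp at this
    simp [σ, this]
  have h1 : closure S ⊆ {B | ∀ i j, B i j = B j i} := by
    refine closure_minimal (fun B hB i j => ?_) ?_
    · have := congrFun (congrFun (hS B hB).1 j) i
      simpa using this
    · simp only [Set.setOf_forall]
      exact isClosed_iInter fun i => isClosed_iInter fun j =>
        isClosed_eq (by fun_prop) (by fun_prop)
  have hAs : (Matrix.of A)ᵀ = Matrix.of A := by
    ext i j; exact h1 hA j i
  have h2 : closure S ⊆ {B | Th (σ B) = C} := by
    refine closure_minimal (fun B hB => ?_) (isClosed_eq hc continuous_const)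
    simp only [Set.mem_setOf_eq]
    rw [hfix B (hS B hB).1]; exact (hS B hB).2
  exact ⟨hAs, by rw [← hfix A hAs]; exact h2 hA⟩

/-! #### Ellipticity of the rotated metric -/

lemma Dg.entry {N O : Mn n} {d : Fin n → ℝ} (h : Dg N O d) (i j : Fin n) :
    N i j = ∑ k, d k * (O i k * O j k) := by
  conv_lhs => rw [h.eq]
  rw [Matrix.mul_apply]
  refine Finset.sum_congr rfl fun k _ => ?_
  rw [Matrix.mul_diagonal, Matrix.transpose_apply]; ring

lemma Dg.O_le {N O : Mn n} {d : Fin n → ℝ} (h : Dg N O d) (i k : Fin n) : |O i k| ≤ 1 := by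
  have h1 : ∑ k, O i k * O i k = 1 := by
    have := congrFun (congrFun h.right i) i
    rw [Matrix.mul_apply] at this
    simpa using this
  have h2 : O i k * O i k ≤ 1 := by
    rw [← h1]
    exact Finset.single_le_sum (f := fun k => O i k * O i k) (fun k _ => mul_self_nonneg _)
      (Finset.mem_univ k)
  rw [abs_le]
  constructor <;> nlinarith

lemma Dg.entry_le {N O : Mn n} {d : Fin n → ℝ} (h : Dg N O d) (K : ℝ) (hK : ∀ i, |d i| ≤ K)
    (i j : Fin n) : |N i j| ≤ n * K := by
  rw [h.entry]
  refine (Finset.abs_sum_le_sum_abs _ _).trans ?_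
  have : ∀ k ∈ Finset.univ, |d k * (O i k * O j k)| ≤ K := fun k _ => by
    rw [abs_mul, abs_mul]
    have h1 := h.O_le i k
    have h2 := h.O_le j k
    have h3 : |O i k| * |O j k| ≤ 1 := by nlinarith [abs_nonneg (O i k), abs_nonneg (O j k)]
    calc |d k| * (|O i k| * |O j k|) ≤ |d k| * 1 := by gcongr
      _ ≤ K := by rw [mul_one]; exact hK k
  refine (Finset.sum_le_card_nsmul _ _ _ this).trans ?_
  simp

lemma Dg.bil_eq {N O : Mn n} {d : Fin n → ℝ} (h : Dg N O d) (p q : Dn n) :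
    bil N p q = ∑ k, d k * (∑ i, O i k * p (EuclideanSpace.single i 1)) *
      (∑ i, O i k * q (EuclideanSpace.single i 1)) := by
  have e : ∀ k, d k * (∑ i, O i k * p (EuclideanSpace.single i 1)) *
      (∑ i, O i k * q (EuclideanSpace.single i 1)) = ∑ i, ∑ j, d k * (O i k * O j k) *
        p (EuclideanSpace.single i 1) * q (EuclideanSpace.single j 1) := fun k => by
    rw [mul_assoc, Finset.sum_mul_sum, Finset.mul_sum]
    refine Finset.sum_congr rfl fun i _ => ?_
    rw [Finset.mul_sum]
    exact Finset.sum_congr rfl fun j _ => by ring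
  simp_rw [e]
  rw [Finset.sum_comm]
  unfold bil
  refine Finset.sum_congr rfl fun i _ => ?_
  rw [Finset.sum_comm]
  refine Finset.sum_congr rfl fun j _ => ?_
  rw [h.entry, Finset.sum_mul, Finset.sum_mul]

lemma one_le_gprod (d : Fin n → ℝ) : 1 ≤ ∏ i, (1 + d i ^ 2) := by
  calc (1 : ℝ) = ∏ i : Fin n, (1 : ℝ) := by simp
    _ ≤ _ := Finset.prod_le_prod (fun i _ => zero_le_one) fun i _ => by nlinarith [sq_nonneg (d i)]

lemma dual_norm_le (p : Dn n) : ‖p‖ ^ 2 ≤ ∑ i, (p (EuclideanSpace.single i 1)) ^ 2 := by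
  set s := ∑ i, (p (EuclideanSpace.single i 1)) ^ 2 with hs
  have hs0 : 0 ≤ s := Finset.sum_nonneg fun i _ => sq_nonneg _
  have h1 : ‖p‖ ≤ Real.sqrt s := by
    refine p.opNorm_le_bound (Real.sqrt_nonneg _) fun x => ?_
    have hx : x = ∑ i, x i • EuclideanSpace.single i (1 : ℝ) := by
      ext j; simp [Pi.single_apply]
    have h2 : p x = ∑ i, p (EuclideanSpace.single i 1) * x i := by
      conv_lhs => rw [hx]
      rw [map_sum]
      exact Finset.sum_congr rfl fun i _ => by rw [map_smul, smul_eq_mul, mul_comm]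
    rw [h2, Real.norm_eq_abs, EuclideanSpace.norm_eq, ← Real.sqrt_mul hs0]
    apply Real.abs_le_sqrt
    simp only [Real.norm_eq_abs, sq_abs]
    exact Finset.sum_mul_sq_le_sq_mul_sq _ _ _
  calc ‖p‖ ^ 2 ≤ (Real.sqrt s) ^ 2 := by gcongr
    _ = s := Real.sq_sqrt hs0

/-- The coefficient field of the Laplace-Beltrami operator. -/
def lbc (N : En n → Mn n) (x : En n) : Mn n :=
  Real.sqrt (1 + N x * N x).det • (1 + N x * N x)⁻¹

lemma lbc_MC {N : En n → Mn n} (hN : MC (⊤ : ℕ∞) N) (hs : ∀ x, (N x)ᵀ = N x) :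
    MC (⊤ : ℕ∞) (lbc N) := by
  unfold lbc
  exact MC.smul (((MC.const 1).add (hN.mul hN)).det.sqrt fun x => (g_det (hs x)).ne')
    (hN.ginv hs)

lemma bil_smul_mat (c : ℝ) (A : Mn n) (p q : Dn n) : bil (c • A) p q = c * bil A p q := by
  unfold bil
  simp_rw [Finset.mul_sum, Matrix.smul_apply, smul_eq_mul]
  exact Finset.sum_congr rfl fun i _ => Finset.sum_congr rfl fun j _ => by ring

lemma lbc_ell {N : En n → Mn n} (hN : MC (⊤ : ℕ∞) N) (K : ℝ)
    (hdg : ∀ y, ∃ O d, Dg (N y) O d ∧ ∀ i, |d i| ≤ K) :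
    ∃ lam Lam, 0 < lam ∧ Ell lam Lam (lbc N) := by
  have hs : ∀ x, (N x)ᵀ = N x := fun x => by
    obtain ⟨O, d, h, -⟩ := hdg x; exact h.symm
  refine ⟨(1 + K ^ 2)⁻¹, n * n * ((1 + K ^ 2) ^ n * n), by positivity, ?_, ?_, ?_⟩
  · intro i j; exact (lbc_MC hN hs i j).continuous
  · intro x p
    obtain ⟨O, d, h, hd⟩ := hdg x
    have hdet : 1 ≤ (1 + N x * N x).det := by
      rw [h.gdet]
      exact one_le_gprod d
    have hW : 1 ≤ Real.sqrt (1 + N x * N x).det := Real.one_le_sqrt.mpr hdet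
    unfold lbc
    rw [bil_smul_mat, h.ginv.bil_eq]
    set v : Fin n → ℝ := fun k => ∑ i, O i k * p (EuclideanSpace.single i 1) with hv
    have hvs : ∑ k, v k ^ 2 = ∑ i, (p (EuclideanSpace.single i 1)) ^ 2 := by
      have := h.one.bil_eq p p
      simp only [one_mul] at this
      have h2 : bil (1 : Mn n) p p = ∑ i, (p (EuclideanSpace.single i 1)) ^ 2 := by
        simp [bil, Matrix.one_apply, sq]
      rw [← h2, this]
      exact Finset.sum_congr rfl fun k _ => sq _
    have h3 : (1 + K ^ 2)⁻¹ * ∑ k, v k ^ 2 ≤ ∑ k, (1 + d k ^ 2)⁻¹ * v k * v k := by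
      rw [Finset.mul_sum]
      refine Finset.sum_le_sum fun k _ => ?_
      rw [mul_assoc, ← sq]
      have : d k ^ 2 ≤ K ^ 2 := sq_le_sq' (by linarith [(abs_le.mp (hd k)).1]) (abs_le.mp (hd k)).2
      gcongr
    have h4 := dual_norm_le p
    have hK : 0 < (1 + K ^ 2)⁻¹ := by positivity
    calc (1 + K ^ 2)⁻¹ * ‖p‖ ^ 2 ≤ (1 + K ^ 2)⁻¹ * ∑ k, v k ^ 2 := by rw [hvs]; gcongr
      _ ≤ ∑ k, (1 + d k ^ 2)⁻¹ * v k * v k := h3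
      _ ≤ _ := le_mul_of_one_le_left (Finset.sum_nonneg fun k _ => by
          rw [mul_assoc]; exact mul_nonneg (inv_pos.mpr (gpos _)).le (mul_self_nonneg _)) hW
  · intro x p q
    obtain ⟨O, d, h, hd⟩ := hdg x
    have hdet : (1 + N x * N x).det ≤ (1 + K ^ 2) ^ n := by
      rw [h.gdet]
      calc ∏ i, (1 + d i ^ 2) ≤ ∏ i : Fin n, (1 + K ^ 2) := by
            refine Finset.prod_le_prod (fun i _ => (gpos _).le) fun i _ => ?_
            have : d i ^ 2 ≤ K ^ 2 := sq_le_sq' (by linarith [(abs_le.mp (hd i)).1]) (abs_le.mp (hd i)).2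
            linarith
        _ = _ := by simp
    have hdet1 : 1 ≤ (1 + N x * N x).det := by
      rw [h.gdet]
      exact one_le_gprod d
    have hW : Real.sqrt (1 + N x * N x).det ≤ (1 + K ^ 2) ^ n :=
      (Real.sqrt_le_left (by linarith) |>.mpr (by nlinarith)).trans hdet
    have hent : ∀ i j, |lbc N x i j| ≤ (1 + K ^ 2) ^ n * n := fun i j => by
      unfold lbc
      rw [Matrix.smul_apply, smul_eq_mul, abs_mul, abs_of_nonneg (Real.sqrt_nonneg _)]
      have := h.ginv.entry_le 1 (fun i => by
        rw [abs_of_pos (inv_pos.mpr (gpos _))]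
        exact inv_le_one_of_one_le₀ (by nlinarith [sq_nonneg (d i)])) i j
      rw [mul_one] at this
      gcongr
    have hei : ∀ (p : Dn n) (i : Fin n), |p (EuclideanSpace.single i 1)| ≤ ‖p‖ := fun p i => by
      have := p.le_opNorm (EuclideanSpace.single i 1)
      simpa using this
    unfold bil
    refine (Finset.abs_sum_le_sum_abs _ _).trans ?_
    have h5 : ∀ i ∈ (Finset.univ : Finset (Fin n)), |∑ j, lbc N x i j * p (EuclideanSpace.single i 1) * q (EuclideanSpace.single j 1)|
        ≤ n * ((1 + K ^ 2) ^ n * n * ‖p‖ * ‖q‖) := fun i _ => by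
      refine (Finset.abs_sum_le_sum_abs _ _).trans ?_
      have h6 : ∀ j ∈ (Finset.univ : Finset (Fin n)), |lbc N x i j * p (EuclideanSpace.single i 1) * q (EuclideanSpace.single j 1)|
        ≤ (1 + K ^ 2) ^ n * n * ‖p‖ * ‖q‖ := fun j _ => by
        rw [abs_mul, abs_mul]
        have := hent i j
        have := hei p i
        have := hei q j
        gcongr
      refine (Finset.sum_le_card_nsmul _ _ _ h6).trans ?_
      simp
    refine (Finset.sum_le_card_nsmul _ _ _ h5).trans (le_of_eq ?_)
    simp
    ring

/-- Integration by parts for the divergence form operator. -/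
lemma weak_form {B : En n → Mn n} (hB : MC 1 B) {f : En n → ℝ} (hf : ContDiff ℝ 2 f)
    {φ : En n → ℝ} (hφ : ContDiff ℝ 1 φ) (hφc : HasCompactSupport φ) :
    ∫ x, bil (B x) (fderiv ℝ f x) (fderiv ℝ φ x) =
      - ∫ x, φ x * ∑ i, ∑ j, pdrv n j (fun y => B y i j * pdrv n i f y) x := by
  have hfd : ∀ i, ContDiff ℝ 1 (fun y => pdrv n i f y) := fun i =>
    (hf.fderiv_right (m := 1) (by norm_num)).clm_apply contDiff_const
  have hh : ∀ i j, ContDiff ℝ 1 (fun y => B y i j * pdrv n i f y) := fun i j => (hB i j).mul (hfd i)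
  have hφd : ∀ j, Continuous fun x => fderiv ℝ φ x (EuclideanSpace.single j 1) := fun j =>
    (fderiv_cont hφ).clm_apply continuous_const
  have hφdc : ∀ j : Fin n, HasCompactSupport fun x => fderiv ℝ φ x (EuclideanSpace.single j 1) :=
    fun j => hφc.fderiv_apply ℝ _
  have hhd : ∀ i j, Continuous fun x => pdrv n j (fun y => B y i j * pdrv n i f y) x := fun i j =>
    (fderiv_cont (hh i j)).clm_apply continuous_const
  have i1 : ∀ i j, Integrable fun x => (B x i j * pdrv n i f x) * fderiv ℝ φ x (EuclideanSpace.single j 1) :=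
    fun i j => int_cs ((hh i j).continuous.mul (hφd j)) (hφdc j).mul_left
  have i2 : ∀ i j, Integrable fun x => pdrv n j (fun y => B y i j * pdrv n i f y) x * φ x :=
    fun i j => int_cs ((hhd i j).mul hφ.continuous) hφc.mul_left
  have i3 : ∀ i j, Integrable fun x => (B x i j * pdrv n i f x) * φ x :=
    fun i j => int_cs ((hh i j).continuous.mul hφ.continuous) hφc.mul_left
  have e : ∀ i j, ∫ x, (B x i j * pdrv n i f x) * fderiv ℝ φ x (EuclideanSpace.single j 1) =
      - ∫ x, pdrv n j (fun y => B y i j * pdrv n i f y) x * φ x := fun i j =>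
    integral_mul_fderiv_eq_neg_fderiv_mul_of_integrable (i2 i j) (i1 i j) (i3 i j)
      (fun x _ => diff_of_C1 (hh i j) x) (fun x _ => diff_of_C1 hφ x)
  unfold bil
  change ∫ x, ∑ i, ∑ j, (B x i j * pdrv n i f x) * fderiv ℝ φ x (EuclideanSpace.single j 1) = _
  rw [integral_finset_sum _ fun i _ => integrable_finset_sum _ fun j _ => i1 i j]
  simp_rw [Finset.mul_sum]
  have i2' : ∀ i j, Integrable fun x => φ x * pdrv n j (fun y => B y i j * pdrv n i f y) x :=
    fun i j => by simpa only [mul_comm] using i2 i j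
  rw [integral_finset_sum _ fun i _ => integrable_finset_sum _ fun j _ => i2' i j,
    ← Finset.sum_neg_distrib]
  refine Finset.sum_congr rfl fun i _ => ?_
  rw [integral_finset_sum _ fun j _ => i1 i j, integral_finset_sum _ fun j _ => i2' i j,
    ← Finset.sum_neg_distrib]
  refine Finset.sum_congr rfl fun j _ => ?_
  rw [e]
  simp only [mul_comm]
end
end

section
set_option linter.all false
section
variable {n : ℕ}

/-- The standard basis vector. -/
abbrev bv (i : Fin n) : En n := EuclideanSpace.single i 1

lemma two_le_top : (2 : WithTop ℕ∞) ≤ ((⊤ : ℕ∞) : WithTop ℕ∞) := by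
  have : ((2 : ℕ∞) : WithTop ℕ∞) ≤ ((⊤ : ℕ∞) : WithTop ℕ∞) := WithTop.coe_le_coe.mpr le_top
  simpa using this

lemma one_one_le_top : (1 + 1 : WithTop ℕ∞) ≤ ((⊤ : ℕ∞) : WithTop ℕ∞) := by
  rw [one_add_one_eq_two]; exact two_le_top

lemma fd_comm {f : En n → ℝ} (hf : ContDiff ℝ (⊤ : ℕ∞) f) (x v w : En n) :
    fderiv ℝ (fun y => fderiv ℝ f y v) x w = fderiv ℝ (fun y => fderiv ℝ f y w) x v := by
  have hd : DifferentiableAt ℝ (fderiv ℝ f) x :=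
    (hf.fderiv_right (m := 1) one_one_le_top).differentiable one_ne_zero x
  have e : ∀ v w, fderiv ℝ (fun y => fderiv ℝ f y v) x w = fderiv ℝ (fderiv ℝ f) x w v := by
    intro v w
    rw [fderiv_clm_apply hd (differentiableAt_const v)]
    simp
  rw [e, e]
  have := (hf.contDiffAt (x := x)).isSymmSndFDerivAt (n := (⊤ : ℕ∞)) (by simpa using two_le_top)
  exact this.eq w v

lemma tsum_mat (D : Fin n → Mn n) (hD : ∀ k i j, D k i j = D j i k) (hs : ∀ k, (D k)ᵀ = D k)
    (P Q : Mn n) (i : Fin n) :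
    ∑ j, (P * D j * Q) i j = ∑ a, P i a * (Q * D a).trace := by
  have hsw : ∀ a b j, D a j b = D j a b := fun a b j => by
    rw [hD a j b, ← congrFun (congrFun (hs b) j) a, Matrix.transpose_apply, hD b a j]
  have h1 : ∀ j, (P * D j * Q) i j = ∑ a, P i a * ∑ b, D j a b * Q b j := fun j => by
    rw [mul_assoc, Matrix.mul_apply]
    exact Finset.sum_congr rfl fun a _ => by rw [Matrix.mul_apply]
  simp_rw [h1]
  rw [Finset.sum_comm]
  refine Finset.sum_congr rfl fun a _ => ?_
  rw [← Finset.mul_sum]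
  congr 1
  rw [Finset.sum_comm, Matrix.trace]
  refine Finset.sum_congr rfl fun b _ => ?_
  rw [Matrix.diag_apply, Matrix.mul_apply]
  exact Finset.sum_congr rfl fun j _ => by rw [hsw, mul_comm]

lemma dmat_smul {E : Type*} [NormedAddCommGroup E] [NormedSpace ℝ E] {A : E → Mn n} (hA : MC 1 A)
    {c : E → ℝ} (hc : ContDiff ℝ 1 c) (x v : E) :
    dmat (fun x => c x • A x) x v = fderiv ℝ c x v • A x + c x • dmat A x v := by
  ext i j
  simp only [dmat, Matrix.of_apply, Matrix.smul_apply, Matrix.add_apply, smul_eq_mul]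
  have := (((hc.differentiable one_ne_zero) x).hasFDerivAt.mul (hA.diff i j x).hasFDerivAt).fderiv
  refine (congrArg (fun L => L v) this).trans ?_
  simp only [_root_.add_apply, _root_.smul_apply, smul_eq_mul]
  ring

lemma g_comm {N : Mn n} (hs : Nᵀ = N) : N * (1 + N * N)⁻¹ = (1 + N * N)⁻¹ * N := by
  have hu : IsUnit (1 + N * N).det := isUnit_iff_ne_zero.mpr (g_det hs).ne'
  have : (1 + N * N) * N = N * (1 + N * N) := by noncomm_ring
  calc N * (1 + N * N)⁻¹ = (1 + N * N)⁻¹ * ((1 + N * N) * N) * (1 + N * N)⁻¹ := by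
        rw [← mul_assoc, Matrix.nonsing_inv_mul _ hu, one_mul]
    _ = _ := by rw [this, mul_assoc, mul_assoc, Matrix.mul_nonsing_inv _ hu, mul_one]

variable {N : En n → Mn n}

lemma dmat_g (hN : MC (⊤ : ℕ∞) N) (y v : En n) :
    dmat (fun x => 1 + N x * N x) y v = dmat N y v * N y + N y * dmat N y v := by
  rw [dmat_add (MC.const 1) (hN.one.mul hN.one), dmat_const, zero_add, dmat_mul hN.one hN.one]

lemma dmat_lbc (hN : MC (⊤ : ℕ∞) N) (hs : ∀ x, (N x)ᵀ = N x) (y v : En n) :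
    dmat (lbc N) y v = Real.sqrt (1 + N y * N y).det •
      (((N y * (1 + N y * N y)⁻¹) * dmat N y v).trace • (1 + N y * N y)⁻¹ -
        (1 + N y * N y)⁻¹ * dmat N y v * (N y * (1 + N y * N y)⁻¹) -
        ((1 + N y * N y)⁻¹ * N y) * dmat N y v * (1 + N y * N y)⁻¹) := by
  have hg : MC 1 (fun x => 1 + N x * N x) := (MC.const 1).add (hN.one.mul hN.one)
  have hd : ∀ x, (1 + N x * N x).det ≠ 0 := fun x => (g_det (hs x)).ne'
  have hW : ContDiff ℝ 1 (fun x => Real.sqrt (1 + N x * N x).det) := hg.det.sqrt hd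
  have h1 : fderiv ℝ (fun x => Real.sqrt (1 + N x * N x).det) y v =
      Real.sqrt (1 + N y * N y).det * ((N y * (1 + N y * N y)⁻¹) * dmat N y v).trace := by
    have h2 := ((hg.det.differentiable one_ne_zero y).hasFDerivAt.sqrt (hd y)).fderiv
    rw [h2, _root_.smul_apply, dmat_det hg hd, dmat_g hN, smul_eq_mul, mul_add, Matrix.trace_add]
    have h3 : ((1 + N y * N y)⁻¹ * (dmat N y v * N y)).trace =
        ((N y * (1 + N y * N y)⁻¹) * dmat N y v).trace := by
      rw [← mul_assoc, Matrix.trace_mul_comm, mul_assoc]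
    have h4 : ((1 + N y * N y)⁻¹ * (N y * dmat N y v)).trace =
        ((N y * (1 + N y * N y)⁻¹) * dmat N y v).trace := by
      rw [← mul_assoc, g_comm (hs y)]
    rw [h3, h4]
    have hp := g_det (hs y)
    have := Real.sq_sqrt hp.le
    have h0 := (Real.sqrt_pos.mpr hp).ne'
    field_simp
    rw [this]; ring
  unfold lbc
  rw [dmat_smul (hN.one.ginv hs) hW, h1, dmat_inv hg hd, dmat_g hN, smul_sub, smul_sub, smul_smul,
    smul_neg, sub_sub, ← smul_add, sub_eq_add_neg]
  congr 3
  noncomm_ring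

lemma div_lbc (hN : MC (⊤ : ℕ∞) N) (hs : ∀ x, (N x)ᵀ = N x)
    (htot : ∀ y i j k, dmat N y (bv k) i j = dmat N y (bv j) i k)
    (htr : ∀ y v, ((1 + N y * N y)⁻¹ * dmat N y v).trace = 0) (y : En n) (i : Fin n) :
    ∑ j, dmat (lbc N) y (bv j) i j = 0 := by
  have hsd : ∀ k, (dmat N y (bv k))ᵀ = dmat N y (bv k) := fun k => by
    ext a b
    simp only [dmat, Matrix.transpose_apply, Matrix.of_apply]
    congr 2
    ext x
    exact congrFun (congrFun (hs x) a) b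
  simp_rw [dmat_lbc hN hs, Matrix.smul_apply, smul_eq_mul]
  rw [← Finset.mul_sum]
  simp_rw [Matrix.sub_apply]
  rw [Finset.sum_sub_distrib, Finset.sum_sub_distrib,
    tsum_mat (fun j => dmat N y (bv j)) (fun k a b => htot y a b k) hsd,
    tsum_mat (fun j => dmat N y (bv j)) (fun k a b => htot y a b k) hsd]
  simp only [htr, mul_zero, Finset.sum_const_zero, sub_zero]
  rw [mul_eq_zero]; right
  rw [sub_eq_zero]
  exact Finset.sum_congr rfl fun a _ => by rw [Matrix.smul_apply, smul_eq_mul, mul_comm]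

/-- the directional second derivative of the potential -/
def fe (N : En n → Mn n) (e : Fin n → ℝ) (y : En n) : ℝ := ∑ a, ∑ b, e a * e b * N y a b

lemma fe_smooth (hN : MC (⊤ : ℕ∞) N) (e : Fin n → ℝ) : ContDiff ℝ (⊤ : ℕ∞) (fe N e) := by
  unfold fe
  exact ContDiff.sum fun a _ => ContDiff.sum fun b _ => contDiff_const.mul (hN a b)

lemma dmat_vec (hN : MC 1 N) (e : Fin n → ℝ) (y : En n) (i j : Fin n) :
    dmat N y (WithLp.toLp 2 e) i j = ∑ k, e k * dmat N y (bv k) i j := by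
  have hx : (WithLp.toLp 2 e : En n) = ∑ i, e i • bv i := by
    ext j; simp [Pi.single_apply]
  simp only [dmat, Matrix.of_apply]
  rw [hx, map_sum]
  simp

lemma fe_d1 (hN : MC (⊤ : ℕ∞) N) (hs : ∀ x, (N x)ᵀ = N x)
    (htot : ∀ y i j k, dmat N y (bv k) i j = dmat N y (bv j) i k) (e : Fin n → ℝ) (y : En n)
    (i : Fin n) :
    pdrv n i (fe N e) y = ∑ a, e a * dmat N y (WithLp.toLp 2 e) i a := by
  have h : HasFDerivAt (fe N e) (∑ a, ∑ b, (e a * e b) • fderiv ℝ (fun y => N y a b) y) y :=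
    HasFDerivAt.fun_sum fun a _ => HasFDerivAt.fun_sum fun b _ =>
      (hN.one.diff a b y).hasFDerivAt.const_mul _
  unfold pdrv
  rw [h.fderiv]
  simp only [ContinuousLinearMap.sum_apply, _root_.smul_apply, smul_eq_mul]
  refine Finset.sum_congr rfl fun a _ => ?_
  rw [dmat_vec hN.one, Finset.mul_sum]
  refine Finset.sum_congr rfl fun b _ => ?_
  have h1 := htot y a b i
  have h2 : dmat N y (bv b) a i = dmat N y (bv b) i a := by
    simp only [dmat, Matrix.of_apply]
    congr 2
    ext x
    exact congrFun (congrFun (hs x) i) a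
  rw [← h2, ← h1, mul_assoc]
  rfl

lemma fe_d2 (hN : MC (⊤ : ℕ∞) N) (hs : ∀ x, (N x)ᵀ = N x)
    (htot : ∀ y i j k, dmat N y (bv k) i j = dmat N y (bv j) i k) (e : Fin n → ℝ) (y : En n)
    (i j : Fin n) :
    pdrv n j (fun y => pdrv n i (fe N e) y) y =
      dmat (fun y => dmat N y (WithLp.toLp 2 e)) y (WithLp.toLp 2 e) i j := by
  set E : En n := WithLp.toLp 2 e with hE
  have h0 : (fun y => pdrv n i (fe N e) y) = fun y => ∑ a, e a * dmat N y E i a :=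
    funext fun y => fe_d1 hN hs htot e y i
  rw [h0]
  have hD := (hN.dmat E).one
  have h : HasFDerivAt (fun y => ∑ a, e a * dmat N y E i a)
      (∑ a, e a • fderiv ℝ (fun y => dmat N y E i a) y) y :=
    HasFDerivAt.fun_sum fun a _ => (hD.diff i a y).hasFDerivAt.const_mul _
  unfold pdrv
  rw [h.fderiv]
  simp only [ContinuousLinearMap.sum_apply, _root_.smul_apply, smul_eq_mul]
  have h3 : ∀ a, fderiv ℝ (fun y => dmat N y E i a) y (bv j) =
      fderiv ℝ (fun y => dmat N y (bv a) i j) y E := fun a => by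
    have : (fun y => dmat N y (bv a) i j) = fun y => dmat N y (bv j) i a :=
      funext fun y => htot y i j a
    rw [this]
    simp only [dmat, Matrix.of_apply]
    exact fd_comm (hN i a) y E (bv j)
  have h4 : ∀ a, fderiv ℝ (fun y => dmat N y (bv a) i j) y E =
      fderiv ℝ (fun y => dmat N y E i j) y (bv a) := fun a => by
    simp only [dmat, Matrix.of_apply]
    exact fd_comm (hN i j) y (bv a) E
  simp_rw [h3, h4]
  rw [dmat_vec hD]
  rfl

lemma fe_op (hn : 2 ≤ n) (hN : MC (⊤ : ℕ∞) N)
    (hdg : ∀ y, ∃ O d, Dg (N y) O d ∧ ((n : ℝ) - 2) * (π / 2) ≤ ∑ i, Real.arctan (d i))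
    (htot : ∀ y i j k, dmat N y (bv k) i j = dmat N y (bv j) i k)
    (htr : ∀ y v, ((1 + N y * N y)⁻¹ * dmat N y v).trace = 0) (e : Fin n → ℝ) (y : En n) :
    0 ≤ ∑ i, ∑ j, pdrv n j (fun y => lbc N y i j * pdrv n i (fe N e) y) y := by
  have hs : ∀ x, (N x)ᵀ = N x := fun x => by
    obtain ⟨O, d, h, -⟩ := hdg x; exact h.symm
  set E : En n := WithLp.toLp 2 e with hE
  have hL := (lbc_MC hN hs).one
  have hf1 : ∀ i, ContDiff ℝ 1 (fun y => pdrv n i (fe N e) y) := fun i =>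
    ((fe_smooth hN e).fderiv_right (m := 1) one_one_le_top).clm_apply contDiff_const
  have h1 : ∀ i j, pdrv n j (fun y => lbc N y i j * pdrv n i (fe N e) y) y =
      dmat (lbc N) y (bv j) i j * pdrv n i (fe N e) y +
        lbc N y i j * dmat (fun y => dmat N y E) y E i j := fun i j => by
    rw [← fe_d2 hN hs htot e y i j]
    have := ((hL.diff i j y).hasFDerivAt.mul (diff_of_C1 (hf1 i) y).hasFDerivAt).fderiv
    refine (congrArg (fun L => L (bv j)) this).trans ?_
    simp only [_root_.add_apply, _root_.smul_apply, smul_eq_mul, dmat, Matrix.of_apply]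
    simp only [pdrv]
    ring
  simp_rw [h1, Finset.sum_add_distrib, ← Finset.sum_mul, div_lbc hN hs htot htr, zero_mul,
    Finset.sum_const_zero, zero_add]
  set X := dmat N y E with hX
  set Y := dmat (fun y => dmat N y E) y E with hY
  have hYs : Yᵀ = Y := by
    ext a b
    simp only [hY, dmat, Matrix.transpose_apply, Matrix.of_apply]
    have : ∀ x, N x b a = N x a b := fun x => congrFun (congrFun (hs x) a) b
    simp_rw [this]
  have hXs : Xᵀ = X := by
    ext a b
    simp only [hX, dmat, Matrix.transpose_apply, Matrix.of_apply]
    have : ∀ x, N x b a = N x a b := fun x => congrFun (congrFun (hs x) a) b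
    simp_rw [this]
  have h2 : ∑ i, ∑ j, lbc N y i j * Y i j =
      Real.sqrt (1 + N y * N y).det * ((1 + N y * N y)⁻¹ * Y).trace := by
    rw [Matrix.trace, Finset.mul_sum]
    refine Finset.sum_congr rfl fun i _ => ?_
    rw [Matrix.diag_apply, Matrix.mul_apply, Finset.mul_sum]
    refine Finset.sum_congr rfl fun j _ => ?_
    rw [← congrFun (congrFun hYs i) j, Matrix.transpose_apply]
    simp only [lbc, Matrix.smul_apply, smul_eq_mul]
    ring
  rw [h2]
  refine mul_nonneg (Real.sqrt_nonneg _) ?_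
  -- differentiate the trace identity
  have hg : MC 1 (fun x => 1 + N x * N x) := (MC.const 1).add (hN.one.mul hN.one)
  have hd : ∀ x, (1 + N x * N x).det ≠ 0 := fun x => (g_det (hs x)).ne'
  have h3 := dmat_trace ((hN.one.ginv hs).mul (hN.dmat E).one) y E
  have h4 : (fun x => ((1 + N x * N x)⁻¹ * dmat N x E).trace) = fun _ => 0 := funext fun x => htr x E
  rw [h4, dmat_mul (hN.one.ginv hs) (hN.dmat E).one, dmat_inv hg hd, dmat_g hN, Matrix.trace_add,
    ← hX, ← hY] at h3
  simp only [fderiv_fun_const, Pi.zero_apply, _root_.zero_apply, neg_mul, Matrix.trace_neg] at h3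
  obtain ⟨O, d, h, hth⟩ := hdg y
  have := alg_ineq hn h X hXs hth (htr y E)
  linarith

lemma fe_sub (hn : 2 ≤ n) (hN : MC (⊤ : ℕ∞) N)
    (hdg : ∀ y, ∃ O d, Dg (N y) O d ∧ ((n : ℝ) - 2) * (π / 2) ≤ ∑ i, Real.arctan (d i))
    (htot : ∀ y i j k, dmat N y (bv k) i j = dmat N y (bv j) i k)
    (htr : ∀ y v, ((1 + N y * N y)⁻¹ * dmat N y v).trace = 0) (e : Fin n → ℝ) :
    IsSub (lbc N) (fe N e) := by
  have hs : ∀ x, (N x)ᵀ = N x := fun x => by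
    obtain ⟨O, d, h, -⟩ := hdg x; exact h.symm
  intro φ hφ hφc hφ0
  rw [weak_form (lbc_MC hN hs).one ((fe_smooth hN e).of_le two_le_top) hφ hφc]
  rw [neg_nonpos]
  exact integral_nonneg fun x => mul_nonneg (hφ0 x) (fe_op hn hN hdg htot htr e x)

/-- Bernstein theorem for the special Lagrangian equation with bounded Hessian. -/
theorem const_phase (hn : 2 ≤ n) (hN : MC (⊤ : ℕ∞) N) (K Θ : ℝ) (hΘ : ((n : ℝ) - 2) * (π / 2) ≤ Θ)
    (hdg : ∀ y, ∃ O d, Dg (N y) O d ∧ (∀ i, |d i| ≤ K) ∧ ∑ i, Real.arctan (d i) = Θ)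
    (htot : ∀ y i j k, dmat N y (bv k) i j = dmat N y (bv j) i k) :
    ∃ A, ∀ y, N y = A := by
  have hs : ∀ x, (N x)ᵀ = N x := fun x => by
    obtain ⟨O, d, h, -⟩ := hdg x; exact h.symm
  have hTh : ∀ y, Th (N y) = Θ := fun y => by
    obtain ⟨O, d, h, -, h2⟩ := hdg y; rw [Th_dg h, h2]
  have htr : ∀ y v, ((1 + N y * N y)⁻¹ * dmat N y v).trace = 0 := fun y v => by
    rw [← (Th_deriv hN.one hs y).2 v]
    simp [hTh]
  have hdg1 : ∀ y, ∃ O d, Dg (N y) O d ∧ ((n : ℝ) - 2) * (π / 2) ≤ ∑ i, Real.arctan (d i) := fun y => by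
    obtain ⟨O, d, h, -, h2⟩ := hdg y; exact ⟨O, d, h, by rw [h2]; exact hΘ⟩
  obtain ⟨lam, Lam, hlam, hell⟩ := lbc_ell hN K fun y => by
    obtain ⟨O, d, h, h1, -⟩ := hdg y; exact ⟨O, d, h, h1⟩
  have hent : ∀ y i j, |N y i j| ≤ n * K := fun y i j => by
    obtain ⟨O, d, h, h1, -⟩ := hdg y; exact h.entry_le K h1 i j
  have hsub := fe_sub hn hN hdg1 htot htr
  have hbd : ∀ e, BddAbove (Set.range (fe N e)) := fun e => by
    refine ⟨∑ a, ∑ b, |e a * e b| * (n * K), ?_⟩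
    rintro _ ⟨y, rfl⟩
    refine Finset.sum_le_sum fun a _ => Finset.sum_le_sum fun b _ => ?_
    refine (le_abs_self _).trans ?_
    rw [abs_mul]
    exact mul_le_mul_of_nonneg_left (hent y a b) (abs_nonneg _)
  let M : (Fin n → ℝ) → ℝ := fun e => ⨆ y, fe N e y
  have hM : ∀ e y, fe N e y ≤ M e := fun e y => le_ciSup (hbd e) y
  have hM' : ∀ e, ∀ ε > 0, ∃ y, M e - ε < fe N e y := fun e ε hε =>
    exists_lt_of_lt_ciSup (by simp only [M]; linarith)
  let S : Set (Fin n → Fin n → ℝ) := Set.range fun y i j => N y i j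
  have hSc : IsCompact (closure S) := by
    refine Metric.isCompact_of_isClosed_isBounded isClosed_closure (Bornology.IsBounded.closure ?_)
    refine (Metric.isBounded_closedBall (x := (0 : Fin n → Fin n → ℝ)) (r := |n * K|)).subset ?_
    rintro _ ⟨y, rfl⟩
    rw [mem_closedBall_zero_iff, pi_norm_le_iff_of_nonneg (abs_nonneg _)]
    intro i
    rw [pi_norm_le_iff_of_nonneg (abs_nonneg _)]
    intro j
    exact (hent y i j).trans (le_abs_self _)
  let F : (Fin n → ℝ) × Set.Ioi (0 : ℝ) → Set (Fin n → Fin n → ℝ) := fun p =>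
    {A | M p.1 - p.2 ≤ ∑ a, ∑ b, p.1 a * p.1 b * A a b}
  have hF : ∀ p, IsClosed (F p) := fun p => isClosed_le continuous_const (by fun_prop)
  obtain ⟨A, hA, hAF⟩ := hSc.inter_iInter_nonempty F hF fun T => by
    classical
    -- choose the minimal slack
    obtain ⟨ε, hε, hεT⟩ : ∃ ε > 0, ∀ p ∈ T, ε ≤ (p.2 : ℝ) := by
      rcases T.eq_empty_or_nonempty with rfl | hT
      · exact ⟨1, one_pos, by simp⟩
      · obtain ⟨p, hp, hmin⟩ := T.exists_min_image (fun p => (p.2 : ℝ)) hT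
        exact ⟨p.2, p.2.2, hmin⟩
    obtain ⟨y, hy⟩ := simul n hn hlam hell T (fun p => fe N p.1)
      (fun p _ => (fe_smooth hN p.1).of_le (by exact_mod_cast le_top)) (fun p _ => hsub p.1) (fun p => M p.1)
      (fun p _ => hM p.1) (fun p _ => hM' p.1) ε hε
    refine ⟨fun i j => N y i j, subset_closure ⟨y, rfl⟩, ?_⟩
    simp only [Set.mem_iInter]
    intro p hp
    have h1 := hy p hp
    have h2 := hεT p hp
    show M p.1 - p.2 ≤ fe N p.1 y
    linarith
  obtain ⟨hAs, hAT⟩ := Th_cont Θ S (by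
    rintro _ ⟨y, rfl⟩
    exact ⟨hs y, hTh y⟩) hA
  have hAM : ∀ e, M e ≤ ∑ a, ∑ b, e a * e b * A a b := fun e => by
    refine le_of_forall_pos_le_add fun ε hε => ?_
    have := Set.mem_iInter.mp hAF (e, ⟨ε, hε⟩)
    have h2 : M e - ε ≤ ∑ a, ∑ b, e a * e b * A a b := this
    linarith
  refine ⟨Matrix.of A, fun y => ?_⟩
  refine (Th_strict (hs y) hAs ?_ (by rw [hAT, hTh])).symm
  refine Matrix.PosSemidef.of_dotProduct_mulVec_nonneg ?_ fun e => ?_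
  · rw [Matrix.IsHermitian, conjTranspose_eq_transpose_of_trivial, Matrix.transpose_sub, hAs, hs]
  · have h1 := (hM e y).trans (hAM e)
    have h2 : star e ⬝ᵥ (Matrix.of A - N y) *ᵥ e =
        ∑ a, ∑ b, e a * e b * A a b - fe N e y := by
      unfold fe
      simp only [dotProduct, mulVec, Pi.star_apply, star_trivial, Matrix.sub_apply, Matrix.of_apply,
        Finset.mul_sum, ← Finset.sum_sub_distrib]
      exact Finset.sum_congr rfl fun a _ => Finset.sum_congr rfl fun b _ => by ring
    rw [h2]; linarith
end
end

section
set_option linter.all false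
section
variable {n : ℕ}

/-- The linear map of a matrix. -/
abbrev Lm (P : Mn n) : En n →L[ℝ] En n := Matrix.toEuclideanCLM (𝕜 := ℝ) (n := Fin n) P

lemma Lm_apply (P : Mn n) (v : En n) (i : Fin n) : (Lm P v) i = ∑ j, P i j * v j := rfl

lemma Lm_det (P : Mn n) : (Lm P).det = P.det := by
  rw [ContinuousLinearMap.det, Matrix.coe_toEuclideanCLM_eq_toEuclideanLin,
    Matrix.toEuclideanLin_eq_toLin_orthonormal, LinearMap.det_toLin]

lemma Lm_bv (P : Mn n) (i j : Fin n) : (Lm P (bv j)) i = P i j := by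
  rw [Lm_apply]; simp [Pi.single_apply]

lemma fderiv_coord {f : En n → En n} {x : En n} (hf : DifferentiableAt ℝ f x) (v : En n)
    (i : Fin n) : (fderiv ℝ f x v) i = fderiv ℝ (fun y => f y i) x v := by
  have := ((EuclideanSpace.proj (𝕜 := ℝ) i).hasFDerivAt.comp x hf.hasFDerivAt).fderiv
  exact (congrArg (fun L => L v) this).symm

lemma vec_sum (v : En n) : v = ∑ i, v i • bv i := by
  ext j; simp [Pi.single_apply]

lemma clm_sum (p : Dn n) (v : En n) : p v = ∑ i, p (bv i) * v i := by
  conv_lhs => rw [vec_sum v]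
  rw [map_sum]
  exact Finset.sum_congr rfl fun i _ => by rw [map_smul, smul_eq_mul, mul_comm]

lemma Dg.inner_ge {P O : Mn n} {d : Fin n → ℝ} (h : Dg P O d) (m : ℝ) (hm : ∀ i, m ≤ d i)
    (w : En n) : m * ‖w‖ ^ 2 ≤ inner ℝ w (Lm P w) := by
  let p : Dn n := innerSL ℝ w
  have hp : ∀ i, p (bv i) = w i := fun i => by
    simp [p, innerSL_apply_apply, EuclideanSpace.inner_single_right]
  have h1 : inner ℝ w (Lm P w) = bil P p p := by
    rw [Matrix.inner_toEuclideanCLM]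
    unfold bil
    simp only [dotProduct, mulVec, Finset.mul_sum]
    refine Finset.sum_congr rfl fun i _ => Finset.sum_congr rfl fun j _ => ?_
    have := hp i
    have := hp j
    simp only [bv] at *
    rw [hp i, hp j]; ring
  have h2 : ‖w‖ ^ 2 = bil 1 p p := by
    rw [EuclideanSpace.norm_sq_eq]
    unfold bil
    simp only [Matrix.one_apply, ite_mul, one_mul, zero_mul, Finset.sum_ite_eq, Finset.mem_univ, if_true]
    refine Finset.sum_congr rfl fun i _ => ?_
    have := hp i
    simp only [bv] at this
    rw [this, Real.norm_eq_abs, sq_abs, sq]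
  rw [h1, h2, h.bil_eq, h.one.bil_eq, Finset.mul_sum]
  refine Finset.sum_le_sum fun k _ => ?_
  rw [one_mul, mul_assoc]
  exact mul_le_mul_of_nonneg_right (hm k) (mul_self_nonneg _)

/-- A global inverse function theorem for strongly monotone smooth maps. -/
lemma diffeo {Φ : En n → En n} (hΦ : ContDiff ℝ (⊤ : ℕ∞) Φ) {P : En n → Mn n}
    (hP : ∀ x, HasFDerivAt Φ (Lm (P x)) x) (m : ℝ) (hm : 0 < m)
    (hmono : ∀ x w, m * ‖w‖ ^ 2 ≤ inner ℝ w (Lm (P x) w)) :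
    ∃ h : En n ≃ₜ En n, (∀ x, h x = Φ x) ∧ ContDiff ℝ (⊤ : ℕ∞) h.symm := by
  have hinj : ∀ x, Function.Injective (Lm (P x) : En n →ₗ[ℝ] En n) := fun x => by
    rw [injective_iff_map_eq_zero]
    intro w hw
    have h1 := hmono x w
    have hw' : Lm (P x) w = 0 := hw
    rw [hw', inner_zero_right] at h1
    have : ‖w‖ ^ 2 ≤ 0 := by
      by_contra hh
      push Not at hh
      have := mul_pos hm hh
      linarith
    have := pow_eq_zero_iff (two_ne_zero) |>.mp (le_antisymm this (sq_nonneg _))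
    exact norm_eq_zero.mp this
  let e : En n → (En n ≃L[ℝ] En n) := fun x =>
    (LinearEquiv.ofInjectiveEndo _ (hinj x)).toContinuousLinearEquiv
  have he : ∀ x, (e x : En n →L[ℝ] En n) = Lm (P x) := fun x => by
    ext1 v
    rfl
  have hstr : ∀ x, HasStrictFDerivAt Φ (e x : En n →L[ℝ] En n) x := fun x => by
    rw [he, ← (hP x).fderiv]
    exact (hΦ.contDiffAt).hasStrictFDerivAt (by simp)
  have hopen := isOpenMap_of_hasStrictFDerivAt_equiv hstr
  have hexp : ∀ x y, m * dist x y ≤ dist (Φ x) (Φ y) := fun x y => by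
    set w := x - y with hw
    have hl : ∀ t : ℝ, HasDerivAt (fun t : ℝ => y + t • w) w t := fun t => by
      simpa using ((hasDerivAt_id t).smul_const w).const_add y
    have hd : ∀ t : ℝ, HasDerivAt (fun t : ℝ => inner ℝ w (Φ (y + t • w)))
        (inner ℝ w (Lm (P (y + t • w)) w)) t := fun t => by
      have h1 := (hP (y + t • w)).comp_hasDerivAt t (hl t)
      exact ((innerSL ℝ w).hasFDerivAt.comp_hasDerivAt t h1)
    obtain ⟨t, -, ht⟩ := exists_hasDerivAt_eq_slope (fun t : ℝ => inner ℝ w (Φ (y + t • w)))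
      (fun t => inner ℝ w (Lm (P (y + t • w)) w)) (zero_lt_one)
      (fun t _ => (hd t).continuousAt.continuousWithinAt) (fun t _ => hd t)
    have h2 := hmono (y + t • w) w
    rw [ht] at h2
    simp only [one_smul, zero_smul, add_zero, sub_zero, div_one] at h2
    rw [← inner_sub_right, show y + w = x by simp [hw]] at h2
    have h3 := real_inner_le_norm w (Φ x - Φ y)
    rw [dist_eq_norm, dist_eq_norm, ← hw]
    rcases (norm_nonneg w).eq_or_lt with h0 | h0
    · rw [← h0, mul_zero]; exact norm_nonneg _
    · have : ‖w‖ * (m * ‖w‖) ≤ ‖w‖ * ‖Φ x - Φ y‖ := by nlinarith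
      exact le_of_mul_le_mul_left this h0
  have hanti : AntilipschitzWith (Real.toNNReal m⁻¹) Φ := AntilipschitzWith.of_le_mul_dist fun x y => by
    rw [Real.coe_toNNReal _ (inv_pos.mpr hm).le, inv_mul_eq_div, le_div_iff₀ hm, mul_comm]
    exact hexp x y
  have hprop : IsProperMap Φ := by
    rw [isProperMap_iff_tendsto_cocompact]
    refine ⟨hΦ.continuous, ?_⟩
    rw [← Metric.cobounded_eq_cocompact]
    exact hanti.tendsto_cobounded
  have hrange : Set.range Φ = Set.univ :=
    IsClopen.eq_univ ⟨hprop.isClosedMap.isClosed_range, hopen.isOpen_range⟩ (Set.range_nonempty _)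
  have hbij : Function.Bijective Φ := ⟨hanti.injective, Set.range_eq_univ.mp hrange⟩
  let h : En n ≃ₜ En n := (Equiv.ofBijective Φ hbij).toHomeomorphOfContinuousOpen hΦ.continuous hopen
  have hh : ∀ x, h x = Φ x := fun x => rfl
  refine ⟨h, hh, Homeomorph.contDiff_symm h (f₀' := e) (fun a => ?_) hΦ⟩
  exact (hstr a).hasFDerivAt

lemma rot_real (κ δ d : ℝ) (hκ : 0 < κ) (hκδ : 2 * κ ≤ δ) (hκπ : κ < π / 2)
    (hd : -(π / 2) + δ ≤ Real.arctan d) :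
    Real.sin κ ≤ Real.cos κ + Real.sin κ * d ∧
    Real.arctan ((Real.cos κ * d - Real.sin κ) / (Real.cos κ + Real.sin κ * d)) =
      Real.arctan d - κ ∧
    |(Real.cos κ * d - Real.sin κ) / (Real.cos κ + Real.sin κ * d)| ≤ (Real.sin κ)⁻¹ := by
  set t := Real.arctan d with ht
  have hc0 : 0 < Real.cos t := Real.cos_arctan_pos d
  have hsd : Real.sin t = d * Real.cos t := by
    have h := Real.tan_arctan d
    rw [← ht, Real.tan_eq_sin_div_cos, div_eq_iff hc0.ne'] at h
    exact h
  have hlt := Real.arctan_lt_pi_div_two d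
  rw [← ht] at hlt
  have e1 : Real.cos (t - κ) = Real.cos t * (Real.cos κ + Real.sin κ * d) := by
    rw [Real.cos_sub, hsd]; ring
  have e2 : Real.sin (t - κ) = Real.cos t * (Real.cos κ * d - Real.sin κ) := by
    rw [Real.sin_sub, hsd]; ring
  have hs0 : 0 < Real.sin κ := Real.sin_pos_of_pos_of_lt_pi hκ (by linarith)
  have hge : Real.sin κ ≤ Real.cos (t - κ) := by
    rw [← Real.cos_pi_div_two_sub, ← Real.cos_abs (t - κ)]
    refine Real.cos_le_cos_of_nonneg_of_le_pi (abs_nonneg _) (by linarith) ?_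
    rw [abs_le]; constructor <;> linarith
  have hpos : 0 < Real.cos κ + Real.sin κ * d := by
    have : 0 < Real.cos t * (Real.cos κ + Real.sin κ * d) := by rw [← e1]; linarith
    exact (mul_pos_iff_of_pos_left hc0).mp this
  have e3 : (Real.cos κ * d - Real.sin κ) / (Real.cos κ + Real.sin κ * d) = Real.tan (t - κ) := by
    rw [Real.tan_eq_sin_div_cos, e1, e2, mul_div_mul_left _ _ hc0.ne']
  refine ⟨?_, ?_, ?_⟩
  · have := Real.cos_le_one t
    nlinarith
  · rw [e3, Real.arctan_tan] <;> linarith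
  · rw [e3, Real.tan_eq_sin_div_cos, abs_div, abs_of_pos (hs0.trans_le hge), div_eq_mul_inv]
    calc |Real.sin (t - κ)| * (Real.cos (t - κ))⁻¹ ≤ 1 * (Real.sin κ)⁻¹ := by
          gcongr
          · exact inv_nonneg.mpr (hs0.le.trans hge)
          · exact Real.abs_sin_le_one _
      _ = _ := one_mul _
end
end

section
set_option linter.all false
section
variable {n : ℕ}

lemma bil_dot (A : Mn n) (p q : Dn n) :
    bil A p q = (fun i => p (bv i)) ⬝ᵥ A *ᵥ (fun j => q (bv j)) := by
  unfold bil
  simp only [dotProduct, mulVec, Finset.mul_sum]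
  exact Finset.sum_congr rfl fun i _ => Finset.sum_congr rfl fun j _ => by ring

lemma bil_conj (P B : Mn n) (p q : Dn n) :
    bil (P * B * Pᵀ) p q = bil B (p.comp (Lm P)) (q.comp (Lm P)) := by
  have e : ∀ p : Dn n, (fun i => (p.comp (Lm P)) (bv i)) = Pᵀ *ᵥ (fun i => p (bv i)) := fun p => by
    ext i
    rw [ContinuousLinearMap.comp_apply, clm_sum]
    simp only [Lm_bv, mulVec, dotProduct, Matrix.transpose_apply]
    exact Finset.sum_congr rfl fun j _ => mul_comm _ _
  rw [bil_dot, bil_dot, e, e, ← Matrix.mulVec_mulVec, ← Matrix.mulVec_mulVec, Matrix.dotProduct_mulVec,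
    Matrix.mulVec_transpose, Matrix.mulVec_transpose]

lemma transfer (h : En n ≃ₜ En n) {P : En n → Mn n} (hP : ∀ x, HasFDerivAt h (Lm (P x)) x)
    (hPs : ∀ x, (P x)ᵀ = P x) {B B' : En n → Mn n}
    (hBB : ∀ x, P x * B x * P x = |(P x).det| • B' (h x))
    {f φ : En n → ℝ} (hf : Differentiable ℝ f) (hφ : Differentiable ℝ φ) :
    ∫ y, bil (B' y) (fderiv ℝ f y) (fderiv ℝ φ y) =
      ∫ x, bil (B x) (fderiv ℝ (fun x => f (h x)) x) (fderiv ℝ (fun x => φ (h x)) x) := by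
  have h1 := integral_image_eq_integral_abs_det_fderiv_smul (volume : Measure (En n))
    MeasurableSet.univ (fun x _ => (hP x).hasFDerivWithinAt) h.injective.injOn
    (fun y => bil (B' y) (fderiv ℝ f y) (fderiv ℝ φ y))
  rw [Set.image_univ, h.surjective.range_eq, setIntegral_univ, setIntegral_univ] at h1
  rw [h1]
  congr 1
  ext x
  have c : ∀ {f : En n → ℝ}, Differentiable ℝ f →
      fderiv ℝ (fun x => f (h x)) x = (fderiv ℝ f (h x)).comp (Lm (P x)) := fun {f} hf =>
    ((hf (h x)).hasFDerivAt.comp x (hP x)).fderiv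
  rw [c hf, c hφ, ← bil_conj, hPs, hBB, bil_smul_mat, Lm_det, smul_eq_mul]

lemma Dg.ext {A B O : Mn n} {d d' : Fin n → ℝ} (h : Dg A O d) (h' : Dg B O d') (hd : ∀ i, d i = d' i) :
    A = B := by
  rw [h.eq, h'.eq, show d = d' from funext hd]

lemma pdrv_smooth {u : En n → ℝ} (hu : ContDiff ℝ (⊤ : ℕ∞) u) (i : Fin n) :
    ContDiff ℝ (⊤ : ℕ∞) (fun y => pdrv n i u y) :=
  (hu.fderiv_right (m := (⊤ : ℕ∞)) (by simp)).clm_apply contDiff_const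

lemma hess_MC {u : En n → ℝ} (hu : ContDiff ℝ (⊤ : ℕ∞) u) : MC (⊤ : ℕ∞) (hess n u) := fun i j =>
  pdrv_smooth (pdrv_smooth hu i) j

/-- The gradient map. -/
def Du (u : En n → ℝ) (x : En n) : En n := WithLp.toLp 2 fun i => pdrv n i u x

lemma Du_smooth {u : En n → ℝ} (hu : ContDiff ℝ (⊤ : ℕ∞) u) : ContDiff ℝ (⊤ : ℕ∞) (Du u) :=
  contDiff_euclidean.mpr fun i => pdrv_smooth hu i

lemma Du_deriv {u : En n → ℝ} (hu : ContDiff ℝ (⊤ : ℕ∞) u) (x : En n) :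
    HasFDerivAt (Du u) (Lm (hess n u x)) x := by
  have hd : DifferentiableAt ℝ (Du u) x := (Du_smooth hu).differentiable (by simp) x
  have : Lm (hess n u x) = fderiv ℝ (Du u) x := by
    ext v i
    rw [fderiv_coord hd, Lm_apply, clm_sum]
    rfl
  rw [this]
  exact hd.hasFDerivAt

lemma rot_deriv {u : En n → ℝ} (hu : ContDiff ℝ (⊤ : ℕ∞) u) (a b : ℝ) (x : En n) :
    HasFDerivAt (fun x => a • x + b • Du u x) (Lm (a • 1 + b • hess n u x)) x := by
  have h1 := ((hasFDerivAt_id (𝕜 := ℝ) x).const_smul a).add ((Du_deriv hu x).const_smul b)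
  refine h1.congr_fderiv ?_
  simp only [Lm]
  rw [map_add, map_smul, map_smul, map_one]
  rfl

/-- Relation between the two Laplace-Beltrami coefficient fields. -/
lemma lbc_rel {M N : Mn n} {O : Mn n} {d : Fin n → ℝ} (c s : ℝ) (hcs : c ^ 2 + s ^ 2 = 1)
    (h : Dg M O d) (hp : ∀ i, 0 < c + s * d i)
    (hN : Dg N O (fun i => (c * d i - s) / (c + s * d i))) :
    (c • (1 : Mn n) + s • M) * (Real.sqrt (1 + M * M).det • (1 + M * M)⁻¹) * (c • (1 : Mn n) + s • M) =
      |(c • (1 : Mn n) + s • M).det| • (Real.sqrt (1 + N * N).det • (1 + N * N)⁻¹) := by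
  have hP : Dg (c • (1 : Mn n) + s • M) O (fun i => c + s * d i) :=
    ((h.one.smul c).add (h.smul s)).congr fun i => by ring
  have e : ∀ i, 1 + d i ^ 2 = (c + s * d i) ^ 2 * (1 + ((c * d i - s) / (c + s * d i)) ^ 2) := fun i => by
    have := (hp i).ne'
    rw [div_pow, mul_add, mul_one, mul_div_cancel₀ _ (pow_ne_zero 2 this)]
    linear_combination (-1 - d i ^ 2) * hcs
  have hW : Real.sqrt (1 + M * M).det =
      |(c • (1 : Mn n) + s • M).det| * Real.sqrt (1 + N * N).det := by
    rw [h.gdet, hN.gdet, hP.det, Finset.prod_congr rfl fun i _ => e i, Finset.prod_mul_distrib,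
      Finset.prod_pow, Real.sqrt_mul (sq_nonneg _), Real.sqrt_sq_eq_abs]
  rw [hW]
  refine Dg.ext ((hP.mul (h.ginv.smul _)).mul hP) ((hN.ginv.smul _).smul _) fun i => ?_
  rw [e i]
  have h1 := (hp i).ne'
  have h2 := (gpos ((c * d i - s) / (c + s * d i))).ne'
  rw [mul_inv]
  generalize (1 + ((c * d i - s) / (c + s * d i)) ^ 2)⁻¹ = z
  field_simp

theorem main_aux (n : ℕ) (hn : 2 ≤ n) (u : En n → ℝ) (hu : ContDiff ℝ (⊤ : ℕ∞) u)
    (hsym : ∀ x, (hess n u x).IsHermitian) (δ : ℝ) (hδ : 0 < δ)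
    (hphase : ∀ x, ((n : ℝ) - 2) * (π / 2) + δ < ∑ i, Real.arctan ((hsym x).eigenvalues i))
    (hpde : ∀ x, lapBel n (fun y => 1 + hess n u y * hess n u y)
      (fun y => ∑ i, Real.arctan ((hsym y).eigenvalues i)) x = 0) :
    ∀ x y, hess n u x = hess n u y := by
  set M := hess n u with hMdef
  have hM : MC (⊤ : ℕ∞) M := hess_MC hu
  choose O hO using fun x => exists_dg (hsym x)
  set d : En n → Fin n → ℝ := fun x => (hsym x).eigenvalues with hddef
  have hMs : ∀ x, (M x)ᵀ = M x := fun x => (hO x).symm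
  have hn0 : (2 : ℝ) ≤ n := by exact_mod_cast hn
  have hsingle : ∀ x i, -(π / 2) + δ ≤ Real.arctan (d x i) := fun x i => by
    have h1 := hphase x
    rw [← Finset.add_sum_erase _ _ (Finset.mem_univ i)] at h1
    have h2 : ∑ j ∈ Finset.univ.erase i, Real.arctan ((hsym x).eigenvalues j) ≤ ((n : ℝ) - 1) * (π / 2) := by
      refine (Finset.sum_le_card_nsmul _ _ (π / 2) fun j _ => (Real.arctan_lt_pi_div_two _).le).trans ?_
      rw [Finset.card_erase_of_mem (Finset.mem_univ i), Finset.card_univ, Fintype.card_fin, nsmul_eq_mul,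
        Nat.cast_sub (by omega), Nat.cast_one]
    simp only [hddef]
    linarith
  have hδπ : δ < π := by
    have h1 := hsingle 0 ⟨0, by omega⟩
    have h2 := Real.arctan_lt_pi_div_two (d 0 ⟨0, by omega⟩)
    linarith
  set κ : ℝ := δ / (2 * n) with hκdef
  have hκ : 0 < κ := by positivity
  have hnκ : n * κ = δ / 2 := by rw [hκdef]; field_simp
  have hκδ : 2 * κ ≤ δ := by nlinarith
  have hκπ : κ < π / 2 := by linarith
  set c := Real.cos κ with hc
  set s := Real.sin κ with hs
  have hcs : c ^ 2 + s ^ 2 = 1 := Real.cos_sq_add_sin_sq κ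
  have hs0 : 0 < s := Real.sin_pos_of_pos_of_lt_pi hκ (by linarith [Real.pi_pos])
  have hrot := fun x i => rot_real κ δ (d x i) hκ hκδ hκπ (hsingle x i)
  have hpos : ∀ x i, 0 < c + s * d x i := fun x i => hs0.trans_le (hrot x i).1
  set P : En n → Mn n := fun x => c • (1 : Mn n) + s • M x with hPdef
  set Q : En n → Mn n := fun x => (-s) • (1 : Mn n) + c • M x with hQdef
  have hPd : ∀ x, Dg (P x) (O x) (fun i => c + s * d x i) := fun x =>
    (((hO x).one.smul c).add ((hO x).smul s)).congr fun i => by ring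
  have hQd : ∀ x, Dg (Q x) (O x) (fun i => c * d x i - s) := fun x =>
    (((hO x).one.smul (-s)).add ((hO x).smul c)).congr fun i => by ring
  have hPs : ∀ x, (P x)ᵀ = P x := fun x => (hPd x).symm
  have hPdet : ∀ x, (P x).det ≠ 0 := fun x => by
    rw [(hPd x).det]
    exact Finset.prod_ne_zero_iff.mpr fun i _ => (hpos x i).ne'
  -- the rotated coordinates
  have hΦs : ContDiff ℝ (⊤ : ℕ∞) (fun x => c • x + s • Du u x) :=
    (contDiff_id.const_smul c).add ((Du_smooth hu).const_smul s)
  have hGs : ContDiff ℝ (⊤ : ℕ∞) (fun x => (-s) • x + c • Du u x) :=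
    (contDiff_id.const_smul (-s)).add ((Du_smooth hu).const_smul c)
  obtain ⟨h, hh, hsymm⟩ := diffeo hΦs (P := P) (fun x => rot_deriv hu c s x) s hs0
    (fun x w => (hPd x).inner_ge s (fun i => (hrot x i).1) w)
  have hhf : (h : En n → En n) = fun x => c • x + s • Du u x := funext hh
  have hhs : ContDiff ℝ (⊤ : ℕ∞) h := by rw [hhf]; exact hΦs
  have hP' : ∀ x, HasFDerivAt h (Lm (P x)) x := fun x => by rw [hhf]; exact rot_deriv hu c s x
  -- the rotated Hessian
  have hPMC : MC (⊤ : ℕ∞) P := (MC.const _).add (MC.smul contDiff_const hM)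
  have hQMC : MC (⊤ : ℕ∞) Q := (MC.const _).add (MC.smul contDiff_const hM)
  set N : En n → Mn n := fun y => Q (h.symm y) * (P (h.symm y))⁻¹ with hNdef
  have hN : MC (⊤ : ℕ∞) N := by
    have h1 : MC (⊤ : ℕ∞) (fun x => Q x * (P x)⁻¹) := hQMC.mul (hPMC.inv hPdet)
    exact fun i j => (h1 i j).comp hsymm
  have hNd : ∀ x, Dg (N (h x)) (O x) (fun i => (c * d x i - s) / (c + s * d x i)) := fun x => by
    simp only [hNdef, Homeomorph.symm_apply_apply]
    exact ((hQd x).mul ((hPd x).inv fun i => (hpos x i).ne')).congr fun i => (div_eq_mul_inv _ _).symm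
  have hNs : ∀ y, (N y)ᵀ = N y := fun y => by
    have := (hNd (h.symm y)).symm
    rwa [h.apply_symm_apply] at this
  -- total symmetry
  let G : En n → En n := fun y => (-s) • h.symm y + c • Du u (h.symm y)
  have hG : ContDiff ℝ (⊤ : ℕ∞) G := hGs.comp hsymm
  have hGd : ∀ y, fderiv ℝ G y = Lm (N y) := fun y => by
    obtain ⟨x, rfl⟩ := h.surjective y
    have h1 := ((hG.differentiable (by simp) (h x)).hasFDerivAt).comp x (hP' x)
    have h2 : (G ∘ h) = fun x => (-s) • x + c • Du u x := by
      ext1 z; simp [G]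
    rw [h2] at h1
    have h3 : (fderiv ℝ G (h x)).comp (Lm (P x)) = Lm (Q x) := h1.unique (rot_deriv hu (-s) c x)
    have h4 : (P x) * (P x)⁻¹ = 1 := Matrix.mul_nonsing_inv _ (isUnit_iff_ne_zero.mpr (hPdet x))
    simp only [hNdef, Homeomorph.symm_apply_apply]
    calc fderiv ℝ G (h x) = (fderiv ℝ G (h x)).comp (Lm (P x * (P x)⁻¹)) := by
          rw [h4]; ext1 v; simp [Lm]
      _ = ((fderiv ℝ G (h x)).comp (Lm (P x))).comp (Lm (P x)⁻¹) := by
          simp only [Lm]; rw [map_mul]; rfl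
      _ = _ := by rw [h3]; simp only [Lm]; rw [map_mul]; rfl
  have hGi : ∀ i, ContDiff ℝ (⊤ : ℕ∞) (fun y => G y i) := fun i => contDiff_euclidean.mp hG i
  have hNG : ∀ y i j, N y i j = fderiv ℝ (fun y => G y i) y (bv j) := fun y i j => by
    rw [← fderiv_coord (hG.differentiable (by simp) y), hGd, Lm_bv]
  have htot : ∀ y i j k, dmat N y (bv k) i j = dmat N y (bv j) i k := fun y i j k => by
    simp only [dmat, Matrix.of_apply]
    simp_rw [hNG]
    exact fd_comm (hGi i) y (bv j) (bv k)
  -- the phase is constant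
  have hθ : (fun y => ∑ i, Real.arctan ((hsym y).eigenvalues i)) = fun y => Th (M y) :=
    funext fun y => (Th_dg (hO y)).symm
  have hTh2 : ContDiff ℝ 2 (fun y => Th (M y)) := Th_smooth hM hMs
  have hpde' : ∀ x, ∑ i, ∑ j, pdrv n j (fun y => lbc M y i j * pdrv n i (fun y => Th (M y)) y) x = 0 := by
    intro x
    have := hpde x
    rw [hθ] at this
    exact this
  have hweak : ∀ φ : En n → ℝ, ContDiff ℝ 1 φ → HasCompactSupport φ →
      ∫ x, bil (lbc M x) (fderiv ℝ (fun y => Th (M y)) x) (fderiv ℝ φ x) = 0 := fun φ hφ hφc => by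
    rw [weak_form (lbc_MC hM hMs).one hTh2 hφ hφc]
    simp [hpde']
  have hbound : ∀ x i, |(c * d x i - s) / (c + s * d x i)| ≤ s⁻¹ := fun x i => (hrot x i).2.2
  obtain ⟨lam, Lam, hlam, hell⟩ := lbc_ell hN s⁻¹ fun y =>
    ⟨O (h.symm y), _, by have := hNd (h.symm y); rwa [h.apply_symm_apply] at this,
      fun i => hbound (h.symm y) i⟩
  let tht : En n → ℝ := fun y => Th (M (h.symm y))
  have htht : ContDiff ℝ 1 tht := (hTh2.of_le (by norm_num)).comp (hsymm.of_le (by exact_mod_cast le_top))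
  have hweak' : ∀ φ : En n → ℝ, ContDiff ℝ 1 φ → HasCompactSupport φ →
      ∫ y, bil (lbc N y) (fderiv ℝ tht y) (fderiv ℝ φ y) = 0 := fun φ hφ hφc => by
    rw [transfer h hP' hPs (B := lbc M) (B' := lbc N) (fun x => lbc_rel c s hcs (hO x) (hpos x) (hNd x))
      (diff_of_C1 htht) (diff_of_C1 hφ)]
    simp only [tht, Homeomorph.symm_apply_apply]
    exact hweak _ (hφ.comp (hhs.of_le (by exact_mod_cast le_top))) (hφc.comp_homeomorph h)
  have hsub1 : IsSub (lbc N) tht := fun φ hφ hφc _ => (hweak' φ hφ hφc).le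
  have hsub2 : IsSub (lbc N) (fun y => - tht y) := fun φ hφ hφc _ => by
    have e : ∀ y, bil (lbc N y) (fderiv ℝ (fun y => - tht y) y) (fderiv ℝ φ y) =
        - bil (lbc N y) (fderiv ℝ tht y) (fderiv ℝ φ y) := fun y => by
      have : fderiv ℝ (fun y => - tht y) y = (-1 : ℝ) • fderiv ℝ tht y := by
        rw [fderiv_fun_neg]; simp
      rw [this, bil_smul_left]; ring
    simp_rw [e]
    rw [integral_neg, hweak' φ hφ hφc, neg_zero]
  have hθb : ∀ y, |tht y| ≤ n * (π / 2) := fun y => by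
    simp only [tht]
    rw [Th_dg (hO (h.symm y))]
    refine (Finset.abs_sum_le_sum_abs _ _).trans ?_
    refine (Finset.sum_le_card_nsmul _ _ (π / 2) fun j _ => ?_).trans ?_
    · exact abs_le.mpr ⟨(Real.neg_pi_div_two_lt_arctan _).le, (Real.arctan_lt_pi_div_two _).le⟩
    · simp
  have hconst := liouville n hn hlam hell tht htht hsub1 hsub2 _ hθb
  -- apply the constant phase theorem
  have hsum : ∀ x, ∑ i, Real.arctan ((c * d x i - s) / (c + s * d x i)) = Th (M x) - δ / 2 := fun x => by
    rw [Th_dg (hO x), Finset.sum_congr rfl fun i _ => (hrot x i).2.1, Finset.sum_sub_distrib]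
    simp only [Finset.sum_const, Finset.card_univ, Fintype.card_fin, nsmul_eq_mul, hnκ]
    rfl
  have hTh0 : ∀ x, Th (M x) = Th (M 0) := fun x => by
    have := hconst (h x) (h 0)
    simpa [tht] using this
  obtain ⟨A, hA⟩ := const_phase hn hN s⁻¹ (Th (M 0) - δ / 2) (by
      rw [Th_dg (hO 0)]
      have := hphase 0
      linarith) (fun y => ⟨O (h.symm y), _, by
        have := hNd (h.symm y); rwa [h.apply_symm_apply] at this,
        fun i => hbound (h.symm y) i, by rw [hsum, hTh0]⟩) htot
  -- invert the rotation
  have hinv : ∀ x, P x * (c • (1 : Mn n) + (-s) • A) = 1 := fun x => by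
    rw [← hA (h x)]
    refine Dg.ext ((hPd x).mul (((hO x).one.smul c).add ((hNd x).smul (-s)))) (hO x).one fun i => ?_
    have := (hpos x i).ne'
    field_simp
    linear_combination hcs
  have hPc : ∀ x y, P x = P y := fun x y => by
    have h1 : (c • (1 : Mn n) + (-s) • A) * P y = 1 := by
      rw [mul_eq_one_comm]; exact hinv y
    calc P x = P x * ((c • (1 : Mn n) + (-s) • A) * P y) := by rw [h1, mul_one]
      _ = P y := by rw [← mul_assoc, hinv, one_mul]
  intro x y
  have h1 := hPc x y
  simp only [hPdef, add_right_inj] at h1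
  exact smul_right_injective _ hs0.ne' h1
end
end

/-- Bernstein theorem for the Hamiltonian stationary equation: an entire smooth solution of
`Δ_g θ = 0` whose Lagrangian phase `θ = ∑ arctan λᵢ(D²u)` satisfies
`θ > (n-2)π/2 + δ` everywhere must have constant Hessian (i.e. `u` is a quadratic and the
gradient graph is a plane). -/
theorem bernstein_hamiltonian_stationary
    (n : ℕ) (hn : 2 ≤ n)
    (u : En n → ℝ) (hu : ContDiff ℝ (⊤ : ℕ∞) u)
    (hsym : ∀ x, (hess n u x).IsHermitian)
    (δ : ℝ) (hδ : 0 < δ)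
    (hphase : ∀ x,
      ((n : ℝ) - 2) * (π / 2) + δ < ∑ i, Real.arctan ((hsym x).eigenvalues i))
    (hpde : ∀ x, lapBel n (fun y => 1 + hess n u y * hess n u y)
      (fun y => ∑ i, Real.arctan ((hsym y).eigenvalues i)) x = 0) :
    ∀ x y, hess n u x = hess n u y := by
  exact main_aux n hn u hu hsym δ hδ hphase hpde
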